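/- Let G be a 1-tough finite simple graph on n ≥ 11 vertices such that σ_2(G) ≥ n − 4, where σ_2(G) denotes the minimum of deg(u) + deg(v) over all pairs of distinct non-adjacent vertices u, v of G. Then G is Hamiltonian. -/

import Mathlib

universe u
/-- A graph is *tough* if for every set `S` of vertices whose removal disconnects the
graph, the number of connected components of `G − S` is at most `|S|`. -/
def SimpleGraph.Tough {V : Type*} (G : SimpleGraph V) : Prop :=
  ∀ S : Finset V, ¬ (G.induce ((S : Set V)ᶜ)).Connected →
    Nat.card (G.induce ((S : Set V)ᶜ)).ConnectedComponent ≤ S.card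


/-- A graph is *Hamiltonian* if it contains a cycle passing through every vertex
exactly once. -/
def SimpleGraph.IsHamiltonianGraph {V : Type*} (G : SimpleGraph V) : Prop :=
  ∃ (a : V) (p : G.Walk a a), p.IsCycle ∧ ∀ v : V, v ∈ p.support



namespace HT
variable {V : Type u} {G : SimpleGraph V}

/-- A list forming a path-like chain from `a` to `b`. -/
def Pth (G : SimpleGraph V) (a : V) (l : List V) (b : V) : Prop :=
  l.IsChain G.Adj ∧ l.head? = some a ∧ l.getLast? = some b

theorem Pth.single (a : V) : Pth G a [a] a := by simp [Pth]

theorem Pth.ne_nil {a b : V} {l : List V} (h : Pth G a l b) : l ≠ [] := by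
  rintro rfl; simp [Pth] at h

theorem Pth.app {a b c d : V} {l m : List V} (h : Pth G a l b) (e : G.Adj b c)
    (h' : Pth G c m d) : Pth G a (l ++ m) d := by
  obtain ⟨h1, h2, h3⟩ := h
  obtain ⟨k1, k2, k3⟩ := h'
  refine ⟨?_, ?_, ?_⟩
  · rw [List.isChain_append]
    refine ⟨h1, k1, ?_⟩
    intro x hx y hy
    simp_all
  · simp [List.head?_append, h2]
  · simp [List.getLast?_append, k3]

theorem Pth.cons {a c d : V} {m : List V} (e : G.Adj a c)
    (h' : Pth G c m d) : Pth G a (a :: m) d := (Pth.single a).app e h'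

theorem Pth.rev {a b : V} {l : List V} (h : Pth G a l b) : Pth G b l.reverse a := by
  obtain ⟨h1, h2, h3⟩ := h
  refine ⟨?_, ?_, ?_⟩
  · rw [List.isChain_reverse]
    exact h1.imp (fun _ _ h => h.symm)
  · simpa using h3
  · simpa using h2

theorem Pth.head_mem {a b : V} {l : List V} (h : Pth G a l b) : a ∈ l :=
  List.mem_of_mem_head? (by simp [h.2.1])

theorem Pth.last_mem {a b : V} {l : List V} (h : Pth G a l b) : b ∈ l := by
  have := h.rev.head_mem; simpa using this

theorem Pth.of_chain {l : List V} (h : l.IsChain G.Adj) (hne : l ≠ []) :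
    ∃ a b, Pth G a l b :=
  ⟨l.head hne, l.getLast hne, h, List.head?_eq_some_head hne, List.getLast?_eq_some_getLast hne⟩

theorem Pth.split {a b : V} {l m : List V} (h : Pth G a (l ++ m) b) (hl : l ≠ []) (hm : m ≠ []) :
    ∃ c d, Pth G a l c ∧ G.Adj c d ∧ Pth G d m b := by
  obtain ⟨h1, h2, h3⟩ := h
  rw [List.isChain_append] at h1
  obtain ⟨c1, c2, c3⟩ := h1
  refine ⟨l.getLast hl, m.head hm, ⟨c1, ?_, List.getLast?_eq_some_getLast hl⟩, ?_,
    ⟨c2, List.head?_eq_some_head hm, ?_⟩⟩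
  · rw [List.head?_append_of_ne_nil _ hl] at h2; exact h2
  · apply c3
    · simp [List.getLast?_eq_some_getLast hl]
    · simp [List.head?_eq_some_head hm]
  · rw [List.getLast?_append_of_ne_nil _ hm] at h3; exact h3

theorem Pth.head_eq {a b x : V} {l : List V} (h : Pth G a (x :: l) b) : x = a := by
  simpa using h.2.1

theorem Pth.last_eq {a b x : V} {l : List V} (h : Pth G a (l ++ [x]) b) : x = b := by
  simpa using h.2.2

theorem Pth.tail {a b x : V} {l : List V} (h : Pth G a (x :: l) b) (hl : l ≠ []) :
    ∃ d, G.Adj a d ∧ Pth G d l b := by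
  have := h.head_eq
  subst this
  obtain ⟨c, d, h1, h2, h3⟩ := Pth.split (l := [x]) h (by simp) hl
  have := h1.2.2
  simp at this
  subst this
  exact ⟨d, h2, h3⟩

theorem Pth.unique {a b a' b' : V} {l : List V} (h : Pth G a l b) (h' : Pth G a' l b') :
    a = a' ∧ b = b' := by
  have h1 := h.2.1; rw [h'.2.1] at h1
  have h2 := h.2.2; rw [h'.2.2] at h2
  simp at h1 h2; exact ⟨h1.symm, h2.symm⟩

/-- A list forming a closed chain. -/
def Cyc (G : SimpleGraph V) (l : List V) : Prop := ∃ a b, Pth G a l b ∧ G.Adj b a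

theorem Cyc.rot {l m : List V} (h : Cyc G (l ++ m)) : Cyc G (m ++ l) := by
  by_cases hl : l = []
  · subst hl; simpa using h
  by_cases hm : m = []
  · subst hm; simpa using h
  obtain ⟨a, b, h1, h2⟩ := h
  obtain ⟨c, d, k1, k2, k3⟩ := h1.split hl hm
  exact ⟨d, c, k3.app h2 k1, k2⟩

theorem Cyc.rev {l : List V} (h : Cyc G l) : Cyc G l.reverse := by
  obtain ⟨a, b, h1, h2⟩ := h
  exact ⟨b, a, h1.rev, h2.symm⟩

/-- 0/1 indicator, hidden from the arithmetic tactics. -/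
def ind [DecidableEq V] (a z : V) : ℕ := if a = z then 1 else 0

theorem cnt_cons [DecidableEq V] (z a : V) (l : List V) :
    List.count z (a :: l) = ind a z + List.count z l := by
  simp [List.count_cons, ind]; omega

theorem perm_of_cnt [DecidableEq V] {l m : List V} (h : ∀ z, l.count z = m.count z) : l.Perm m :=
  List.perm_iff_count.2 h

theorem Pth.shorten {a b : V} {l : List V} (h : Pth G a l b) :
    ∃ l', Pth G a l' b ∧ l'.Nodup ∧ l' ⊆ l := by
  classical
  induction hn : l.length using Nat.strong_induction_on generalizing l with
  | _ n ih =>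
    by_cases hd : l.Nodup
    · exact ⟨l, h, hd, List.Subset.refl _⟩
    · rw [← List.exists_duplicate_iff_not_nodup] at hd
      obtain ⟨x, hx⟩ := hd
      rw [List.duplicate_iff_sublist] at hx
      have : ∃ l1 l2 l3, l = l1 ++ x :: l2 ++ x :: l3 := by
        have hx1 : x ∈ l := hx.subset (by simp)
        obtain ⟨l1, l2, e, hl1⟩ := List.eq_append_cons_of_mem hx1
        have : x ∈ l2 := by
          by_contra hl2
          have := hx.count_le x
          rw [e] at this
          simp [List.count_eq_zero_of_not_mem hl1, List.count_eq_zero_of_not_mem hl2] at this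
        obtain ⟨m1, m2, e2⟩ := List.append_of_mem this
        exact ⟨l1, m1, m2, by rw [e, e2]; simp⟩
      obtain ⟨l1, l2, l3, e⟩ := this
      have hp : Pth G a (l1 ++ x :: l3) b := by
        subst e
        obtain ⟨h1, h2, h3⟩ := h
        refine ⟨?_, ?_, ?_⟩
        · rw [List.append_assoc, List.isChain_append] at h1
          obtain ⟨c1, c2, c3⟩ := h1
          rw [List.isChain_append] at c2
          rw [List.isChain_append]
          refine ⟨c1, c2.2.1, ?_⟩
          intro y hy z hz
          apply c3 y hy
          simpa using hz
        · cases l1 <;> simpa using h2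
        · rw [List.getLast?_append_of_ne_nil _ (by simp)] at h3 ⊢
          exact h3
      obtain ⟨l', p1, p2, p3⟩ := ih _ (by rw [← hn, e]; simp) hp rfl
      refine ⟨l', p1, p2, fun y hy => ?_⟩
      have := p3 hy
      rw [e]; simp at this ⊢; tauto

/-- Chain of membership in a list along a walk: connectivity gives a path. -/
theorem Pth.trans' {a b c : V} {l m : List V} (h : Pth G a l b) (h' : Pth G b m c) :
    ∃ k, Pth G a k c ∧ k ⊆ l ++ m := by
  by_cases hm : m = [b]
  · subst hm
    have := (h'.unique (Pth.single b)).2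
    subst this
    exact ⟨l, h, by simp⟩
  · cases m with
    | nil => exact absurd rfl h'.ne_nil
    | cons x m =>
      have := h'.head_eq
      subst this
      have hm' : m ≠ [] := by rintro rfl; exact hm rfl
      obtain ⟨d, e1, e2⟩ := h'.tail hm'
      exact ⟨l ++ m, h.app e1 e2, by intro y; simp; tauto⟩

end HT

namespace HT
variable {V : Type u} {G : SimpleGraph V}

theorem tough_label [Finite V] (ht : G.Tough) {ι : Type u} (S T : Finset V) (f : V → ι)
    (hf : ∀ u v, u ∉ S → v ∉ S → G.Adj u v → f u = f v) (hTS : ∀ v ∈ T, v ∉ S)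
    (hinj : ∀ u ∈ T, ∀ v ∈ T, f u = f v → u = v) (h2 : 2 ≤ T.card) : T.card ≤ S.card := by
  classical
  set H := G.induce ((S : Set V)ᶜ) with hH
  have hreach : ∀ (u v : ((S : Set V)ᶜ : Set V)), H.Reachable u v → f u.1 = f v.1 := by
    rintro u v ⟨w⟩
    induction w with
    | nil => rfl
    | @cons a b c h p ih =>
      rw [← ih]
      exact hf _ _ (fun h' => a.2 h') (fun h' => b.2 h') h
  have hnc : ¬ H.Connected := by
    intro hc
    obtain ⟨a, ha, b, hb, hab⟩ := Finset.one_lt_card.1 (show 1 < T.card by omega)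
    exact hab (hinj a ha b hb (hreach ⟨a, by simpa using hTS a ha⟩ ⟨b, by simpa using hTS b hb⟩
      (hc.preconnected _ _)))
  refine le_trans ?_ (ht S hnc)
  have : Nat.card T = T.card := by simp
  rw [← this]
  apply Nat.card_le_card_of_injective
    (fun t : T => H.connectedComponentMk ⟨t.1, by simpa using hTS t.1 t.2⟩)
  intro a b hab
  have := SimpleGraph.ConnectedComponent.exact hab
  exact Subtype.ext (hinj _ a.2 _ b.2 (hreach _ _ this))

theorem ham_of_list [Fintype V] (h3 : 3 ≤ Fintype.card V) (l : List V) (hl : l.Nodup)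
    (hc : Cyc G l) (hlen : Fintype.card V ≤ l.length) : G.IsHamiltonianGraph := by
  classical
  obtain ⟨a, b, hp, hba⟩ := hc
  have hall : ∀ v, v ∈ l := by
    intro v
    have h1 : l.toFinset = Finset.univ := by
      apply Finset.eq_univ_of_card
      have := l.toFinset.card_le_univ
      rw [List.toFinset_card_of_nodup hl] at *
      omega
    have : v ∈ l.toFinset := by rw [h1]; simp
    simpa using this
  have hne := hp.ne_nil
  have hca : l.head hne = a := by
    have := hp.2.1; rw [List.head?_eq_some_head hne] at this; simpa using this
  have hcb : l.getLast hne = b := by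
    have := hp.2.2; rw [List.getLast?_eq_some_getLast hne] at this; simpa using this
  have hw : ∃ p : G.Walk a b, p.support = l := by
    refine ⟨(SimpleGraph.Walk.ofSupport l hne hp.1).copy hca hcb, ?_⟩
    simp
  obtain ⟨p, hps⟩ := hw
  refine ⟨b, SimpleGraph.Walk.cons hba p, ?_, ?_⟩
  · rw [SimpleGraph.Walk.cons_isCycle_iff]
    have hpp : p.IsPath := by
      rw [SimpleGraph.Walk.isPath_def, hps]; exact hl
    refine ⟨hpp, ?_⟩
    intro he
    have hlen2 : p.length + 1 = l.length := by
      rw [← hps]; simp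
    cases p with
    | nil => exact G.loopless.irrefl _ hba
    | @cons _ c _ hac q =>
      simp only [SimpleGraph.Walk.edges_cons, List.mem_cons] at he
      rw [SimpleGraph.Walk.cons_isPath_iff] at hpp
      rcases he with he | he
      · have : b = c := by
          simp only [Sym2.eq, Sym2.rel_iff', Prod.mk.injEq, Prod.swap_prod_mk] at he
          rcases he with ⟨h1, h2⟩ | ⟨h1, h2⟩
          · exact absurd h1 hba.ne
          · exact h1
        subst this
        have : q = SimpleGraph.Walk.nil := by
          have := hpp.1
          exact SimpleGraph.Walk.eq_nil_iff_nil.2 (SimpleGraph.Walk.isPath_iff_nil.1 this)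
        subst this
        simp at hlen2
        omega
      · exact hpp.2 (SimpleGraph.Walk.snd_mem_support_of_mem_edges _ he)
  · intro v
    have := hall v
    rw [← hps] at this
    simp [this]

/-- The standing hypotheses of the proof by contradiction. -/
structure Ctx [Fintype V] [DecidableEq V] (G : SimpleGraph V) [DecidableRel G.Adj] : Prop where
  n11 : 11 ≤ Fintype.card V
  tough : G.Tough
  sig : ∀ u v : V, u ≠ v → ¬ G.Adj u v → Fintype.card V ≤ G.degree u + G.degree v + 4
  nonham : ∀ l : List V, l.Nodup → Cyc G l → l.length < Fintype.card V

section tough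
variable [Fintype V] [DecidableEq V]

theorem tough_iso (ht : G.Tough) (I S : List V) (hI : I.Nodup) (hd : ∀ v ∈ I, v ∉ S)
    (hN : ∀ v ∈ I, ∀ w, G.Adj v w → w ∈ S) (h2 : 2 ≤ I.length) : I.length ≤ S.length := by
  have := tough_label ht S.toFinset I.toFinset (fun v => if v ∈ I then some v else none)
    (by
      intro u v hu hv huv
      have h1 : u ∉ I := fun h => hv (by simpa using hN u h v huv)
      have h2 : v ∉ I := fun h => hu (by simpa using hN v h u huv.symm)
      simp [h1, h2])
    (by simpa using hd) (by
      intro u hu v hv h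
      simp only [List.mem_toFinset] at hu hv
      simpa [hu, hv] using h) (by rw [List.toFinset_card_of_nodup hI]; exact h2)
  rw [List.toFinset_card_of_nodup hI] at this
  exact this.trans (List.toFinset_card_le S)

theorem tough_iso3 (ht : G.Tough) (I S : List V) (P : V → Prop) (hI : I.Nodup)
    (hd : ∀ v ∈ I, v ∉ S)
    (hN : ∀ v ∈ I, ∀ w, G.Adj v w → w ∈ S)
    (hP : ∀ u v, u ∉ S → v ∉ S → u ∉ I → v ∉ I → G.Adj u v → P u → P v)
    (p q : V) (hp : P p) (hq : ¬ P q) (hpS : p ∉ S) (hqS : q ∉ S) (hpI : p ∉ I) (hqI : q ∉ I) :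
    I.length + 2 ≤ S.length := by
  classical
  have hnd : (p :: q :: I).Nodup := by
    simp only [List.nodup_cons, List.mem_cons, not_or]
    exact ⟨⟨fun h => hq (h ▸ hp), hpI⟩, hqI, hI⟩
  have := tough_label ht S.toFinset (p :: q :: I).toFinset
    (fun v => if v ∈ I then v else if P v then p else q)
    (by
      intro u v hu hv huv
      simp only [List.mem_toFinset] at hu hv
      have h1 : u ∉ I := fun h => hv (by simpa using hN u h v huv)
      have h2 : v ∉ I := fun h => hu (by simpa using hN v h u huv.symm)
      have h3 : P u ↔ P v := ⟨hP u v hu hv h1 h2 huv, hP v u hv hu h2 h1 huv.symm⟩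
      simp [h1, h2, h3])
    (by
      intro v hv
      simp only [List.mem_toFinset, List.mem_cons] at hv ⊢
      rcases hv with rfl | rfl | hv
      · exact hpS
      · exact hqS
      · exact hd v hv) (by
      have key : ∀ u ∈ (p :: q :: I).toFinset,
          (if u ∈ I then u else if P u then p else q) = u := by
        intro u hu
        simp only [List.mem_toFinset, List.mem_cons] at hu
        rcases hu with rfl | rfl | hu
        · simp [hp]
        · simp [hq]
        · simp [hu]
      intro u hu v hv h
      simp only [key u hu, key v hv] at h
      exact h) (by rw [List.toFinset_card_of_nodup hnd]; simp)
  rw [List.toFinset_card_of_nodup hnd] at this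
  have := this.trans (List.toFinset_card_le S)
  simp at this
  omega

theorem tough_iso2 (ht : G.Tough) (I S : List V) (hI : I.Nodup) (hd : ∀ v ∈ I, v ∉ S)
    (hN : ∀ v ∈ I, ∀ w, G.Adj v w → w ∈ S) (hne : I ≠ []) (q : V) (hqI : q ∉ I) (hqS : q ∉ S) :
    I.length + 1 ≤ S.length := by
  have hnd : (q :: I).Nodup := by simp [hqI, hI]
  have hlen : 1 ≤ I.length := List.length_pos_iff.2 hne
  have := tough_label ht S.toFinset (q :: I).toFinset
    (fun v => if v ∈ I then v else q)
    (by
      intro u v hu hv huv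
      simp only [List.mem_toFinset] at hu hv
      have h1 : u ∉ I := fun h => hv (by simpa using hN u h v huv)
      have h2 : v ∉ I := fun h => hu (by simpa using hN v h u huv.symm)
      simp [h1, h2])
    (by
      intro v hv
      simp only [List.mem_toFinset, List.mem_cons] at hv ⊢
      rcases hv with rfl | hv
      · exact hqS
      · exact hd v hv) (by
      have key : ∀ u ∈ (q :: I).toFinset,
          (if u ∈ I then u else q) = u := by
        intro u hu
        simp only [List.mem_toFinset, List.mem_cons] at hu
        rcases hu with rfl | hu
        · simp
        · simp [hu]
      intro u hu v hv h
      simp only [key u hu, key v hv] at h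
      exact h) (by rw [List.toFinset_card_of_nodup hnd]; simp; omega)
  rw [List.toFinset_card_of_nodup hnd] at this
  simpa using this.trans (List.toFinset_card_le S)

theorem deg_le_list [DecidableRel G.Adj] (v : V) (l : List V) (h : ∀ w, G.Adj v w → w ∈ l) :
    G.degree v ≤ l.length := by
  rw [← SimpleGraph.card_neighborFinset_eq_degree]
  refine le_trans (Finset.card_le_card (t := l.toFinset) ?_) (List.toFinset_card_le l)
  intro w hw
  simp at hw ⊢
  exact h w hw

end tough

/-- `C` is a longest cycle. -/
def IsMx (G : SimpleGraph V) (C : List V) : Prop :=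
  C.Nodup ∧ Cyc G C ∧ ∀ l : List V, l.Nodup → Cyc G l → l.length ≤ C.length

/-- Some longest cycle misses `y`. -/
def Missable (G : SimpleGraph V) (y : V) : Prop := ∃ C, IsMx G C ∧ y ∉ C

theorem IsMx.perm {C C' : List V} (h : IsMx G C) (hc : Cyc G C') (hp : C'.Perm C) : IsMx G C' :=
  ⟨hp.nodup_iff.2 h.1, hc, fun l h1 h2 => hp.length_eq ▸ h.2.2 l h1 h2⟩

theorem IsMx.rot {l m : List V} (h : IsMx G (l ++ m)) : IsMx G (m ++ l) :=
  h.perm h.2.1.rot List.perm_append_comm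

theorem IsMx.rev {l : List V} (h : IsMx G l) : IsMx G l.reverse :=
  h.perm h.2.1.rev (List.reverse_perm l)

/-- No cycle through the whole of a longest cycle and a further nonempty list. -/
theorem IsMx.no {C l O : List V} (h : IsMx G C) (hO : O.Nodup) (hOC : ∀ y ∈ O, y ∉ C)
    (hc : Cyc G l) (hp : l.Perm (O ++ C)) (hne : O ≠ []) : False := by
  have hnd : l.Nodup := hp.nodup_iff.2 (by
    rw [List.nodup_append]
    exact ⟨hO, h.1, fun a ha b hb hab => hOC a ha (hab ▸ hb)⟩)
  have := h.2.2 l hnd hc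
  rw [hp.length_eq, List.length_append] at this
  have := List.length_pos_iff.2 hne
  omega

theorem IsMx.no1 {C l : List V} {x : V} (h : IsMx G C) (hx : x ∉ C)
    (hc : Cyc G l) (hp : l.Perm (x :: C)) : False :=
  h.no (O := [x]) (by simp) (by simpa using hx) hc hp (by simp)

/-- A cycle swapping `w` for `x` is again longest. -/
theorem IsMx.swap {C l : List V} {x w : V} (h : IsMx G C) (hx : x ∉ C)
    (hc : Cyc G l) (hp : (w :: l).Perm (x :: C)) : IsMx G l ∧ w ∉ l := by
  have hnd : (w :: l).Nodup := hp.nodup_iff.2 (by simp [hx, h.1])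
  simp at hnd
  refine ⟨⟨hnd.2, hc, fun m h1 h2 => ?_⟩, hnd.1⟩
  have := hp.length_eq
  simp at this
  rw [this]; exact h.2.2 m h1 h2

theorem IsMx.insert {C : List V} {y p q : V} {m : List V} (h : IsMx G C) (hy : y ∉ C)
    (e : C = m ++ [p, q]) (h1 : G.Adj y p) (h2 : G.Adj y q) : False := by
  have hc : Cyc G ([q] ++ (m ++ [p])) := by
    have := h.2.1
    rw [e, show m ++ [p, q] = (m ++ [p]) ++ [q] by simp] at this
    exact this.rot
  classical
  obtain ⟨a, b, k1, k2⟩ := hc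
  have e1 := Pth.head_eq k1
  have e2 : p = b := Pth.last_eq (l := [q] ++ m) (by simpa using k1)
  subst e1; subst e2
  refine h.no1 (x := y) hy (l := y :: ([q] ++ (m ++ [p]))) ⟨_, _, k1.cons h2, h1.symm⟩ ?_
  subst e
  refine perm_of_cnt fun z => ?_
  simp only [cnt_cons, List.count_append, List.count_nil]; omega

end HT

namespace HT
variable {V : Type u} {G : SimpleGraph V}

theorem count3 (x t v : V → ℕ) : ∀ (l : List V) (u d : V) (c v0 : ℕ),
    (∀ X p q Y, u :: l = X ++ p :: q :: Y → t p + x q ≤ 1) →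
    (∀ X p q Y, u :: l = X ++ p :: q :: Y → v p + t q ≤ 1) →
    (∀ X p z q Y, u :: l = X ++ p :: z :: q :: Y → v p + x q ≤ 1) →
    c + x u ≤ 1 → v0 + t u ≤ 1 → (∀ w r, l = w :: r → v0 + x w ≤ 1) →
    (u :: l).getLast? = some d →
    c + v0 + ((u :: l).map (fun z => x z + t z + v z)).sum ≤ (u :: l).length + 1 + v d := by
  intro l
  induction l with
  | nil =>
    intro u d c v0 _ _ _ h1 h2 _ h4
    simp at h4
    subst h4
    simp
    omega
  | cons w r ih =>
    intro u d c v0 a1 a2 a3 h1 h2 h3 h4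
    have := ih w d (v0 + t u) (v u)
      (fun X p q Y e => a1 (u :: X) p q Y (by rw [e]; rfl))
      (fun X p q Y e => a2 (u :: X) p q Y (by rw [e]; rfl))
      (fun X p z q Y e => a3 (u :: X) p z q Y (by rw [e]; rfl))
      (by
        have := h3 w r rfl
        have := a1 [] u w r rfl
        omega)
      (a2 [] u w r rfl)
      (fun w' r' e => a3 [] u w w' r' (by rw [e]; rfl))
      (by simpa using h4)
    simp only [List.map_cons, List.sum_cons, List.length_cons] at this ⊢
    omega

/-- No path from `a` to `b` avoiding `H` and covering all of `C` except possibly `w`. -/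
def NoP (G : SimpleGraph V) (H : Finset V) (C : List V) (a b w : V) : Prop :=
  ∀ Q : List V, Pth G a Q b → Q.Nodup → (∀ z ∈ Q, z ∉ H) → (∀ z ∈ C, z = w ∨ z ∈ Q) → False

/-- Vertices of `C` with a neighbour in `H`. -/
def Att (G : SimpleGraph V) (H : Finset V) (C : List V) (a : V) : Prop :=
  a ∈ C ∧ ∃ h ∈ H, G.Adj a h

theorem sum_append_perm [DecidableEq V] {C l m : List V} (f : V → ℕ) (h : (l ++ m).Perm C) :
    (C.map f).sum = (l.map f).sum + (m.map f).sum := by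
  rw [← (h.map f).sum_eq]; simp

section
variable [Fintype V] [DecidableEq V] [DecidableRel G.Adj]

theorem deg_split (C : List V) (hC : C.Nodup) (b : V) :
    G.degree b = (C.map (fun z => if G.Adj b z then 1 else 0)).sum
      + ((G.neighborFinset b).filter (fun z => z ∉ C)).card := by
  rw [← SimpleGraph.card_neighborFinset_eq_degree,
    ← Finset.card_filter_add_card_filter_not (s := G.neighborFinset b) (fun z => z ∈ C)]
  congr 1
  rw [← List.sum_toFinset _ hC, Finset.sum_ite]
  simp
  congr 1
  ext z
  simp
  tauto

theorem half_count (C U1 U2 : List V) (H : Finset V) (P : V → Prop) [DecidablePred P]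
    (a1 a2 b1 b2 : V)
    (hC : C.Nodup) (hHC : ∀ z ∈ H, z ∉ C)
    (k1 : Pth G b1 U1 a2) (k2 : Pth G b2 U2 a1) (hp : (U1 ++ U2).Perm C)
    (e1 : G.Adj a1 b1) (e2 : G.Adj a2 b2)
    (hPA : ∀ y ∈ C, P y → Att G H C y)
    (T1 : ∀ a a' w, Att G H C a → Att G H C a' → a ≠ a' → w ∉ C → NoP G H C a a' w)
    (ha1 : Att G H C a1) (ha2 : Att G H C a2) (ha : a1 ≠ a2)
    (T21 : ∀ y ∈ C, P y → y ≠ a1 → ∀ w, ¬ Att G H C w → NoP G H C a1 y w)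
    (T22 : ∀ y ∈ C, P y → y ≠ a2 → ∀ w, ¬ Att G H C w → NoP G H C a2 y w) :
    (U1.map (fun z => (if G.Adj b1 z then 1 else 0) + (if G.Adj b2 z then 1 else 0)
      + (if P z then 1 else 0))).sum ≤ U1.length + (if P a2 then 1 else 0) := by
  have hnd : (U1 ++ U2).Nodup := hp.nodup_iff.2 hC
  have hmem : ∀ z, z ∈ U1 ++ U2 ↔ z ∈ C := fun z => hp.mem_iff
  obtain ⟨h0, hh0, hadj0⟩ := ha1.2
  have hh0C := hHC h0 hh0
  have pth2 : ∀ X Y, X ≠ [] → Y ≠ [] → U1 = X ++ Y → ∃ c d, Pth G b1 X c ∧ G.Adj c d ∧ Pth G d Y a2 := by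
    intro X Y hX hY e
    rw [e] at k1
    exact k1.split hX hY
  -- generic consequence: a permuted list is fine
  have fin : ∀ Q : List V, Q.Perm C → Q.Nodup ∧ (∀ z ∈ Q, z ∉ H) ∧ ∀ z ∈ C, z ∈ Q := by
    intro Q hQ
    exact ⟨hQ.nodup_iff.2 hC, fun z hz hzH => hHC z hzH (hQ.mem_iff.1 hz), fun z hz => hQ.mem_iff.2 hz⟩
  have c1 : ∀ X p q Y, U1 = X ++ p :: q :: Y → G.Adj b2 p → G.Adj b1 q → False := by
    intro X p q Y e h1 h2
    obtain ⟨c, d, p1, p2, p3⟩ := pth2 (X ++ [p]) (q :: Y) (by simp) (by simp) (by simpa using e)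
    have := p1.last_eq; subst this
    have := p3.head_eq; subst this
    have hQ : Pth G a1 (U2.reverse ++ ((X ++ [p]).reverse ++ (q :: Y))) a2 :=
      k2.rev.app h1 (p1.rev.app h2 p3)
    have hperm : (U2.reverse ++ ((X ++ [p]).reverse ++ (q :: Y))).Perm C := by
      refine List.Perm.trans (perm_of_cnt fun z => ?_) hp
      simp only [e, cnt_cons, List.count_append, List.count_reverse, List.count_nil]; omega
    obtain ⟨f1, f2, f3⟩ := fin _ hperm
    exact T1 a1 a2 h0 ha1 ha2 ha hh0C _ hQ f1 f2 (fun z hz => Or.inr (f3 z hz))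
  have hnA : ∀ w, w ∉ C → ¬ Att G H C w := fun w hw h => hw h.1
  have inC : ∀ z ∈ U1, z ∈ C := fun z hz => (hmem z).1 (by simp [hz])
  have c2 : ∀ X p q Y, U1 = X ++ p :: q :: Y → P p → G.Adj b2 q → False := by
    intro X p q Y e h1 h2
    obtain ⟨c, d, p1, p2, p3⟩ := pth2 (X ++ [p]) (q :: Y) (by simp) (by simp) (by simpa using e)
    have := p1.last_eq; subst this
    have := p3.head_eq; subst this
    have hQ : Pth G a2 ((q :: Y).reverse ++ (U2 ++ (X ++ [p]))) p :=
      p3.rev.app h2.symm (k2.app e1 p1)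
    have hperm : ((q :: Y).reverse ++ (U2 ++ (X ++ [p]))).Perm C := by
      refine List.Perm.trans (perm_of_cnt fun z => ?_) hp
      simp only [e, cnt_cons, List.count_append, List.count_reverse, List.count_nil]; omega
    obtain ⟨f1, f2, f3⟩ := fin _ hperm
    refine T22 p (inC p (by simp [e])) h1 ?_ h0 (hnA _ hh0C) _ hQ f1 f2 (fun z hz => Or.inr (f3 z hz))
    rintro rfl
    have := p3.last_mem
    rw [e] at hnd
    have hnd := (List.nodup_append.1 hnd).1
    have hnd := (List.nodup_append.1 hnd).2.1
    exact (List.nodup_cons.1 hnd).1 this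
  have cA : ∀ X p q Y, U1 = X ++ p :: q :: Y → P p → ¬ Att G H C q := by
    intro X p q Y e h1 h2
    obtain ⟨c, d, p1, p2, p3⟩ := pth2 (X ++ [p]) (q :: Y) (by simp) (by simp) (by simpa using e)
    have := p1.last_eq; subst this
    have := p3.head_eq; subst this
    have hQ : Pth G q ((q :: Y) ++ (U2 ++ (X ++ [p]))) p := p3.app e2 (k2.app e1 p1)
    have hperm : ((q :: Y) ++ (U2 ++ (X ++ [p]))).Perm C := by
      refine List.Perm.trans (perm_of_cnt fun z => ?_) hp
      simp only [e, cnt_cons, List.count_append, List.count_nil]; omega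
    obtain ⟨f1, f2, f3⟩ := fin _ hperm
    exact T1 q p h0 h2 (hPA p (inC p (by simp [e])) h1) p2.ne.symm hh0C _ hQ f1 f2
      (fun z hz => Or.inr (f3 z hz))
  have c3 : ∀ X p z q Y, U1 = X ++ p :: z :: q :: Y → P p → G.Adj b1 q → False := by
    intro X p w q Y e h1 h2
    obtain ⟨c, d, p1, p2, p3⟩ := pth2 (X ++ [p]) (w :: q :: Y) (by simp) (by simp) (by simpa using e)
    have := p1.last_eq; subst this
    have := p3.head_eq; subst this
    obtain ⟨d', p4, p5⟩ := p3.tail (by simp)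
    have := p5.head_eq; subst this
    have hQ : Pth G a1 (U2.reverse ++ ((q :: Y).reverse ++ (X ++ [p]))) p :=
      k2.rev.app e2.symm (p5.rev.app h2.symm p1)
    have hperm : (w :: (U2.reverse ++ ((q :: Y).reverse ++ (X ++ [p])))).Perm C := by
      refine List.Perm.trans (perm_of_cnt fun z => ?_) hp
      simp only [e, cnt_cons, List.count_append, List.count_reverse, List.count_nil]; omega
    obtain ⟨f1, f2, f3⟩ := fin _ hperm
    refine T21 p (inC p (by simp [e])) h1 ?_ w (cA X p w (q :: Y) e h1) _ hQ
      (List.nodup_cons.1 f1).2 (fun z hz => f2 z (List.mem_cons_of_mem _ hz))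
      (fun z hz => List.mem_cons.1 (f3 z hz))
    rintro rfl
    have h3 := k2.last_mem
    exact (List.nodup_append.1 hnd).2.2 p (by simp [e]) p h3 rfl
  obtain ⟨l, hl⟩ : ∃ l, U1 = b1 :: l := by
    cases hU : U1 with
    | nil => exact absurd hU k1.ne_nil
    | cons z l => rw [hU] at k1; have := k1.head_eq; subst this; exact ⟨l, rfl⟩
  have := count3 (fun z => if G.Adj b1 z then 1 else 0) (fun z => if G.Adj b2 z then 1 else 0)
    (fun z => if P z then 1 else 0) l b1 a2 1 0
    (by
      intro X p q Y e
      have := c1 X p q Y (hl.trans e)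
      split_ifs <;> first | omega | (exfalso; apply this <;> assumption))
    (by
      intro X p q Y e
      have := c2 X p q Y (hl.trans e)
      split_ifs <;> first | omega | (exfalso; apply this <;> assumption))
    (by
      intro X p z q Y e
      have := c3 X p z q Y (hl.trans e)
      split_ifs <;> first | omega | (exfalso; apply this <;> assumption))
    (by simp) (by split_ifs <;> omega) (by intro w r _; split_ifs <;> omega)
    (by rw [← hl]; exact k1.2.2)
  rw [← hl] at this
  omega

theorem triple_count (C U1 U2 : List V) (H : Finset V) (P : V → Prop) [DecidablePred P]
    (a1 a2 b1 b2 : V)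
    (hC : C.Nodup) (hHC : ∀ z ∈ H, z ∉ C)
    (k1 : Pth G b1 U1 a2) (k2 : Pth G b2 U2 a1) (hp : (U1 ++ U2).Perm C)
    (e1 : G.Adj a1 b1) (e2 : G.Adj a2 b2)
    (hPA : ∀ y ∈ C, P y → Att G H C y)
    (T1 : ∀ a a' w, Att G H C a → Att G H C a' → a ≠ a' → w ∉ C → NoP G H C a a' w)
    (ha1 : Att G H C a1) (ha2 : Att G H C a2) (ha : a1 ≠ a2)
    (T21 : ∀ y ∈ C, P y → y ≠ a1 → ∀ w, ¬ Att G H C w → NoP G H C a1 y w)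
    (T22 : ∀ y ∈ C, P y → y ≠ a2 → ∀ w, ¬ Att G H C w → NoP G H C a2 y w) :
    G.degree b1 + G.degree b2 + (C.map (fun z => if P z then 1 else 0)).sum + H.card
      ≤ Fintype.card V + (if P a1 then 1 else 0) + (if P a2 then 1 else 0) := by
  have q1 := half_count C U1 U2 H P a1 a2 b1 b2 hC hHC k1 k2 hp e1 e2 hPA T1 ha1 ha2 ha T21 T22
  have hp' : (U2 ++ U1).Perm C := List.perm_append_comm.trans hp
  have q2 := half_count C U2 U1 H P a2 a1 b2 b1 hC hHC k2 k1 hp' e2 e1 hPA T1 ha2 ha1 ha.symm T22 T21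
  obtain ⟨h0, hh0, hadj0⟩ := ha1.2
  have hh0C := hHC h0 hh0
  have d1 := deg_split (G := G) C hC b1
  have d2 := deg_split (G := G) C hC b2
  have s1 := sum_append_perm (fun z => if G.Adj b1 z then 1 else 0) hp
  have s2 := sum_append_perm (fun z => if G.Adj b2 z then 1 else 0) hp
  have s3 := sum_append_perm (fun z => if P z then 1 else 0) hp
  have hlen := hp.length_eq
  rw [List.length_append] at hlen
  simp only [List.sum_map_add] at q1 q2
  have fin : ∀ Q : List V, Q.Perm C → Q.Nodup ∧ (∀ z ∈ Q, z ∉ H) ∧ ∀ z ∈ C, z ∈ Q := by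
    intro Q hQ
    exact ⟨hQ.nodup_iff.2 hC, fun z hz hzH => hHC z hzH (hQ.mem_iff.1 hz), fun z hz => hQ.mem_iff.2 hz⟩
  have nA : ∀ (b a : V) (U U' : List V) (d d' : V), (U ++ U').Perm C → Pth G b U d → G.Adj d d' →
      Pth G d' U' a → G.Adj a b → Att G H C a → ∀ h ∈ H, ¬ G.Adj b h := by
    intro b a U U' d d' pp m1 m2 m3 m4 m5 h hh hb
    obtain ⟨f1, f2, f3⟩ := fin _ pp
    exact T1 b a h0 ⟨pp.mem_iff.1 (by simp [m1.head_mem]), h, hh, hb⟩ m5 m4.ne.symm hh0C _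
      (m1.app m2 m3) f1 f2 (fun z hz => Or.inr (f3 z hz))
  have n1 := nA b1 a1 U1 U2 a2 b2 hp k1 e2 k2 e1 ha1
  have n2 := nA b2 a2 U2 U1 a1 b1 hp' k2 e1 k1 e2 ha2
  have hdis : ∀ z, z ∉ C → G.Adj b1 z → G.Adj b2 z → False := by
    intro z hz h1 h2
    have hzH : z ∉ H := fun h => n1 z h h1
    have hQ : Pth G a1 (U2.reverse ++ ([z] ++ U1)) a2 :=
      k2.rev.app h2 ((Pth.single z).app h1.symm k1)
    have hperm : (U2.reverse ++ ([z] ++ U1)).Perm (z :: C) := by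
      refine List.Perm.trans (perm_of_cnt fun z' => ?_) (hp.cons z)
      simp only [cnt_cons, List.count_append, List.count_reverse, List.count_nil]; omega
    refine T1 a1 a2 h0 ha1 ha2 ha hh0C _ hQ (hperm.nodup_iff.2 (by simp [hz, hC])) ?_
      (fun z hz => Or.inr (hperm.mem_iff.2 (List.mem_cons_of_mem _ hz)))
    intro y hy
    rcases List.mem_cons.1 (hperm.mem_iff.1 hy) with rfl | h
    · exact hzH
    · exact fun hh => hHC y hh h
  have hcard : ((G.neighborFinset b1).filter (fun z => z ∉ C)).card
      + ((G.neighborFinset b2).filter (fun z => z ∉ C)).card + H.card + C.length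
      ≤ Fintype.card V := by
    rw [← List.toFinset_card_of_nodup hC, ← Finset.card_union_of_disjoint,
      ← Finset.card_union_of_disjoint, ← Finset.card_union_of_disjoint]
    · exact Finset.card_le_univ _
    · rw [Finset.disjoint_left]
      intro z hz
      simp only [Finset.mem_union, Finset.mem_filter, List.mem_toFinset] at hz ⊢
      rcases hz with (hz | hz) | hz
      · exact hz.2
      · exact hz.2
      · exact hHC z hz
    · rw [Finset.disjoint_left]
      intro z hz
      simp only [Finset.mem_union, Finset.mem_filter, SimpleGraph.mem_neighborFinset] at hz
      rcases hz with hz | hz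
      · exact fun h => n1 z h hz.1
      · exact fun h => n2 z h hz.1
    · rw [Finset.disjoint_left]
      intro z hz hz'
      simp only [Finset.mem_filter, SimpleGraph.mem_neighborFinset] at hz hz'
      exact hdis z hz.2 hz.1 hz'.1
  omega
end
end HT

namespace HT
variable {V : Type u} {G : SimpleGraph V}

/-- Concatenation of blocks: a marked vertex followed by a segment. -/
def flat (L : List (V × List V)) : List V := L.flatMap (fun p => p.1 :: p.2)

@[simp] theorem flat_nil : flat ([] : List (V × List V)) = [] := rfl
@[simp] theorem flat_cons (p : V × List V) (L : List (V × List V)) :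
    flat (p :: L) = p.1 :: (p.2 ++ flat L) := rfl
@[simp] theorem flat_append (L M : List (V × List V)) : flat (L ++ M) = flat L ++ flat M := by
  simp [flat]

theorem decomp (A : V → Prop) (l : List V) : ∃ s L, l = s ++ flat L ∧ (∀ z ∈ s, ¬ A z) ∧
    ∀ p ∈ L, A p.1 ∧ ∀ z ∈ p.2, ¬ A z := by
  induction l with
  | nil => exact ⟨[], [], rfl, by simp, by simp⟩
  | cons x l ih =>
    obtain ⟨s, L, e, h1, h2⟩ := ih
    by_cases hx : A x
    · refine ⟨[], (x, s) :: L, by simp [e], by simp, ?_⟩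
      intro p hp
      rcases List.mem_cons.1 hp with rfl | hp
      · exact ⟨hx, h1⟩
      · exact h2 p hp
    · refine ⟨x :: s, L, by simp [e], ?_, h2⟩
      intro z hz
      rcases List.mem_cons.1 hz with rfl | hz
      · exact hx
      · exact h1 z hz

/-- `L` is a block decomposition of (a rotation of) the longest cycle `C`. -/
structure Dec (G : SimpleGraph V) (A : V → Prop) (C : List V) (L : List (V × List V)) : Prop where
  mx : IsMx G (flat L)
  perm : (flat L).Perm C
  hA : ∀ p ∈ L, A p.1 ∧ ∀ z ∈ p.2, ¬ A z

theorem dec_exists (A : V → Prop) {C : List V} (h : IsMx G C) (a : V) (ha : a ∈ C) (hAa : A a) :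
    ∃ L, Dec G A C L := by
  obtain ⟨l1, l2, e⟩ := List.append_of_mem ha
  obtain ⟨s, L, e2, h1, h2⟩ := decomp A (a :: l2 ++ l1)
  have hs : s = [] := by
    cases s with
    | nil => rfl
    | cons z s => simp at e2 h1; exact absurd (e2.1 ▸ hAa) h1.1
  subst hs
  simp only [List.nil_append] at e2
  have hp : (flat L).Perm C := by rw [← e2, e]; exact List.perm_append_comm
  refine ⟨L, ⟨?_, hp, h2⟩⟩
  rw [← e2]
  rw [e] at h
  exact h.rot

theorem Dec.rot {A : V → Prop} {C : List V} {L M : List (V × List V)} (h : Dec G A C (L ++ M)) :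
    Dec G A C (M ++ L) := by
  obtain ⟨h1, h2, h3⟩ := h
  refine ⟨?_, ?_, fun p hp => h3 p (by simp at hp ⊢; tauto)⟩
  · rw [flat_append] at *; exact h1.rot
  · rw [flat_append] at *; exact List.perm_append_comm.trans h2

theorem Dec.mem {A : V → Prop} {C : List V} {L : List (V × List V)} (h : Dec G A C L) (z : V) :
    z ∈ C ∧ A z ↔ z ∈ L.map Prod.fst := by
  rw [← h.perm.mem_iff]
  simp only [flat, List.mem_flatMap, List.mem_map, List.mem_cons]
  constructor
  · rintro ⟨⟨p, hp, rfl | hz⟩, hA⟩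
    · exact ⟨p, hp, rfl⟩
    · exact absurd hA ((h.hA p hp).2 z hz)
  · rintro ⟨p, hp, rfl⟩
    exact ⟨⟨p, hp, Or.inl rfl⟩, (h.hA p hp).1⟩

theorem fst_sublist (L : List (V × List V)) : (L.map Prod.fst).Sublist (flat L) := by
  induction L with
  | nil => simp
  | cons p L ih =>
    simp only [List.map_cons, flat_cons]
    exact (ih.trans (List.sublist_append_right _ _)).cons_cons _

theorem Dec.nodup_fst {A : V → Prop} {C : List V} {L : List (V × List V)} (h : Dec G A C L) :
    (L.map Prod.fst).Nodup := h.mx.1.sublist (fst_sublist L)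

theorem Dec.nodup {A : V → Prop} {C : List V} {L : List (V × List V)} (h : Dec G A C L) :
    L.Nodup := List.Nodup.of_map _ h.nodup_fst

theorem Dec.nodC {A : V → Prop} {C : List V} {L : List (V × List V)} (h : Dec G A C L) :
    C.Nodup := h.perm.nodup_iff.1 h.mx.1

theorem flat_length (L : List (V × List V)) :
    (flat L).length = L.length + (L.map (fun p => p.2.length)).sum := by
  induction L with
  | nil => simp
  | cons p L ih => simp [ih]; omega

theorem Dec.front {A : V → Prop} {C : List V} {L : List (V × List V)} (h : Dec G A C L)
    {p : V × List V} (hp : p ∈ L) : ∃ M, Dec G A C (p :: M) ∧ (p :: M).Perm L := by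
  obtain ⟨l1, l2, e⟩ := List.append_of_mem hp
  subst e
  exact ⟨l2 ++ l1, by simpa using h.rot, by
    rw [← List.cons_append]; exact List.perm_append_comm⟩

theorem Dec.two {A : V → Prop} {C : List V} {L : List (V × List V)} (h : Dec G A C L)
    {p q : V × List V} (hp : p ∈ L) (hq : q ∈ L) (hpq : p ≠ q) :
    ∃ M1 M2, Dec G A C (p :: (M1 ++ q :: M2)) ∧ (p :: (M1 ++ q :: M2)).Perm L := by
  obtain ⟨M, h1, h2⟩ := h.front hp
  have : q ∈ M := by
    have := h2.mem_iff.2 hq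
    rcases List.mem_cons.1 this with h | h
    · exact absurd h.symm hpq
    · exact h
  obtain ⟨l1, l2, e⟩ := List.append_of_mem this
  subst e
  exact ⟨l1, l2, h1, h2⟩

/-- Four arcs of a cycle: segment, connector, segment, connector. -/
structure Arcs (G : SimpleGraph V) (A : V → Prop) (C : List V)
    (a1 b1 c1 d1 a2 b2 c2 d2 : V) (s1 W1 s2 W2 : List V) : Prop where
  p1 : Pth G b1 s1 c1
  w1 : Pth G d1 W1 a2
  p2 : Pth G b2 s2 c2
  w2 : Pth G d2 W2 a1
  e1 : G.Adj a1 b1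
  f1 : G.Adj c1 d1
  e2 : G.Adj a2 b2
  f2 : G.Adj c2 d2
  perm : (s1 ++ (W1 ++ (s2 ++ W2))).Perm C
  A1 : A a1
  A2 : A a2
  D1 : A d1
  D2 : A d2
  nd : C.Nodup

variable {A : V → Prop} {C : List V} {a1 b1 c1 d1 a2 b2 c2 d2 : V} {s1 W1 s2 W2 : List V}

theorem Arcs.swap (h : Arcs G A C a1 b1 c1 d1 a2 b2 c2 d2 s1 W1 s2 W2) :
    Arcs G A C a2 b2 c2 d2 a1 b1 c1 d1 s2 W2 s1 W1 := by
  classical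
  exact ⟨h.p2, h.w2, h.p1, h.w1, h.e2, h.f2, h.e1, h.f1, (perm_of_cnt fun z => by
      simp only [List.count_append]; omega).trans h.perm, h.A2, h.A1, h.D2, h.D1, h.nd⟩

theorem Arcs.mirror (h : Arcs G A C a1 b1 c1 d1 a2 b2 c2 d2 s1 W1 s2 W2) :
    Arcs G A C d1 c1 b1 a1 d2 c2 b2 a2 s1.reverse W2.reverse s2.reverse W1.reverse := by
  classical
  exact ⟨h.p1.rev, h.w2.rev, h.p2.rev, h.w1.rev, h.f1.symm, h.e1.symm, h.f2.symm, h.e2.symm,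
    (perm_of_cnt fun z => by
      simp only [List.count_append, List.count_reverse]; omega).trans h.perm,
    h.D1, h.D2, h.A1, h.A2, h.nd⟩

theorem Arcs.ne (h : Arcs G A C a1 b1 c1 d1 a2 b2 c2 d2 s1 W1 s2 W2) : a1 ≠ a2 := by
  rintro rfl
  have := h.perm.nodup_iff.2 h.nd
  have := (List.nodup_append.1 this).2.1
  exact (List.nodup_append.1 this).2.2 _ h.w1.last_mem _ (by simp [h.w2.last_mem]) rfl

theorem Arcs.ne' (h : Arcs G A C a1 b1 c1 d1 a2 b2 c2 d2 s1 W1 s2 W2) : d1 ≠ d2 := h.mirror.ne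

theorem cons_rot {a : V} {l : List V} (h : Cyc G (a :: l)) : Cyc G (l ++ [a]) :=
  Cyc.rot (l := [a]) h

theorem Dec.arcs {L : List (V × List V)} (h : Dec G A C L)
    {p q : V × List V} (hp : p ∈ L) (hq : q ∈ L) (hpq : p ≠ q) (hp2 : p.2 ≠ []) (hq2 : q.2 ≠ []) :
    ∃ b1 c1 d1 b2 c2 d2 W1 W2, Arcs G A C p.1 b1 c1 d1 q.1 b2 c2 d2 p.2 W1 q.2 W2 := by
  classical
  obtain ⟨M1, M2, k, _⟩ := h.two hp hq hpq
  have hc : Cyc G (p.2 ++ ((flat M1 ++ [q.1]) ++ (q.2 ++ (flat M2 ++ [p.1])))) := by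
    have := cons_rot (a := p.1) (l := p.2 ++ flat (M1 ++ q :: M2)) k.mx.2.1
    simpa using this
  obtain ⟨b1, a1', h1, h2⟩ := hc
  obtain ⟨c1, d1, g1, g2, h1⟩ := h1.split hp2 (by simp)
  obtain ⟨a2, b2, g3, g4, h1⟩ := h1.split (by simp) (by simp)
  obtain ⟨c2, d2, g5, g6, g7⟩ := h1.split hq2 (by simp)
  have e1 := g7.last_eq
  have e2 := g3.last_eq
  subst e1; subst e2
  have hD : ∀ (M : List (V × List V)) (a d b : V), (∀ r ∈ M, A r.1) → A a →
      Pth G d (flat M ++ [a]) b → A d := by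
    intro M a d b hM ha hP
    cases M with
    | nil => have := hP.head_eq; subst this; exact ha
    | cons r M => have := hP.head_eq (l := r.2 ++ flat M ++ [a]); subst this; exact hM r (by simp)
  refine ⟨b1, c1, d1, b2, c2, d2, _, _, g1, g3, g5, g7, h2, g2, g4, g6, ?_, (h.hA p hp).1,
    (h.hA q hq).1, ?_, ?_, h.nodC⟩
  · refine List.Perm.trans (perm_of_cnt fun z => ?_) k.perm
    simp only [flat_cons, flat_append, cnt_cons, List.count_append, List.count_nil]; omega
  · exact hD M1 q.1 d1 _ (fun r hr => (k.hA r (by simp [hr])).1) (h.hA q hq).1 g3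
  · exact hD M2 p.1 d2 _ (fun r hr => (k.hA r (by simp [hr])).1) (h.hA p hp).1 g7

end HT

namespace HT
variable {V : Type u} {G : SimpleGraph V}

/-- `H` is a connected component of the complement of `C`. -/
structure Comp (G : SimpleGraph V) (C : List V) (H : Finset V) : Prop where
  hne : H.Nonempty
  hHC : ∀ z ∈ H, z ∉ C
  hN : ∀ v ∈ H, ∀ w, G.Adj v w → w ∈ H ∨ w ∈ C
  conn : ∀ u ∈ H, ∀ v ∈ H, ∃ l, Pth G u l v ∧ ∀ z ∈ l, z ∈ H

theorem via {C Q l : List V} {H : Finset V} {a b u v w : V} (mx : IsMx G C)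
    (hQ : Pth G a Q b) (hn : Q.Nodup) (hQH : ∀ z ∈ Q, z ∉ H) (hcov : ∀ z ∈ C, z = w ∨ z ∈ Q)
    (hl : Pth G u l v) (hln : l.Nodup) (hlH : ∀ z ∈ l, z ∈ H) (h1 : G.Adj a u) (h2 : G.Adj b v) :
    (w ∉ C ∨ 2 ≤ l.length) → False := by
  classical
  have hc : Cyc G (Q ++ l.reverse) := ⟨a, u, hQ.app h2 hl.rev, h1.symm⟩
  have hnd : (Q ++ l.reverse).Nodup := by
    rw [List.nodup_append]
    refine ⟨hn, by simpa using hln, ?_⟩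
    intro z hz y hy e
    subst e
    exact hQH z hz (hlH z (by simpa using hy))
  have hle := mx.2.2 _ hnd hc
  rw [List.length_append, List.length_reverse] at hle
  have hl1 : 1 ≤ l.length := List.length_pos_iff.2 hl.ne_nil
  rintro (h | h)
  · have : C.length ≤ Q.length := by
      apply List.Subperm.length_le
      apply List.Nodup.subperm mx.1
      intro z hz
      rcases hcov z hz with rfl | h'
      · exact absurd hz h
      · exact h'
    omega
  · have : C.length ≤ (w :: Q).length := by
      apply List.Subperm.length_le
      apply List.Nodup.subperm mx.1
      intro z hz
      rcases hcov z hz with rfl | h'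
      · simp
      · simp [h']
    simp at this
    omega

theorem Pth.two_le {l : List V} {u v : V} (h : Pth G u l v) (huv : u ≠ v) : 2 ≤ l.length := by
  match l, h with
  | [], h => exact absurd rfl h.ne_nil
  | [x], h =>
    have h1 := h.unique (Pth.single x)
    exact absurd (h1.1.trans h1.2.symm) huv
  | _ :: _ :: _, _ => simp

theorem Comp.T1 {C : List V} {H : Finset V} (mx : IsMx G C) (hH : Comp G C H) :
    ∀ a a' w, Att G H C a → Att G H C a' → a ≠ a' → w ∉ C → NoP G H C a a' w := by
  rintro a a' w ⟨_, u, hu, hau⟩ ⟨_, v, hv, hav⟩ hne hw Q hQ hn hQH hcov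
  obtain ⟨l, hl, hlH⟩ := hH.conn u hu v hv
  obtain ⟨l', hl', hn', hs⟩ := hl.shorten
  exact via mx hQ hn hQH hcov hl' hn' (fun z hz => hlH z (hs hz)) hau hav (Or.inl hw)

theorem Comp.T2 {C : List V} {H : Finset V} (mx : IsMx G C) (hH : Comp G C H)
    {a a' u v : V} (hu : u ∈ H) (hv : v ∈ H) (hau : G.Adj a u) (hav : G.Adj a' v) (huv : u ≠ v)
    (w : V) : NoP G H C a a' w := by
  intro Q hQ hn hQH hcov
  obtain ⟨l, hl, hlH⟩ := hH.conn u hu v hv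
  obtain ⟨l', hl', hn', hs⟩ := hl.shorten
  exact via mx hQ hn hQH hcov hl' hn' (fun z hz => hlH z (hs hz)) hau hav
    (Or.inr (hl'.two_le huv))

theorem cut_two {C : List V} (mx : IsMx G C) {a1 a2 : V} (h1 : a1 ∈ C) (h2 : a2 ∈ C)
    (hne : a1 ≠ a2) : ∃ b1 b2 U1 U2, Pth G b1 U1 a2 ∧ Pth G b2 U2 a1 ∧ G.Adj a1 b1 ∧ G.Adj a2 b2 ∧
      (U1 ++ U2).Perm C := by
  classical
  obtain ⟨l1, l2, e⟩ := List.append_of_mem h1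
  have hc : Cyc G (a1 :: l2 ++ l1) := by
    have := mx.2.1; rw [e] at this; exact this.rot
  have hc' : Cyc G ((l2 ++ l1) ++ [a1]) := cons_rot hc
  have : a2 ∈ l2 ++ l1 := by
    rw [e] at h2; simp at h2 ⊢; rcases h2 with h | h | h
    · exact Or.inr h
    · exact absurd h.symm hne
    · exact Or.inl h
  obtain ⟨m1, m2, e2⟩ := List.append_of_mem this
  have : (l2 ++ l1) ++ [a1] = (m1 ++ [a2]) ++ (m2 ++ [a1]) := by rw [e2]; simp
  rw [this] at hc'
  obtain ⟨b1, a, k1, k2⟩ := hc'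
  obtain ⟨c, b2, k3, k4, k5⟩ := k1.split (by simp) (by simp)
  have := k3.last_eq; subst this
  have := k5.last_eq; subst this
  refine ⟨b1, b2, _, _, k3, k5, k2, k4, ?_⟩
  rw [← this, e]
  refine perm_of_cnt fun z => ?_
  simp only [cnt_cons, List.count_append, List.count_nil]; omega

theorem cut_nonadj {C U1 U2 : List V} {H : Finset V} {a1 a2 b1 b2 : V} (mx : IsMx G C)
    (hHC : ∀ z ∈ H, z ∉ C)
    (T1 : ∀ a a' w, Att G H C a → Att G H C a' → a ≠ a' → w ∉ C → NoP G H C a a' w)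
    (ha1 : Att G H C a1) (ha2 : Att G H C a2) (hne : a1 ≠ a2)
    (k1 : Pth G b1 U1 a2) (k2 : Pth G b2 U2 a1) (e1 : G.Adj a1 b1) (e2 : G.Adj a2 b2)
    (hp : (U1 ++ U2).Perm C) : ¬ Att G H C b1 ∧ ¬ Att G H C b2 ∧ ¬ G.Adj b1 b2 ∧ b1 ≠ b2 ∧
      b1 ∈ C ∧ b2 ∈ C := by
  classical
  obtain ⟨h0, hh0, -⟩ := ha1.2
  have hw := hHC h0 hh0
  have key : ∀ (Q : List V) (a b : V), Pth G a Q b → Att G H C a → Att G H C b → a ≠ b →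
      Q.Perm (U1 ++ U2) → False := by
    intro Q a b hQ ha hb hab hperm
    have hperm := hperm.trans hp
    exact T1 a b h0 ha hb hab hw Q hQ (hperm.nodup_iff.2 mx.1)
      (fun z hz hzH => hHC z hzH (hperm.mem_iff.1 hz)) (fun z hz => Or.inr (hperm.mem_iff.2 hz))
  refine ⟨fun h => ?_, fun h => ?_, fun h => ?_, ?_, hp.mem_iff.1 (by simp [k1.head_mem]),
    hp.mem_iff.1 (by simp [k2.head_mem])⟩
  · exact key _ _ _ (k1.app e2 k2) h ha1 e1.ne.symm (List.Perm.refl _)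
  · exact key _ _ _ (k2.app e1 k1) h ha2 e2.ne.symm List.perm_append_comm
  · refine key _ _ _ (k2.rev.app h.symm k1) ha1 ha2 hne ?_
    refine perm_of_cnt fun z => ?_
    simp only [List.count_append, List.count_reverse]; omega
  · rintro rfl
    exact (List.nodup_append.1 (hp.nodup_iff.2 mx.1)).2.2 _ k1.head_mem _ k2.head_mem rfl

section
variable [Fintype V] [DecidableEq V] [DecidableRel G.Adj]

theorem degH {C : List V} {H : Finset V} (hC : C.Nodup) (hHC : ∀ z ∈ H, z ∉ C)
    (hN : ∀ v ∈ H, ∀ w, G.Adj v w → w ∈ H ∨ w ∈ C) (v : V) (hv : v ∈ H) :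
    G.degree v + 1 ≤ (C.map (fun z => if G.Adj v z then 1 else 0)).sum + H.card := by
  rw [deg_split C hC v]
  have : ((G.neighborFinset v).filter (fun z => z ∉ C)).card ≤ (H.erase v).card := by
    apply Finset.card_le_card
    intro z hz
    simp only [Finset.mem_filter, SimpleGraph.mem_neighborFinset, Finset.mem_erase] at hz ⊢
    exact ⟨hz.1.ne.symm, (hN v hv z hz.1).resolve_right hz.2⟩
  rw [Finset.card_erase_of_mem hv] at this
  have : 1 ≤ H.card := Finset.card_pos.2 ⟨v, hv⟩
  omega

theorem partA_S1 (cx : Ctx G) {C : List V} {H : Finset V} (mx : IsMx G C) (hH : Comp G C H)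
    (h2 : 2 ≤ H.card) :
    ∀ a a' w, Att G H C a → Att G H C a' → a ≠ a' → ¬ Att G H C w → NoP G H C a a' w := by
  intro a1 a2 w ha1 ha2 hne hw
  by_cases hex : ∃ u ∈ H, ∃ v ∈ H, u ≠ v ∧ G.Adj a1 u ∧ G.Adj a2 v
  · obtain ⟨u, hu, v, hv, huv, h1, h2⟩ := hex
    exact hH.T2 mx hu hv h1 h2 huv w
  exfalso
  push Not at hex
  obtain ⟨v1, hv1, hav1⟩ := ha1.2
  obtain ⟨v2, hv2, hav2⟩ := ha2.2
  have hv12 : v1 = v2 := by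
    by_contra h; exact hex v1 hv1 v2 hv2 h hav1 hav2
  subst hv12
  obtain ⟨v, hv, hvne⟩ := Finset.exists_mem_ne (show 1 < H.card by omega) v1
  have nv1 : ¬ G.Adj v a1 := fun h => hex v hv v1 hv1 hvne h.symm hav2
  have nv2 : ¬ G.Adj v a2 := fun h => hex v1 hv1 v hv hvne.symm hav1 h.symm
  obtain ⟨b1, b2, U1, U2, k1, k2, e1, e2, hp⟩ := cut_two mx ha1.1 ha2.1 hne
  have hT1 := hH.T1 mx
  have tc := triple_count C U1 U2 H (fun z => G.Adj v z) a1 a2 b1 b2 mx.1 hH.hHC k1 k2 hp e1 e2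
    (fun y hy h => ⟨hy, v, hv, h.symm⟩) hT1 ha1 ha2 hne
    (fun y hy h _ w _ => hH.T2 mx hv1 hv hav1 h.symm hvne.symm w)
    (fun y hy h _ w _ => hH.T2 mx hv1 hv hav2 h.symm hvne.symm w)
  obtain ⟨m1, m2, m3, m4, m5, m6⟩ := cut_nonadj mx hH.hHC hT1 ha1 ha2 hne k1 k2 e1 e2 hp
  have hd := degH mx.1 hH.hHC hH.hN v hv
  have s1 := cx.sig v b1 (fun h => hH.hHC v hv (h ▸ m5)) (fun h => m1 ⟨m5, v, hv, h.symm⟩)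
  have s2 := cx.sig v b2 (fun h => hH.hHC v hv (h ▸ m6)) (fun h => m2 ⟨m6, v, hv, h.symm⟩)
  have s3 := cx.sig b1 b2 m4 m3
  have := cx.n11
  simp only [nv1, nv2, if_false] at tc
  omega

/-- The hypotheses of the main structural theorem. -/
structure SC (G : SimpleGraph V) [DecidableRel G.Adj] (H : Finset V) (C : List V) : Prop where
  cx : Ctx G
  mx : IsMx G C
  hne : H.Nonempty
  hHC : ∀ z ∈ H, z ∉ C
  hN : ∀ v ∈ H, ∀ w, G.Adj v w → w ∈ H ∨ w ∈ C
  S1 : ∀ a a' w, Att G H C a → Att G H C a' → a ≠ a' → ¬ Att G H C w → NoP G H C a a' w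

variable {H : Finset V} {C : List V}

theorem SC.T1 (h : SC G H C) :
    ∀ a a' w, Att G H C a → Att G H C a' → a ≠ a' → w ∉ C → NoP G H C a a' w :=
  fun a a' w h1 h2 h3 h4 => h.S1 a a' w h1 h2 h3 (fun h => h4 h.1)

theorem two_att (cx : Ctx G) (mx : IsMx G C) (hne : H.Nonempty) (hHC : ∀ z ∈ H, z ∉ C)
    (hN : ∀ v ∈ H, ∀ w, G.Adj v w → w ∈ H ∨ w ∈ C) :
    ∃ a a', Att G H C a ∧ Att G H C a' ∧ a ≠ a' := by
  classical
  by_contra hcon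
  push Not at hcon
  obtain ⟨h0, hh0⟩ := hne
  have hS : (C.toFinset.filter (fun a => Att G H C a)).card ≤ 1 := by
    rw [Finset.card_le_one]
    intro a ha b hb
    simp at ha hb
    exact hcon a b ha.2 hb.2
  obtain ⟨c, hc, hcA⟩ : ∃ c ∈ C, ¬ Att G H C c := by
    by_contra hall
    push Not at hall
    obtain ⟨a, b, h1, h2⟩ := mx.2.1
    exact h2.ne (hcon b a (hall b h1.last_mem) (hall a h1.head_mem))
  have hc0 : h0 ≠ c := fun h => hHC h0 hh0 (h ▸ hc)
  have hcH : c ∉ H := fun h => hHC c h hc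
  have := tough_label cx.tough (C.toFinset.filter (fun a => Att G H C a)) {h0, c}
    (fun v => if v ∈ H then h0 else c) (by
      have key : ∀ u v, v ∉ C.toFinset.filter (fun a => Att G H C a) → G.Adj u v → u ∈ H → v ∈ H := by
        intro u v hv huv hu
        rcases hN u hu v huv with h | h
        · exact h
        · exfalso; apply hv; simp; exact ⟨h, h, u, hu, huv.symm⟩
      intro u v hu hv huv
      by_cases h : u ∈ H
      · simp [h, key u v hv huv h]
      · have : v ∉ H := fun h' => h (key v u hu huv.symm h')
        simp [h, this])
    (by
      intro v hv
      simp at hv ⊢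
      rcases hv with rfl | rfl
      · exact fun h => absurd h (hHC v hh0)
      · exact fun _ => hcA)
    (by
      intro u hu v hv
      simp at hu hv
      rcases hu with rfl | rfl <;> rcases hv with rfl | rfl <;> simp [hh0, hcH])
    (by rw [Finset.card_pair hc0])
  rw [Finset.card_pair hc0] at this
  omega

theorem SC.dec (h : SC G H C) : ∃ L, Dec G (Att G H C) C L ∧ 2 ≤ L.length := by
  obtain ⟨a, a', h1, h2, h3⟩ := two_att h.cx h.mx h.hne h.hHC h.hN
  obtain ⟨L, hL⟩ := dec_exists (Att G H C) h.mx a h1.1 h1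
  refine ⟨L, hL, ?_⟩
  have m1 := (hL.mem a).1 ⟨h1.1, h1⟩
  have m2 := (hL.mem a').1 ⟨h2.1, h2⟩
  by_contra hlt
  have : (L.map Prod.fst).length ≤ 1 := by simp; omega
  match hM : L.map Prod.fst with
  | [] => rw [hM] at m1; simp at m1
  | [x] => rw [hM] at m1 m2; simp at m1 m2; exact h3 (m1.trans m2.symm)
  | _ :: _ :: _ => rw [hM] at this; simp at this

/-- No path missing at most one nonattached vertex (perm form). -/
theorem SC.noQ (h : SC G H C) {a a' : V} {Q O : List V} (ha : Att G H C a) (ha' : Att G H C a')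
    (hne : a ≠ a') (hQ : Pth G a Q a') (hO : O.Nodup) (hOC : ∀ z ∈ O, z ∉ C ∧ z ∉ H)
    (hp : Q.Perm (O ++ C)) : False := by
  obtain ⟨h0, hh0⟩ := h.hne
  refine h.T1 a a' h0 ha ha' hne (h.hHC _ hh0) Q hQ (hp.nodup_iff.2 ?_) ?_
    (fun z hz => Or.inr (hp.mem_iff.2 (by simp [hz])))
  · rw [List.nodup_append]
    exact ⟨hO, h.mx.1, fun z hz y hy e => (hOC z hz).1 (e ▸ hy)⟩
  · intro z hz hzH
    rcases List.mem_append.1 (hp.mem_iff.1 hz) with h' | h'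
    · exact (hOC z h').2 hzH
    · exact h.hHC z hzH h'

theorem SC.noQ1 (h : SC G H C) {a a' w : V} {Q O : List V} (ha : Att G H C a) (ha' : Att G H C a')
    (hne : a ≠ a') (hw : ¬ Att G H C w) (hQ : Pth G a Q a') (hO : O.Nodup)
    (hOC : ∀ z ∈ O, z ∉ C ∧ z ∉ H)
    (hp : (w :: Q).Perm (O ++ C)) : False := by
  have hnd : (w :: Q).Nodup := by
    refine hp.nodup_iff.2 ?_
    rw [List.nodup_append]
    exact ⟨hO, h.mx.1, fun z hz y hy e => (hOC z hz).1 (e ▸ hy)⟩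
  refine h.S1 a a' w ha ha' hne hw Q hQ (List.nodup_cons.1 hnd).2 ?_
    (fun z hz => List.mem_cons.1 (hp.mem_iff.2 (by simp [hz])))
  · intro z hz hzH
    rcases List.mem_append.1 (hp.mem_iff.1 (List.mem_cons_of_mem _ hz)) with h' | h'
    · exact (hOC z h').2 hzH
    · exact h.hHC z hzH h'

theorem SC.seg2 (h : SC G H C) {L : List (V × List V)} (hL : Dec G (Att G H C) C L)
    (h2 : 2 ≤ L.length) (p : V × List V) (hp : p ∈ L) : 2 ≤ p.2.length := by
  obtain ⟨M, hM, hperm⟩ := hL.front hp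
  have hlen := hperm.length_eq
  match M, hM, hlen with
  | [], _, hlen => simp at hlen; omega
  | q :: M, hM, hlen =>
    by_contra hlt
    have hAp := (hL.hA p hp)
    have hAq := (hM.hA q (by simp)).1
    have hnd := hM.nodup_fst
    have hpq : p.1 ≠ q.1 := by simp at hnd; tauto
    have hc : Cyc G (p.2 ++ (flat (q :: M) ++ [p.1])) := by
      have := cons_rot (a := p.1) (l := p.2 ++ flat (q :: M)) hM.mx.2.1
      simpa using this
    have hQ : Pth G q.1 (flat (q :: M) ++ [p.1]) p.1 := by
      by_cases hs : p.2 = []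
      · obtain ⟨a, b, k1, k2⟩ := hc
        rw [hs] at k1
        have k1 : Pth G a (q.1 :: ((q.2 ++ flat M) ++ [p.1])) b := k1
        have := k1.head_eq; subst this
        have := Pth.last_eq (l := q.1 :: (q.2 ++ flat M)) k1; subst this
        exact k1
      · obtain ⟨a, b, k1, k2⟩ := hc
        obtain ⟨c, d, g1, g2, k1⟩ := k1.split hs (by simp)
        have k1 : Pth G d (q.1 :: ((q.2 ++ flat M) ++ [p.1])) b := k1
        have := k1.head_eq; subst this
        have := Pth.last_eq (l := q.1 :: (q.2 ++ flat M)) k1; subst this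
        exact k1
    have hpm : (p.2 ++ (flat (q :: M) ++ [p.1])).Perm C := by
      refine List.Perm.trans (perm_of_cnt fun z => ?_) hM.perm
      simp only [flat_cons, cnt_cons, List.count_append, List.count_nil]; omega
    match hs : p.2 with
    | [] =>
      rw [hs] at hpm
      exact h.noQ (O := []) hAq hAp.1 hpq.symm hQ (by simp) (by simp) hpm
    | [w] =>
      rw [hs] at hpm
      exact h.noQ1 (O := []) (w := w) hAq hAp.1 hpq.symm (hAp.2 w (by simp [hs])) hQ (by simp)
        (by simp) hpm
    | _ :: _ :: _ => rw [hs] at hlt; simp at hlt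

end
end HT

namespace HT
set_option linter.unusedSectionVars false
variable {V : Type u} {G : SimpleGraph V}

theorem Pth.glue {a b y y' y'' : V} {l w : List V} (h : Pth G a (l ++ [y]) y')
    (h' : Pth G y'' (y :: w) b) : Pth G a (l ++ y :: w) b := by
  have := h.last_eq; subst this
  have := h'.head_eq; subst this
  by_cases hw : w = []
  · subst hw
    have := (h'.unique (Pth.single _)).2
    subst this
    exact h
  · obtain ⟨d, e1, e2⟩ := h'.tail hw
    have := h.app e1 e2
    simpa using this

theorem Pth.suffix {a b y : V} {u w : List V} (h : Pth G a (u ++ y :: w) b) :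
    Pth G y (y :: w) b := by
  by_cases hu : u = []
  · subst hu
    have := h.head_eq; subst this; exact h
  · obtain ⟨c, d, h1, h2, h3⟩ := h.split hu (by simp)
    have := h3.head_eq; subst this; exact h3

theorem Dec.disj {A : V → Prop} {C : List V} {L : List (V × List V)} (h : Dec G A C L)
    {p q : V × List V} (hp : p ∈ L) (hq : q ∈ L) {z : V} (h1 : z ∈ p.2) (h2 : z ∈ q.2) : p = q := by
  by_contra hpq
  obtain ⟨M1, M2, k, _⟩ := h.two hp hq hpq
  have := k.mx.1
  simp only [flat_cons, flat_append] at this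
  have := (List.nodup_cons.1 this).2
  exact (List.nodup_append.1 this).2.2 z h1 z (by simp [h2]) rfl

theorem Dec.memC {A : V → Prop} {C : List V} {L : List (V × List V)} (h : Dec G A C L) (z : V) :
    z ∈ C ↔ z ∈ L.map Prod.fst ∨ ∃ p ∈ L, z ∈ p.2 := by
  rw [← h.perm.mem_iff]
  simp only [flat, List.mem_flatMap, List.mem_map, List.mem_cons]
  constructor
  · rintro ⟨p, hp, rfl | hz⟩
    · exact Or.inl ⟨p, hp, rfl⟩
    · exact Or.inr ⟨p, hp, hz⟩
  · rintro (⟨p, hp, rfl⟩ | ⟨p, hp, hz⟩)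
    · exact ⟨p, hp, Or.inl rfl⟩
    · exact ⟨p, hp, Or.inr hz⟩

section
variable [Fintype V] [DecidableEq V] [DecidableRel G.Adj] {H : Finset V} {C : List V}

/-- If no two segments are connected outside, toughness fails. -/
theorem SC.noconn_false (h : SC G H C) {L : List (V × List V)} (hL : Dec G (Att G H C) C L)
    (h2 : 2 ≤ L.length)
    (hnc : ∀ p ∈ L, ∀ q ∈ L, p ≠ q → ∀ y ∈ p.2, ∀ y' ∈ q.2, ∀ O : List V, O.Nodup →
      (∀ z ∈ O, z ∉ C ∧ z ∉ H) → Pth G y (y :: (O ++ [y'])) y' → False) : False := by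
  have hseg := h.seg2 hL h2
  obtain ⟨h0, hh0⟩ := h.hne
  set f : V → Set (V × List V) := fun v => {p | p ∈ L ∧ ∃ y ∈ p.2, ∃ l : List V,
    (∀ z ∈ l, z ∉ C ∧ z ∉ H) ∧ Pth G v (l ++ [y]) y} with hf
  have inC : ∀ p ∈ L, ∀ y ∈ p.2, y ∈ C := fun p hp y hy => (hL.memC y).2 (Or.inr ⟨p, hp, hy⟩)
  have headcase : ∀ (v y : V) (l : List V), (∀ z ∈ l, z ∉ C ∧ z ∉ H) → Pth G v (l ++ [y]) y →
      (l = [] ∧ v = y) ∨ (v ∉ C ∧ v ∉ H) := by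
    intro v y l hl hP
    cases l with
    | nil => have := hP.head_eq; exact Or.inl ⟨rfl, this.symm⟩
    | cons z l => have := hP.head_eq (l := l ++ [y]); subst this; exact Or.inr (hl z (by simp))
  have fH : ∀ v ∈ H, f v = ∅ := by
    intro v hv
    ext p
    simp only [hf, Set.mem_ofPred_eq, Set.mem_empty_iff_false, iff_false]
    rintro ⟨hp, y, hy, l, hl, hP⟩
    rcases headcase v y l hl hP with ⟨-, rfl⟩ | h'
    · exact h.hHC v hv (inC p hp v hy)
    · exact h'.2 hv
  have fS : ∀ p ∈ L, ∀ y ∈ p.2, f y = {p} := by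
    intro p hp y hy
    ext q
    simp only [hf, Set.mem_ofPred_eq, Set.mem_singleton_iff]
    constructor
    · rintro ⟨hq, y', hy', l, hl, hP⟩
      rcases headcase y y' l hl hP with ⟨-, rfl⟩ | h'
      · exact hL.disj hq hp hy' hy
      · exact absurd (inC p hp y hy) h'.1
    · rintro rfl
      exact ⟨hp, y, hy, [], by simp, Pth.single y⟩
  have fsub : ∀ u v, v ∉ (L.map Prod.fst).toFinset → u ∉ (L.map Prod.fst).toFinset → G.Adj u v →
      f u ⊆ f v := by
    intro u v hv hu huv p hpu
    obtain ⟨hp, y, hy, l, hl, hP⟩ := hpu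
    have hP' : Pth G v ((v :: l) ++ [y]) y := hP.cons huv.symm
    by_cases hvH : v ∈ H
    · exfalso
      have hu' : u ∈ H := by
        rcases h.hN v hvH u huv.symm with h' | h'
        · exact h'
        · exact absurd (by simpa using (hL.mem u).1 ⟨h', h', v, hvH, huv⟩) hu
      have : p ∈ f u := ⟨hp, y, hy, l, hl, hP⟩
      rw [fH u hu'] at this
      exact this
    by_cases hvC : v ∈ C
    · rcases (hL.memC v).1 hvC with h' | ⟨q, hq, hvq⟩
      · exact absurd (by simpa using h') hv
      · by_cases hpq : p = q
        · subst hpq; rw [fS p hp v hvq]; rfl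
        · exfalso
          obtain ⟨l', k1, k2, k3⟩ := hP'.shorten
          have hvy : v ≠ y := by
            rintro rfl; exact hpq (hL.disj hp hq hy hvq)
          -- extract the interior
          have : ∃ O, l' = v :: (O ++ [y]) := by
            cases l' with
            | nil => exact absurd rfl k1.ne_nil
            | cons x l' =>
              have := k1.head_eq; subst this
              rcases List.eq_nil_or_concat l' with rfl | ⟨O, z, rfl⟩
              · have := (k1.unique (Pth.single x)).2; exact absurd this.symm hvy
              · have := Pth.last_eq (l := x :: O) (by simpa using k1); subst this
                exact ⟨O, by simp⟩
          obtain ⟨O, rfl⟩ := this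
          have k2' := k2
          simp only [List.nodup_cons, List.nodup_append, List.mem_append, List.mem_singleton] at k2'
          refine hnc q hq p hp (Ne.symm hpq) v hvq y hy O k2'.2.1 ?_ k1
          intro z hz
          have hz' := k3 (show z ∈ v :: (O ++ [y]) by simp [hz])
          simp only [List.cons_append, List.mem_cons, List.mem_append, List.not_mem_nil, or_false] at hz'
          rcases hz' with rfl | hz' | rfl
          · exact absurd (Or.inl hz) k2'.1
          · exact hl z hz'
          · exact absurd rfl (k2'.2.2.2 z hz z rfl)
    · exact ⟨hp, y, hy, v :: l, by
        intro z hz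
        rcases List.mem_cons.1 hz with rfl | hz
        · exact ⟨hvC, hvH⟩
        · exact hl z hz, hP'⟩
  set g : V × List V → V := fun p => p.2.headD p.1 with hg
  have hgm : ∀ p ∈ L, g p ∈ p.2 := by
    intro p hp
    have := hseg p hp
    simp only [hg]
    match hs : p.2 with
    | [] => rw [hs] at this; simp at this
    | z :: _ => simp
  have hginj : (L.map g).Nodup := by
    apply List.Nodup.map_on _ hL.nodup
    intro p hp q hq e
    have := hgm p hp
    rw [e] at this
    exact hL.disj hp hq this (hgm q hq)
  have hTn : (h0 :: L.map g).Nodup := by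
    rw [List.nodup_cons]
    refine ⟨?_, hginj⟩
    intro hm
    obtain ⟨p, hp, e⟩ := List.mem_map.1 hm
    exact h.hHC h0 hh0 (e ▸ inC p hp _ (hgm p hp))
  have := tough_label h.cx.tough (L.map Prod.fst).toFinset (h0 :: L.map g).toFinset f
    (fun u v hu hv huv => Set.Subset.antisymm (fsub u v hv hu huv) (fsub v u hu hv huv.symm))
    (by
      intro v hv hvS
      simp only [List.mem_toFinset] at hv hvS
      have hvS' := (hL.mem v).2 hvS
      rcases List.mem_cons.1 hv with rfl | hv
      · exact h.hHC v hh0 hvS'.1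
      · obtain ⟨p, hp, rfl⟩ := List.mem_map.1 hv
        exact (hL.hA p hp).2 _ (hgm p hp) hvS'.2)
    (by
      intro u hu v hv e
      simp only [List.mem_toFinset] at hu hv
      rcases List.mem_cons.1 hu with hu2 | hu2 <;> rcases List.mem_cons.1 hv with hv2 | hv2
      · rw [hu2, hv2]
      · obtain ⟨p, hp, rfl⟩ := List.mem_map.1 hv2
        rw [hu2, fH _ hh0, fS p hp _ (hgm p hp)] at e
        exact absurd e.symm (Set.singleton_ne_empty p)
      · obtain ⟨p, hp, rfl⟩ := List.mem_map.1 hu2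
        rw [hv2, fH _ hh0, fS p hp _ (hgm p hp)] at e
        exact absurd e (Set.singleton_ne_empty p)
      · obtain ⟨p, hp, rfl⟩ := List.mem_map.1 hu2
        obtain ⟨q, hq, rfl⟩ := List.mem_map.1 hv2
        rw [fS q hq _ (hgm q hq), fS p hp _ (hgm p hp)] at e
        rw [Set.singleton_eq_singleton_iff.1 e])
    (by rw [List.toFinset_card_of_nodup hTn]; simp; omega)
  rw [List.toFinset_card_of_nodup hTn, List.toFinset_card_of_nodup hL.nodup_fst] at this
  simp at this

variable {a1 b1 c1 d1 a2 b2 c2 d2 : V} {s1 W1 s2 W2 : List V}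

/-- Connection to the head of the second segment, cutting off `u`. -/
theorem SC.conn_a (h : SC G H C)
    (ar : Arcs G (Att G H C) C a1 b1 c1 d1 a2 b2 c2 d2 s1 W1 s2 W2)
    (hs1 : ∀ z ∈ s1, ¬ Att G H C z)
    {y : V} {u w O : List V} (e : s1 = u ++ y :: w) (hu : u.length ≤ 1) (hO : O.Nodup)
    (hOZ : ∀ z ∈ O, z ∉ C ∧ z ∉ H) (hP : Pth G b2 (b2 :: (O ++ [y])) y) : False := by
  have p1 := ar.p1
  rw [e] at p1
  have k := p1.suffix
  obtain ⟨d, hd, hP'⟩ := hP.tail (by simp)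
  have hQ : Pth G a1 (W2.reverse ++ (s2.reverse ++ ((O ++ y :: w) ++ W1))) a2 :=
    ar.w2.rev.app ar.f2.symm (ar.p2.rev.app hd ((hP'.glue k).app ar.f1 ar.w1))
  match u, e, hu with
  | [], e, _ =>
    refine h.noQ (O := O) ar.A1 ar.A2 ar.ne hQ hO hOZ ?_
    refine List.Perm.trans (perm_of_cnt fun z => ?_) (ar.perm.append_left O)
    simp only [e, cnt_cons, List.count_append, List.count_nil, List.count_reverse]; omega
  | [w0], e, _ =>
    refine h.noQ1 (O := O) ar.A1 ar.A2 ar.ne (hs1 w0 (by simp [e])) hQ hO hOZ ?_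
    refine List.Perm.trans (perm_of_cnt fun z => ?_) (ar.perm.append_left O)
    simp only [e, cnt_cons, List.count_append, List.count_nil, List.count_reverse]; omega
  | _ :: _ :: _, _, hu => simp at hu

/-- Connection from the last vertex of the first segment to the head of a short second segment. -/
theorem SC.conn_b (h : SC G H C)
    (ar : Arcs G (Att G H C) C a1 b1 c1 d1 a2 b2 c2 d2 s1 W1 s2 W2)
    (hs2 : ¬ Att G H C c2) (e : s2 = [b2, c2])
    {O : List V} (hO : O.Nodup)
    (hOZ : ∀ z ∈ O, z ∉ C ∧ z ∉ H) (hP : Pth G c1 (c1 :: (O ++ [b2])) b2) : False := by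
  obtain ⟨d, hd, hP'⟩ := hP.tail (by simp)
  have hQ : Pth G d2 (W2 ++ (s1 ++ ((O ++ [b2]) ++ W1.reverse))) d1 :=
    ar.w2.app ar.e1 (ar.p1.app hd (hP'.app ar.e2.symm ar.w1.rev))
  refine h.noQ1 (O := O) ar.D2 ar.D1 ar.ne'.symm hs2 hQ hO hOZ ?_
  refine List.Perm.trans (perm_of_cnt fun z => ?_) (ar.perm.append_left O)
  simp only [e, cnt_cons, List.count_append, List.count_nil, List.count_reverse]; omega

theorem Pth.revc {y y' : V} {O : List V} (hP : Pth G y (y :: (O ++ [y'])) y') :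
    Pth G y' (y' :: (O.reverse ++ [y])) y := by
  have := hP.rev; simpa using this

theorem SC.conn_c (h : SC G H C)
    (ar : Arcs G (Att G H C) C a1 b1 c1 d1 a2 b2 c2 d2 s1 W1 s2 W2)
    (hs1 : ∀ z ∈ s1, ¬ Att G H C z) (hs2 : ∀ z ∈ s2, ¬ Att G H C z)
    (e2 : s2 = [b2, c2]) {y y' : V} {O : List V}
    (hy : y ∈ s1) (hlen : s1.length ≤ 3) (hy' : y' ∈ s2)
    (hO : O.Nodup) (hOZ : ∀ z ∈ O, z ∉ C ∧ z ∉ H) (hP : Pth G y (y :: (O ++ [y'])) y') : False := by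
  have main : ∀ {a1 b1 c1 d1 a2 b2 c2 d2 : V} {s1 W1 s2 W2 : List V},
      Arcs G (Att G H C) C a1 b1 c1 d1 a2 b2 c2 d2 s1 W1 s2 W2 → (∀ z ∈ s1, ¬ Att G H C z) →
      (∀ z ∈ s2, ¬ Att G H C z) → s2 = [b2, c2] → y ∈ s1 → s1.length ≤ 3 →
      y' = b2 → False := by
    intro a1 b1 c1 d1 a2 b2 c2 d2 s1 W1 s2 W2 ar hs1 hs2 e2 hy hlen hyb
    subst hyb
    obtain ⟨u, w, e⟩ := List.append_of_mem hy
    by_cases hu : u.length ≤ 1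
    · exact h.conn_a ar hs1 e hu (O := O.reverse) (by simpa using hO) (by simpa using hOZ) hP.revc
    · have hw : w = [] := by
        rw [e] at hlen; simp at hlen
        exact List.length_eq_zero_iff.1 (by omega)
      subst hw
      have p1 := ar.p1
      rw [e] at p1
      have := p1.last_eq; subst this
      exact h.conn_b ar (hs2 c2 (by simp [e2])) e2 hO hOZ hP
  rw [e2] at hy'
  simp at hy'
  rcases hy' with hy' | hy'
  · exact main ar hs1 hs2 e2 hy hlen hy'
  · exact main ar.mirror (by simpa using hs1) (by simpa using hs2) (by simp [e2]) (by simpa using hy)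
      (by simpa using hlen) hy'

theorem sum_two_le {L : List (V × List V)} {p q : V × List V} (hp : p ∈ L) (hq : q ∈ L)
    (hpq : p ≠ q) (f : V × List V → ℕ) : f p + f q ≤ (L.map f).sum := by
  obtain ⟨l1, l2, rfl⟩ := List.append_of_mem hp
  have : q ∈ l1 ++ l2 := by simp at hq ⊢; rcases hq with h | h | h
                            · exact Or.inl h
                            · exact absurd h.symm hpq
                            · exact Or.inr h
  have h2 : f q ≤ ((l1 ++ l2).map f).sum := List.single_le_sum (by simp) _ (List.mem_map_of_mem this)
  simp at h2 ⊢
  omega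

theorem excess_sum (L : List (V × List V)) (h : ∀ p ∈ L, 2 ≤ p.2.length) :
    (flat L).length = 3 * L.length + (L.map (fun p => p.2.length - 2)).sum := by
  induction L with
  | nil => simp
  | cons p L ih =>
    have h1 := h p (by simp)
    have h2 := ih (fun q hq => h q (by simp [hq]))
    simp [h2]; omega

theorem SC.E2 (h : SC G H C) {L : List (V × List V)} (hL : Dec G (Att G H C) C L)
    (h2 : 2 ≤ L.length) : 3 * L.length + 2 ≤ C.length := by
  have hseg := h.seg2 hL h2
  by_contra hlt
  have hex := excess_sum L hseg
  rw [hL.perm.length_eq] at hex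
  refine h.noconn_false hL h2 ?_
  have main : ∀ p ∈ L, ∀ q ∈ L, p ≠ q → q.2.length = 2 → p.2.length ≤ 3 →
      ∀ y ∈ p.2, ∀ y' ∈ q.2, ∀ O : List V, O.Nodup →
      (∀ z ∈ O, z ∉ C ∧ z ∉ H) → Pth G y (y :: (O ++ [y'])) y' → False := by
    intro p hp q hq hpq hl hl' y hy y' hy' O hO hOZ hP
    have n1 : p.2 ≠ [] := by intro h'; rw [h'] at hy; simp at hy
    have n2 : q.2 ≠ [] := by intro h'; rw [h'] at hy'; simp at hy'
    obtain ⟨b1, c1, d1, b2, c2, d2, W1, W2, ar⟩ := hL.arcs hp hq hpq n1 n2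
    have : q.2 = [b2, c2] := by
      have pp := ar.p2
      match hs : q.2 with
      | [x, y] =>
        rw [hs] at pp
        have e1 := pp.head_eq
        have e2 := Pth.last_eq (l := [x]) pp
        rw [e1, e2]
      | [] => rw [hs] at hl; simp at hl
      | [_] => rw [hs] at hl; simp at hl
      | _ :: _ :: _ :: _ => rw [hs] at hl; simp at hl
    exact h.conn_c ar (hL.hA p hp).2 (hL.hA q hq).2 this hy hl' hy' hO hOZ hP
  intro p hp q hq hpq y hy y' hy' O hO hOZ hP
  have hs := sum_two_le hp hq hpq (fun p => p.2.length - 2)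
  have l1 := hseg p hp
  have l2 := hseg q hq
  by_cases hq2 : q.2.length = 2
  · exact main p hp q hq hpq hq2 (by omega) y hy y' hy' O hO hOZ hP
  · exact main q hq p hp (Ne.symm hpq) (by omega) (by omega) y' hy' y hy O.reverse
      (by simpa using hO) (by simpa using hOZ) hP.revc

end
end HT

namespace HT
set_option linter.unusedSectionVars false
variable {V : Type u} {G : SimpleGraph V}

theorem Cyc.chain {x : V} {l : List V} (h : Cyc G (x :: l)) : ((x :: l) ++ [x]).IsChain G.Adj := by
  obtain ⟨a, b, h1, h2⟩ := h
  have := h1.head_eq; subst this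
  exact (h1.app h2 (Pth.single x)).1

section
variable [Fintype V] [DecidableEq V] [DecidableRel G.Adj] {H : Finset V} {C : List V}
  {L : List (V × List V)}

theorem all_adj {v : V} {l : List V} (h : ∀ w, G.Adj v w → w ∈ l) (hd : l.length ≤ G.degree v) :
    ∀ w ∈ l, G.Adj v w := by
  rw [← SimpleGraph.card_neighborFinset_eq_degree] at hd
  have h1 : G.neighborFinset v ⊆ l.toFinset := by
    intro w hw; simp at hw ⊢; exact h w hw
  have := Finset.eq_of_subset_of_card_le h1 ((List.toFinset_card_le l).trans hd)
  intro w hw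
  have : w ∈ G.neighborFinset v := by rw [this]; simpa using hw
  simpa using this

theorem SC.attL (hL : Dec G (Att G H C) C L) (z : V) : Att G H C z ↔ z ∈ L.map Prod.fst := by
  rw [← hL.mem z]; exact ⟨fun h => ⟨h.1, h⟩, fun h => h.2⟩

theorem SC.cNv (h : SC G H C) (hL : Dec G (Att G H C) C L) (v : V) (hv : v ∈ H) :
    (C.map (fun z => if G.Adj v z then 1 else 0)).sum ≤ L.length := by
  rw [← List.sum_toFinset _ h.mx.1, Finset.sum_ite]
  simp
  rw [← List.length_map (f := Prod.fst)]
  refine le_trans (Finset.card_le_card (t := (L.map Prod.fst).toFinset) ?_) (List.toFinset_card_le _)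
  intro z hz
  simp only [Finset.mem_filter, List.mem_toFinset] at hz ⊢
  exact (SC.attL hL z).1 ⟨hz.1, v, hv, hz.2.symm⟩

theorem SC.degv (h : SC G H C) (hL : Dec G (Att G H C) C L) (v : V) (hv : v ∈ H) :
    G.degree v + 1 ≤ L.length + H.card := by
  have := degH h.mx.1 h.hHC h.hN v hv
  have := h.cNv hL v hv
  omega

theorem SC.degD (h : SC G H C) (hL : Dec G (Att G H C) C L) (y : V) (hy : y ∉ H)
    (hyA : ¬ Att G H C y) : Fintype.card V + 1 ≤ G.degree y + 4 + L.length + H.card := by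
  obtain ⟨v, hv⟩ := h.hne
  have h1 := h.degv hL v hv
  have h2 := h.cx.sig y v (fun e => hy (e ▸ hv)) (fun e => by
    rcases h.hN v hv y e.symm with h' | h'
    · exact hy h'
    · exact hyA ⟨h', v, hv, e⟩)
  omega

theorem SC.num (h : SC G H C) (hL : Dec G (Att G H C) C L) :
    Fintype.card V ≤ 8 + L.length + H.card := by
  obtain ⟨a1, a2, ha1, ha2, hne⟩ := two_att h.cx h.mx h.hne h.hHC h.hN
  obtain ⟨v, hv⟩ := h.hne
  obtain ⟨b1, b2, U1, U2, k1, k2, e1, e2, hp⟩ := cut_two h.mx ha1.1 ha2.1 hne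
  have tc := triple_count C U1 U2 H (fun z => G.Adj v z) a1 a2 b1 b2 h.mx.1 h.hHC k1 k2 hp e1 e2
    (fun y hy h => ⟨hy, v, hv, h.symm⟩) h.T1 ha1 ha2 hne
    (fun y hy h' hn w hw => h.S1 _ _ w ha1 ⟨hy, v, hv, h'.symm⟩ hn.symm hw)
    (fun y hy h' hn w hw => h.S1 _ _ w ha2 ⟨hy, v, hv, h'.symm⟩ hn.symm hw)
  obtain ⟨m1, m2, m3, m4, m5, m6⟩ := cut_nonadj h.mx h.hHC h.T1 ha1 ha2 hne k1 k2 e1 e2 hp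
  have hd := degH h.mx.1 h.hHC h.hN v hv
  have hd2 := h.degv hL v hv
  have s1 := h.cx.sig v b1 (fun e => h.hHC v hv (e ▸ m5)) (fun e => m1 ⟨m5, v, hv, e.symm⟩)
  have s2 := h.cx.sig v b2 (fun e => h.hHC v hv (e ▸ m6)) (fun e => m2 ⟨m6, v, hv, e.symm⟩)
  have i1 : (if G.Adj v a1 then 1 else 0) ≤ 1 := by split_ifs <;> omega
  have i2 : (if G.Adj v a2 then 1 else 0) ≤ 1 := by split_ifs <;> omega
  omega

theorem SC.pair (h : SC G H C) {a1 a2 b1 b2 : V} {U1 U2 : List V} (ha1 : Att G H C a1)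
    (ha2 : Att G H C a2) (hne : a1 ≠ a2) (k1 : Pth G b1 U1 a2) (k2 : Pth G b2 U2 a1)
    (e1 : G.Adj a1 b1) (e2 : G.Adj a2 b2) (hp : (U1 ++ U2).Perm C) :
    G.degree b1 + G.degree b2 + H.card ≤ Fintype.card V := by
  have tc := triple_count C U1 U2 H (fun z => False) a1 a2 b1 b2 h.mx.1 h.hHC k1 k2 hp e1 e2
    (fun y hy h => h.elim) h.T1 ha1 ha2 hne
    (fun y hy h' hn w hw => h'.elim)
    (fun y hy h' hn w hw => h'.elim)
  simpa using tc

theorem card_le (h : SC G H C) : C.length + H.card ≤ Fintype.card V := by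
  rw [← List.toFinset_card_of_nodup h.mx.1, ← Finset.card_union_of_disjoint]
  · exact Finset.card_le_univ _
  · rw [Finset.disjoint_left]
    intro z hz hzH
    exact h.hHC z hzH (by simpa using hz)

theorem all_of_card (h : SC G H C) (hc : C.length + H.card = Fintype.card V) (z : V) (hz : z ∉ H) :
    z ∈ C := by
  by_contra hzC
  have : (insert z (C.toFinset ∪ H)).card ≤ Fintype.card V := Finset.card_le_univ _
  rw [Finset.card_insert_of_notMem (by simp [hz, hzC]), Finset.card_union_of_disjoint,
    List.toFinset_card_of_nodup h.mx.1] at this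
  · omega
  · rw [Finset.disjoint_left]
    intro z hz hzH
    exact h.hHC z hzH (by simpa using hz)

theorem SC.nadj (h : SC G H C) (hL : Dec G (Att G H C) C L) {p q : V × List V} (hp : p ∈ L)
    (hq : q ∈ L) (hpq : p ≠ q) {u w t : List V} {y b : V} (e1 : p.2 = u ++ y :: w)
    (e2 : q.2 = b :: t) (hu : u.length ≤ 1) : ¬ G.Adj b y := by
  intro hby
  obtain ⟨b1, c1, d1, b2, c2, d2, W1, W2, ar⟩ := hL.arcs hp hq hpq (by simp [e1]) (by simp [e2])
  have pp := ar.p2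
  rw [e2] at pp
  have := pp.head_eq; subst this
  exact h.conn_a ar (hL.hA p hp).2 e1 hu (O := []) (by simp) (by simp)
    ((Pth.single y).cons hby)

theorem SC.nadj' (h : SC G H C) (hL : Dec G (Att G H C) C L) {p q : V × List V} (hp : p ∈ L)
    (hq : q ∈ L) (hpq : p ≠ q) {u w t : List V} {y c : V} (e1 : p.2 = u ++ y :: w)
    (e2 : q.2 = t ++ [c]) (hw : w.length ≤ 1) : ¬ G.Adj c y := by
  intro hby
  obtain ⟨b1, c1, d1, b2, c2, d2, W1, W2, ar⟩ := hL.arcs hp hq hpq (by simp [e1]) (by simp [e2])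
  have pp := ar.p2
  rw [e2] at pp
  have := pp.last_eq; subst this
  exact h.conn_a ar.mirror (by simpa using (hL.hA p hp).2) (u := w.reverse) (w := u.reverse)
    (y := y) (by simp [e1]) (by simpa using hw) (O := []) (by simp) (by simp)
    ((Pth.single y).cons hby)

theorem SC.nadjb (h : SC G H C) (hL : Dec G (Att G H C) C L) {p q : V × List V} (hp : p ∈ L)
    (hq : q ∈ L) (hpq : p ≠ q) {t : List V} {y b c : V} (e1 : p.2 = t ++ [y])
    (e2 : q.2 = [b, c]) : ¬ G.Adj b y := by
  intro hby
  obtain ⟨b1, c1, d1, b2, c2, d2, W1, W2, ar⟩ := hL.arcs hp hq hpq (by simp [e1]) (by simp [e2])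
  have pp := ar.p2
  rw [e2] at pp
  have := pp.head_eq; subst this
  have := Pth.last_eq (l := [b]) pp; subst this
  have pp := ar.p1
  rw [e1] at pp
  have := pp.last_eq; subst this
  exact h.conn_b ar ((hL.hA q hq).2 c (by simp [e2])) e2 (O := []) (by simp) (by simp)
    ((Pth.single b).cons hby.symm)

theorem SC.nadjb' (h : SC G H C) (hL : Dec G (Att G H C) C L) {p q : V × List V} (hp : p ∈ L)
    (hq : q ∈ L) (hpq : p ≠ q) {t : List V} {y b c : V} (e1 : p.2 = y :: t)
    (e2 : q.2 = [b, c]) : ¬ G.Adj c y := by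
  intro hby
  obtain ⟨b1, c1, d1, b2, c2, d2, W1, W2, ar⟩ := hL.arcs hp hq hpq (by simp [e1]) (by simp [e2])
  have pp := ar.p2
  rw [e2] at pp
  have := pp.head_eq; subst this
  have := Pth.last_eq (l := [b]) pp; subst this
  have pp := ar.p1
  rw [e1] at pp
  have := pp.head_eq; subst this
  exact h.conn_b ar.mirror ((hL.hA q hq).2 b (by simp [e2])) (by simp [e2]) (O := []) (by simp)
    (by simp) ((Pth.single c).cons hby.symm)

theorem len2 {l : List V} (h : l.length = 2) : ∃ a b, l = [a, b] := List.length_eq_two.1 h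
theorem len3 {l : List V} (h : l.length = 3) : ∃ a b c, l = [a, b, c] := List.length_eq_three.1 h
theorem len4 {l : List V} (h : l.length = 4) : ∃ a b c d, l = [a, b, c, d] := by
  match l, h with
  | [a, b, c, d], _ => exact ⟨a, b, c, d, rfl⟩
theorem len5 {l : List V} (h : l.length = 5) : ∃ a b c d e, l = [a, b, c, d, e] := by
  match l, h with
  | [a, b, c, d, e], _ => exact ⟨a, b, c, d, e, rfl⟩
theorem len6 {l : List V} (h : l.length = 6) : ∃ a b c d e f, l = [a, b, c, d, e, f] := by
  match l, h with
  | [a, b, c, d, e, f], _ => exact ⟨a, b, c, d, e, f, rfl⟩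

/-- Neighbours of a nonattached vertex when everything lies in `C ∪ H`. -/
theorem SC.nbrC (h : SC G H C) (hc : C.length + H.card = Fintype.card V) {y w : V} (hy : y ∈ C)
    (hyA : ¬ Att G H C y) (hw : G.Adj y w) : w ∈ C := by
  refine all_of_card h hc w (fun hwH => hyA ⟨hy, w, hwH, hw⟩)

set_option maxHeartbeats 2000000 in
theorem SC.three422 (h : SC G H C) (hc : C.length + H.card = Fintype.card V)
    {a1 a2 a3 p1 p2 p3 p4 b2 c2 b3 c3 : V}
    (hL : Dec G (Att G H C) C [(a1, [p1, p2, p3, p4]), (a2, [b2, c2]), (a3, [b3, c3])]) : False := by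
  have hCl := hL.perm.length_eq
  simp at hCl
  have hnd := hL.mx.1
  have hch := Cyc.chain (x := a1) hL.mx.2.1
  simp [List.isChain_cons_cons] at hch
  simp at hnd
  have hmem : ∀ w, w ∈ C ↔ w ∈ [a1, p1, p2, p3, p4, a2, b2, c2, a3, b3, c3] := fun w => by
    rw [← hL.perm.mem_iff]; simp
  have hA1 := hL.hA (a1, [p1, p2, p3, p4]) (by simp)
  have hA2 := hL.hA (a2, [b2, c2]) (by simp)
  have hA3 := hL.hA (a3, [b3, c3]) (by simp)
  have n12 : (a1, [p1, p2, p3, p4]) ≠ (a2, [b2, c2]) := by simp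
  have n13 : (a1, [p1, p2, p3, p4]) ≠ (a3, [b3, c3]) := by simp
  have n23 : (a2, [b2, c2]) ≠ (a3, [b3, c3]) := by simp; tauto
  have full : ∀ (y : V) (l : List V), y ∈ C → ¬ Att G H C y → (∀ w ∈ C, G.Adj y w → w ∈ l) → l.length ≤ 5 →
      ∀ w ∈ l, G.Adj y w := by
    intro y l hy hyA hN hl
    apply all_adj
    · intro w hw; exact hN w (h.nbrC hc hy hyA hw) hw
    · have := h.degD hL y (fun hyH => h.hHC y hyH hy) hyA
      simp at this
      omega
  -- facts for a short segment q against the long one and the other short one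
  have shortb : ∀ a b c a' b' c', (a, [b, c]) ∈ [(a1, [p1, p2, p3, p4]), (a2, [b2, c2]), (a3, [b3, c3])] →
      (a', [b', c']) ∈ [(a1, [p1, p2, p3, p4]), (a2, [b2, c2]), (a3, [b3, c3])] →
      (a, [b, c]) ≠ (a', [b', c']) →
      ¬ G.Adj b p1 ∧ ¬ G.Adj b p2 ∧ ¬ G.Adj b p4 ∧ ¬ G.Adj b b' ∧ ¬ G.Adj b c' ∧
      ¬ G.Adj c p1 ∧ ¬ G.Adj c p3 ∧ ¬ G.Adj c p4 ∧ ¬ G.Adj c b' ∧ ¬ G.Adj c c' := by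
    intro a b c a' b' c' hq hr hne
    have hp : (a1, [p1, p2, p3, p4]) ∈ [(a1, [p1, p2, p3, p4]), (a2, [b2, c2]), (a3, [b3, c3])] := by simp
    have hnp : (a1, [p1, p2, p3, p4]) ≠ (a, [b, c]) := by simp
    exact ⟨h.nadj hL hp hq hnp (u := []) (by rfl) (by rfl) (by simp),
      h.nadj hL hp hq hnp (u := [p1]) (by rfl) (by rfl) (by simp),
      h.nadjb hL hp hq hnp (t := [p1, p2, p3]) (by rfl) (by rfl),
      h.nadj hL hr hq hne.symm (u := []) (by rfl) (by rfl) (by simp),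
      h.nadj hL hr hq hne.symm (u := [b']) (by rfl) (by rfl) (by simp),
      h.nadjb' hL hp hq hnp (t := [p2, p3, p4]) (by rfl) (by rfl),
      h.nadj' hL hp hq hnp (u := [p1, p2]) (t := [b]) (w := [p4]) (by rfl) (by rfl) (by simp),
      h.nadj' hL hp hq hnp (u := [p1, p2, p3]) (t := [b]) (w := []) (by rfl) (by rfl) (by simp),
      h.nadj' hL hr hq hne.symm (u := []) (w := [c']) (t := [b]) (by rfl) (by rfl) (by simp),
      h.nadj' hL hr hq hne.symm (u := [b']) (w := []) (t := [b]) (by rfl) (by rfl) (by simp)⟩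
  obtain ⟨x1, x2, x3, x4, x5, x6, x7, x8, x9, x10⟩ := shortb a2 b2 c2 a3 b3 c3 (by simp) (by simp) n23
  obtain ⟨y1, y2, y3, y4, y5, y6, y7, y8, y9, y10⟩ :=
    shortb a3 b3 c3 a2 b2 c2 (by simp) (by simp) n23.symm
  have g1 := full b2 [a1, a2, a3, c2, p3] ((hmem _).2 (by simp)) (hA2.2 _ (by simp)) (by
    intro w hw hb
    have := (hmem w).1 hw
    simp only [List.mem_cons, List.not_mem_nil, or_false] at this ⊢
    rcases this with rfl | rfl | rfl | rfl | rfl | rfl | rfl | rfl | rfl | rfl | rfl <;>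
      first | exact absurd hb (by assumption) | exact absurd rfl hb.ne | simp) (by simp)
  have g2 := full c2 [a1, a2, a3, b2, p2] ((hmem _).2 (by simp)) (hA2.2 _ (by simp)) (by
    intro w hw hb
    have := (hmem w).1 hw
    simp only [List.mem_cons, List.not_mem_nil, or_false] at this ⊢
    rcases this with rfl | rfl | rfl | rfl | rfl | rfl | rfl | rfl | rfl | rfl | rfl <;>
      first | exact absurd hb (by assumption) | exact absurd rfl hb.ne | simp) (by simp)
  have g3 := full b3 [a1, a2, a3, c3, p3] ((hmem _).2 (by simp)) (hA3.2 _ (by simp)) (by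
    intro w hw hb
    have := (hmem w).1 hw
    simp only [List.mem_cons, List.not_mem_nil, or_false] at this ⊢
    rcases this with rfl | rfl | rfl | rfl | rfl | rfl | rfl | rfl | rfl | rfl | rfl <;>
      first | exact absurd hb (by assumption) | exact absurd rfl hb.ne | simp) (by simp)
  have g4 := full c3 [a1, a2, a3, b3, p2] ((hmem _).2 (by simp)) (hA3.2 _ (by simp)) (by
    intro w hw hb
    have := (hmem w).1 hw
    simp only [List.mem_cons, List.not_mem_nil, or_false] at this ⊢
    rcases this with rfl | rfl | rfl | rfl | rfl | rfl | rfl | rfl | rfl | rfl | rfl <;>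
      first | exact absurd hb (by assumption) | exact absurd rfl hb.ne | simp) (by simp)
  simp only [List.forall_mem_cons, List.not_mem_nil, false_imp_iff, implies_true, and_true] at g1 g2 g3 g4
  refine h.noQ (O := []) (a := a1) (a' := a3) (Q := [a1, p1, p2, c2, b2, p3, p4, a2, b3, c3, a3])
    hA1.1 hA3.1 (by tauto) ⟨?_, rfl, rfl⟩ (by simp) (by simp) ?_
  · obtain ⟨e1, e2, e3, e4, e5, e6, e7, e8, e9, e10, e11⟩ := hch
    obtain ⟨g11, g12, g13, g14, g15⟩ := g1
    obtain ⟨g21, g22, g23, g24, g25⟩ := g2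
    obtain ⟨g31, g32, g33, g34, g35⟩ := g3
    obtain ⟨g41, g42, g43, g44, g45⟩ := g4
    simp only [List.isChain_cons_cons, List.isChain_singleton, and_true]
    exact ⟨e1, e2, g25.symm, e7.symm, g15, e4, e5, g32.symm, e10, g43⟩
  · refine List.Perm.trans (perm_of_cnt fun z => ?_) hL.perm
    simp only [flat_cons, flat_nil, List.nil_append, List.append_nil, cnt_cons, List.count_append,
      List.count_nil, List.cons_append]
    omega

theorem SC.three332 (h : SC G H C) (hc : C.length + H.card = Fintype.card V)
    {a1 a2 a3 b c x1 x2 x3 y1 y2 y3 : V}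
    (hL : Dec G (Att G H C) C [(a1, [b, c]), (a2, [x1, x2, x3]), (a3, [y1, y2, y3])]) : False := by
  have hCl := hL.perm.length_eq
  simp at hCl
  have hmem : ∀ w, w ∈ C ↔ w ∈ [a1, b, c, a2, x1, x2, x3, a3, y1, y2, y3] := fun w => by
    rw [← hL.perm.mem_iff]; simp
  have hA1 := hL.hA (a1, [b, c]) (by simp)
  have key : ∀ a x y z, (a, [x, y, z]) ∈ [(a1, [b, c]), (a2, [x1, x2, x3]), (a3, [y1, y2, y3])] →
      ¬ G.Adj b x ∧ ¬ G.Adj b y ∧ ¬ G.Adj b z := by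
    intro a x y z hp
    have hq : (a1, [b, c]) ∈ [(a1, [b, c]), (a2, [x1, x2, x3]), (a3, [y1, y2, y3])] := by simp
    have hne : (a, [x, y, z]) ≠ (a1, [b, c]) := by simp
    exact ⟨h.nadj hL hp hq hne (u := []) (by rfl) (by rfl) (by simp),
      h.nadj hL hp hq hne (u := [x]) (by rfl) (by rfl) (by simp),
      h.nadjb hL hp hq hne (t := [x, y]) (by rfl) (by rfl)⟩
  obtain ⟨k1, k2, k3⟩ := key a2 x1 x2 x3 (by simp)
  obtain ⟨k4, k5, k6⟩ := key a3 y1 y2 y3 (by simp)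
  have hbC : b ∈ C := (hmem b).2 (by simp)
  have hbA := hA1.2 b (by simp)
  have hd := h.degD hL b (fun hyH => h.hHC b hyH hbC) hbA
  have := deg_le_list b [a1, a2, a3, c] (by
    intro w hw
    have := (hmem w).1 (h.nbrC hc hbC hbA hw)
    simp only [List.mem_cons, List.not_mem_nil, or_false] at this ⊢
    rcases this with rfl | rfl | rfl | rfl | rfl | rfl | rfl | rfl | rfl | rfl | rfl <;>
      first | exact absurd hw (by assumption) | exact absurd rfl hw.ne | simp)
  simp at this hd
  omega

theorem SC.K3 (h : SC G H C) (hL : Dec G (Att G H C) C L) (h3 : L.length = 3) : False := by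
  have e2 := h.E2 hL (by omega)
  have e3 := h.num hL
  have e4 := card_le h
  have s2 := h.seg2 hL (by omega)
  have hc : C.length + H.card = Fintype.card V := by omega
  have key : ∀ p q r, Dec G (Att G H C) C [p, q, r] →
      (p.2.length = 4 ∧ q.2.length = 2 ∧ r.2.length = 2 ∨
      p.2.length = 2 ∧ q.2.length = 3 ∧ r.2.length = 3) → False := by
    rintro ⟨a1, s1⟩ ⟨a2, s2⟩ ⟨a3, s3⟩ hD (⟨h1, h2, h3⟩ | ⟨h1, h2, h3⟩) <;> simp only at h1 h2 h3
    · obtain ⟨p1, p2, p3, p4, rfl⟩ := len4 h1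
      obtain ⟨b2, c2, rfl⟩ := len2 h2
      obtain ⟨b3, c3, rfl⟩ := len2 h3
      exact h.three422 hc hD
    · obtain ⟨b, c, rfl⟩ := len2 h1
      obtain ⟨x1, x2, x3, rfl⟩ := len3 h2
      obtain ⟨y1, y2, y3, rfl⟩ := len3 h3
      exact h.three332 hc hD
  obtain ⟨p, q, r, rfl⟩ := List.length_eq_three.1 h3
  have hlen := hL.perm.length_eq
  rw [flat_length] at hlen
  simp at hlen
  have t1 := s2 p (by simp)
  have t2 := s2 q (by simp)
  have t3 := s2 r (by simp)
  have r1 : Dec G (Att G H C) C [q, r, p] := Dec.rot (L := [p]) hL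
  have r2 : Dec G (Att G H C) C [r, p, q] := Dec.rot (L := [q]) r1
  have k1 : ¬ _ := key p q r hL
  have k2 : ¬ _ := key q r p r1
  have k3 : ¬ _ := key r p q r2
  omega

end
end HT

namespace HT
set_option linter.unusedSectionVars false
set_option linter.unusedSimpArgs false
variable {V : Type u} {G : SimpleGraph V}

theorem IsMx.ins_head {x y z : V} {l : List V} (h : IsMx G (x :: y :: l)) (hz : z ∉ x :: y :: l)
    (h1 : G.Adj z x) (h2 : G.Adj z y) : False := by
  have h' := h.rot (l := [x, y]) (m := l)
  exact h'.insert (y := z) (p := x) (q := y) (m := l) (by simp at hz ⊢; tauto)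
    rfl h1 h2

theorem cyc_of_chain {x : V} {l : List V} (h : ((x :: l) ++ [x]).IsChain G.Adj) : Cyc G (x :: l) := by
  have h1 : Pth G x ((x :: l) ++ [x]) x := ⟨h, rfl, by rw [List.getLast?_append]; simp⟩
  obtain ⟨c, d, h2, h3, h4⟩ := h1.split (by simp) (by simp)
  have := h4.head_eq (l := []); subst this
  exact ⟨x, c, h2.head_eq ▸ h2, h3⟩

theorem alt_ind {c1 c2 c3 c4 c5 c6 c7 c8 z : V} (h : IsMx G [c1, c2, c3, c4, c5, c6, c7, c8])
    (hz : z ∉ [c1, c2, c3, c4, c5, c6, c7, c8]) (h1 : G.Adj z c1) (h3 : G.Adj z c3)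
    (h7 : G.Adj z c7) : ¬ G.Adj c2 c4 ∧ ¬ G.Adj c2 c6 := by
  classical
  have hch := Cyc.chain h.2.1
  simp only [List.cons_append, List.nil_append, List.isChain_cons_cons, List.isChain_singleton,
    and_true] at hch
  obtain ⟨e1, e2, e3, e4, e5, e6, e7, e8⟩ := hch
  constructor <;> intro hh
  · refine h.no1 (l := [c3, c2, c4, c5, c6, c7, c8, c1, z]) hz (cyc_of_chain ?_) (perm_of_cnt fun y => ?_)
    · simp only [List.cons_append, List.nil_append, List.isChain_cons_cons, List.isChain_singleton,
        and_true]
      exact ⟨e2.symm, hh, e4, e5, e6, e7, e8, h1.symm, h3⟩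
    · simp only [cnt_cons]; omega
  · refine h.no1 (l := [c3, c4, c5, c6, c2, c1, c8, c7, z]) hz (cyc_of_chain ?_) (perm_of_cnt fun y => ?_)
    · simp only [List.cons_append, List.nil_append, List.isChain_cons_cons, List.isChain_singleton,
        and_true]
      exact ⟨e3, e4, e5, hh.symm, e1.symm, e8.symm, e7.symm, h7.symm, h3⟩
    · simp only [cnt_cons]; omega

section
variable [Fintype V] [DecidableEq V] [DecidableRel G.Adj] {H : Finset V} {C : List V}
  {L : List (V × List V)}

/-- the edge indicator -/
def ei (G : SimpleGraph V) [DecidableRel G.Adj] (u v : V) : ℕ := if G.Adj u v then 1 else 0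

theorem ei_le (u v : V) : ei G u v ≤ 1 := by unfold ei; split_ifs <;> omega
theorem ei_comm (u v : V) : ei G u v = ei G v u := by unfold ei; simp only [SimpleGraph.adj_comm]
theorem ei_one {u v : V} (h : ei G u v = 1) : G.Adj u v := by
  unfold ei at h; split_ifs at h with h'; exact h'
theorem ei_pos {u v : V} (h : G.Adj u v) : ei G u v = 1 := by unfold ei; simp [h]
theorem ei_zero {u v : V} (h : ¬ G.Adj u v) : ei G u v = 0 := by unfold ei; simp [h]
theorem ei_self (u : V) : ei G u u = 0 := by unfold ei; simp
theorem ei_or {u v w x : V} (h : G.Adj u v → G.Adj w x → False) : ei G u v + ei G w x ≤ 1 := by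
  unfold ei; split_ifs with h1 h2 <;> first | omega | exact (h h1 h2).elim

theorem deg_ei (v : V) (l : List V) (h : ∀ w, G.Adj v w → w ∈ l) :
    G.degree v ≤ (l.map (ei G v)).sum := by
  rw [← SimpleGraph.card_neighborFinset_eq_degree]
  have : G.neighborFinset v ⊆ (l.filter (fun w => G.Adj v w)).toFinset := by
    intro w hw; simp at hw ⊢; exact ⟨h w hw, hw⟩
  refine (Finset.card_le_card this).trans ((List.toFinset_card_le _).trans ?_)
  clear h this
  induction l with
  | nil => simp
  | cons x l ih =>
    by_cases hx : G.Adj v x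
    · simp [List.filter_cons, hx, ei_pos hx]; simpa [add_comm] using ih
    · simp [List.filter_cons, hx, ei_zero hx]; simpa using ih

theorem alt8 {c1 c2 c3 c4 c5 c6 c7 c8 z : V} (h : IsMx G [c1, c2, c3, c4, c5, c6, c7, c8])
    (hz : z ∉ [c1, c2, c3, c4, c5, c6, c7, c8])
    (hd : 4 ≤ ([c1, c2, c3, c4, c5, c6, c7, c8].map (ei G z)).sum) :
    (G.Adj z c1 ∧ G.Adj z c3 ∧ G.Adj z c5 ∧ G.Adj z c7 ∧
      ¬ G.Adj z c2 ∧ ¬ G.Adj z c4 ∧ ¬ G.Adj z c6 ∧ ¬ G.Adj z c8) ∨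
    (G.Adj z c2 ∧ G.Adj z c4 ∧ G.Adj z c6 ∧ G.Adj z c8 ∧
      ¬ G.Adj z c1 ∧ ¬ G.Adj z c3 ∧ ¬ G.Adj z c5 ∧ ¬ G.Adj z c7) := by
  have r1 := h.rot (l := [c1]); have r2 := h.rot (l := [c1, c2])
  have r3 := h.rot (l := [c1, c2, c3]); have r4 := h.rot (l := [c1, c2, c3, c4])
  have r5 := h.rot (l := [c1, c2, c3, c4, c5]); have r6 := h.rot (l := [c1, c2, c3, c4, c5, c6])
  have r7 := h.rot (l := [c1, c2, c3, c4, c5, c6, c7])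
  simp only [List.cons_append, List.nil_append] at r1 r2 r3 r4 r5 r6 r7
  simp only [List.mem_cons, List.not_mem_nil, or_false, not_or] at hz
  obtain ⟨z1, z2, z3, z4, z5, z6, z7, z8⟩ := hz
  have f1 := ei_or (h.ins_head (z := z) (by simp; tauto))
  have f2 := ei_or (r1.ins_head (z := z) (by simp; tauto))
  have f3 := ei_or (r2.ins_head (z := z) (by simp; tauto))
  have f4 := ei_or (r3.ins_head (z := z) (by simp; tauto))
  have f5 := ei_or (r4.ins_head (z := z) (by simp; tauto))
  have f6 := ei_or (r5.ins_head (z := z) (by simp; tauto))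
  have f7 := ei_or (r6.ins_head (z := z) (by simp; tauto))
  have f8 := ei_or (r7.ins_head (z := z) (by simp; tauto))
  simp only [List.map_cons, List.map_nil, List.sum_cons, List.sum_nil] at hd
  have conv : ∀ c, (G.Adj z c ↔ ei G z c = 1) := fun c => ⟨ei_pos, ei_one⟩
  simp only [conv]
  omega

theorem alt9 {c1 c2 c3 c4 c5 c6 c7 c8 c9 z : V} (h : IsMx G [c1, c2, c3, c4, c5, c6, c7, c8, c9])
    (hz : z ∉ [c1, c2, c3, c4, c5, c6, c7, c8, c9])
    (hd : 5 ≤ ([c1, c2, c3, c4, c5, c6, c7, c8, c9].map (ei G z)).sum) : False := by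
  have r1 := h.rot (l := [c1]); have r2 := h.rot (l := [c1, c2])
  have r3 := h.rot (l := [c1, c2, c3]); have r4 := h.rot (l := [c1, c2, c3, c4])
  have r5 := h.rot (l := [c1, c2, c3, c4, c5]); have r6 := h.rot (l := [c1, c2, c3, c4, c5, c6])
  have r7 := h.rot (l := [c1, c2, c3, c4, c5, c6, c7])
  have r8 := h.rot (l := [c1, c2, c3, c4, c5, c6, c7, c8])
  simp only [List.cons_append, List.nil_append] at r1 r2 r3 r4 r5 r6 r7 r8
  simp only [List.mem_cons, List.not_mem_nil, or_false, not_or] at hz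
  obtain ⟨z1, z2, z3, z4, z5, z6, z7, z8, z9⟩ := hz
  have f1 := ei_or (h.ins_head (z := z) (by simp; tauto))
  have f2 := ei_or (r1.ins_head (z := z) (by simp; tauto))
  have f3 := ei_or (r2.ins_head (z := z) (by simp; tauto))
  have f4 := ei_or (r3.ins_head (z := z) (by simp; tauto))
  have f5 := ei_or (r4.ins_head (z := z) (by simp; tauto))
  have f6 := ei_or (r5.ins_head (z := z) (by simp; tauto))
  have f7 := ei_or (r6.ins_head (z := z) (by simp; tauto))
  have f8 := ei_or (r7.ins_head (z := z) (by simp; tauto))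
  have f9 := ei_or (r8.ins_head (z := z) (by simp; tauto))
  simp only [List.map_cons, List.map_nil, List.sum_cons, List.sum_nil] at hd
  omega

theorem two_out {x y z z' : V} {l : List V} (h : IsMx G (x :: y :: l)) (hz : z ∉ x :: y :: l)
    (hz' : z' ∉ x :: y :: l) (e : G.Adj z z') (h1 : G.Adj z x) (h2 : G.Adj z' y) : False := by
  have hne := e.ne
  have hch := Cyc.chain h.2.1
  rw [List.cons_append, List.cons_append, List.isChain_cons_cons] at hch
  refine h.no (O := [z, z']) (l := x :: z :: z' :: y :: l) (by simpa using hne) (by simp at hz hz' ⊢; tauto)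
    (cyc_of_chain ?_) (perm_of_cnt fun w => ?_) (by simp)
  · simp only [List.cons_append, List.isChain_cons_cons]
    exact ⟨h1.symm, e, h2, hch.2⟩
  · simp only [cnt_cons, List.cons_append, List.nil_append]; omega

theorem two_out3 {x y w z z' : V} {l : List V} (h : IsMx G (x :: y :: w :: l))
    (hz : z ∉ x :: y :: w :: l)
    (hz' : z' ∉ x :: y :: w :: l) (e : G.Adj z z') (h1 : G.Adj z x) (h2 : G.Adj z' w) : False := by
  have hne := e.ne
  have hch := Cyc.chain h.2.1
  rw [List.cons_append, List.cons_append, List.cons_append, List.isChain_cons_cons,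
    List.isChain_cons_cons] at hch
  have hnd := h.1
  have := h.2.2 (x :: z :: z' :: w :: l) (by
    simp at hz hz' hnd ⊢
    refine ⟨?_, ?_, ?_, ?_⟩ <;> tauto) (cyc_of_chain (by
      simp only [List.cons_append, List.isChain_cons_cons]
      exact ⟨h1.symm, e, h2, hch.2.2⟩))
  simp at this

theorem out_count (h : SC G H C) (O : List V) (hO : O.Nodup) (hOZ : ∀ z ∈ O, z ∉ C ∧ z ∉ H) :
    C.length + H.card + O.length ≤ Fintype.card V := by
  have : (O.toFinset ∪ (C.toFinset ∪ H)).card ≤ Fintype.card V := Finset.card_le_univ _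
  rw [Finset.card_union_of_disjoint, Finset.card_union_of_disjoint,
    List.toFinset_card_of_nodup h.mx.1, List.toFinset_card_of_nodup hO] at this
  · omega
  · rw [Finset.disjoint_left]
    intro z hz hzH
    exact h.hHC z hzH (by simpa using hz)
  · rw [Finset.disjoint_left]
    intro z hz hzH
    simp at hz hzH
    have := hOZ z hz
    tauto

set_option maxHeartbeats 1000000 in
theorem rho1 (h : SC G H C) {c1 c2 c3 c4 c5 c6 c7 c8 z a a' : V}
    (hmx : IsMx G [c1, c2, c3, c4, c5, c6, c7, c8])
    (hp : [c1, c2, c3, c4, c5, c6, c7, c8].Perm C) (hz : z ∉ C) (hzH : z ∉ H)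
    (hall : ∀ w, w ∉ C → w ∉ H → w = z)
    (hA : ∀ w, Att G H C w → w = a ∨ w = a')
    (ha : a ∈ [c1, c3, c5, c7])
    (z1 : G.Adj z c1) (z3 : G.Adj z c3) (z5 : G.Adj z c5) (z7 : G.Adj z c7)
    (z2 : ¬ G.Adj z c2) (z4 : ¬ G.Adj z c4) (z6 : ¬ G.Adj z c6) (z8 : ¬ G.Adj z c8) : False := by
  have hz0 : z ∉ [c1, c2, c3, c4, c5, c6, c7, c8] := fun h => hz (hp.mem_iff.1 h)
  have r2 := hmx.rot (l := [c1, c2]); have r4 := hmx.rot (l := [c1, c2, c3, c4])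
  have r6 := hmx.rot (l := [c1, c2, c3, c4, c5, c6])
  simp only [List.cons_append, List.nil_append] at r2 r4 r6
  obtain ⟨v, hv⟩ := h.hne
  obtain ⟨i1, j1⟩ := alt_ind hmx hz0 z1 z3 z7
  obtain ⟨i2, j2⟩ := alt_ind r2 (z := z) (by simp at hz0 ⊢; tauto) z3 z5 z1
  obtain ⟨i3, j3⟩ := alt_ind r4 (z := z) (by simp at hz0 ⊢; tauto) z5 z7 z3
  obtain ⟨i4, j4⟩ := alt_ind r6 (z := z) (by simp at hz0 ⊢; tauto) z7 z1 z5
  have hnd := hmx.1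
  have hvC := h.hHC v hv
  have hv0 : v ∉ [c1, c2, c3, c4, c5, c6, c7, c8] := fun h => hvC (hp.mem_iff.1 h)
  have hvz : v ≠ z := fun e => hzH (e ▸ hv)
  have hsub : ∀ w ∈ [c2, c4, c6, c8].filter (fun w => w ≠ a'), w ∈ [c2, c4, c6, c8] ∧ w ≠ a' := by
    intro w hw; simpa [List.mem_filter] using hw
  have hlen : 3 ≤ ([c2, c4, c6, c8].filter (fun w => w ≠ a')).length := by
    simp only [List.nodup_cons, List.mem_cons, List.not_mem_nil, or_false, not_or] at hnd
    obtain ⟨n1, n2, n3, n4, n5, n6, n7, n8⟩ := hnd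
    by_cases e2 : c2 = a' <;> by_cases e4 : c4 = a' <;> by_cases e6 : c6 = a' <;>
      by_cases e8 : c8 = a' <;> simp [e2, e4, e6, e8] <;> (exfalso; subst_vars; simp_all)
  have nd2 : (z :: [c2, c4, c6, c8].filter (fun w => w ≠ a')).Nodup := by
    rw [List.nodup_cons]
    refine ⟨fun hh => ?_, List.Nodup.filter _ ?_⟩
    · have := (hsub _ hh).1
      simp at this hz0; tauto
    · simp only [List.nodup_cons, List.mem_cons, List.not_mem_nil, or_false, not_or] at hnd ⊢
      simp; tauto
  have := tough_iso2 h.cx.tough (z :: [c2, c4, c6, c8].filter (fun w => w ≠ a')) [c1, c3, c5, c7]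
    nd2 ?_ ?_ (by simp) v ?_ ?_
  · simp only [List.length_cons, List.length_nil] at this; omega
  · intro w hw hS
    rcases List.mem_cons.1 hw with rfl | hw
    · simp at hS hz0; tauto
    · have := (hsub _ hw).1
      simp only [List.nodup_cons, List.mem_cons, List.not_mem_nil, or_false, not_or] at hnd this hS
      grind
  · intro w hw y hy
    have hyH : y ∉ H := by
      intro hyH
      rcases List.mem_cons.1 hw with rfl | hw
      · rcases h.hN y hyH _ hy.symm with h' | h'
        · exact hzH h'
        · exact hz h'
      · have h1 := hsub _ hw
        have hwC : w ∈ C := hp.mem_iff.1 (by have := h1.1; simp at this ⊢; tauto)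
        rcases hA w ⟨hwC, y, hyH, hy⟩ with rfl | rfl
        · have := h1.1
          simp only [List.nodup_cons, List.mem_cons, List.not_mem_nil, or_false, not_or] at hnd this ha
          grind
        · exact h1.2 rfl
    by_cases hyC : y ∈ C
    · have hy8 := hp.mem_iff.2 hyC
      have hw' : w = z ∨ w ∈ [c2, c4, c6, c8] := by
        rcases List.mem_cons.1 hw with h | h
        · exact Or.inl h
        · exact Or.inr (hsub _ h).1
      clear hw
      simp only [List.mem_cons, List.not_mem_nil, or_false] at hy8 hw' ⊢
      rcases hw' with rfl | rfl | rfl | rfl | rfl <;>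
        rcases hy8 with rfl | rfl | rfl | rfl | rfl | rfl | rfl | rfl <;> 
        first | exact absurd hy (by assumption) | exact absurd hy.symm (by assumption) | exact absurd rfl hy.ne | simp
    · have := hall y hyC hyH
      subst this
      exfalso
      rcases List.mem_cons.1 hw with rfl | hw
      · exact hy.ne rfl
      · have := (hsub _ hw).1
        have sy := hy.symm
        simp only [List.mem_cons, List.not_mem_nil, or_false] at this
        rcases this with rfl | rfl | rfl | rfl <;> exact absurd sy (by assumption)
  · simp only [List.mem_cons, not_or]
    refine ⟨hvz, fun hh => ?_⟩
    have := (hsub _ hh).1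
    simp at this hv0; tauto
  · simp at hv0 ⊢; tauto

end
end HT

namespace HT
set_option linter.unusedSectionVars false
set_option linter.unusedSimpArgs false
variable {V : Type u} {G : SimpleGraph V}
section
variable [Fintype V] [DecidableEq V] [DecidableRel G.Adj] {H : Finset V} {C : List V}
  {L : List (V × List V)}

theorem len8 {l : List V} (h : l.length = 8) :
    ∃ a b c d e f g i, l = [a, b, c, d, e, f, g, i] := by
  match l, h with
  | [a, b, c, d, e, f, g, i], _ => exact ⟨a, b, c, d, e, f, g, i, rfl⟩
theorem len9 {l : List V} (h : l.length = 9) :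
    ∃ a b c d e f g i j, l = [a, b, c, d, e, f, g, i, j] := by
  match l, h with
  | [a, b, c, d, e, f, g, i, j], _ => exact ⟨a, b, c, d, e, f, g, i, j, rfl⟩

theorem rho2 {c1 c2 c3 c4 c5 c6 c7 c8 z z' : V}
    (hmx : IsMx G [c1, c2, c3, c4, c5, c6, c7, c8])
    (hz : z ∉ [c1, c2, c3, c4, c5, c6, c7, c8]) (hz' : z' ∉ [c1, c2, c3, c4, c5, c6, c7, c8])
    (hd : 5 ≤ ei G z z' + ([c1, c2, c3, c4, c5, c6, c7, c8].map (ei G z)).sum)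
    (hd' : 5 ≤ ei G z z' + ([c1, c2, c3, c4, c5, c6, c7, c8].map (ei G z')).sum) : False := by
  have i1 := ei_le (G := G) z z'
  have k1 := alt8 hmx hz (by omega)
  have k2 := alt8 hmx hz' (by omega)
  have hzz : G.Adj z z' := by
    by_contra hn
    rw [ei_zero hn] at hd
    have le : ∀ c, ei G z c ≤ 1 := fun c => ei_le z c
    have l1 := le c1; have l2 := le c2; have l3 := le c3; have l4 := le c4
    have l5 := le c5; have l6 := le c6; have l7 := le c7; have l8 := le c8
    simp only [List.map_cons, List.map_nil, List.sum_cons, List.sum_nil] at hd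
    rcases k1 with ⟨-, -, -, -, m1, m2, m3, m4⟩ | ⟨-, -, -, -, m1, m2, m3, m4⟩ <;>
    · have := ei_zero m1; have := ei_zero m2; have := ei_zero m3; have := ei_zero m4
      omega
  have r1 := hmx.rot (l := [c1])
  simp only [List.cons_append, List.nil_append] at r1
  have y1 : z ∉ [c2, c3, c4, c5, c6, c7, c8, c1] := by simp at hz ⊢; tauto
  have y2 : z' ∉ [c2, c3, c4, c5, c6, c7, c8, c1] := by simp at hz' ⊢; tauto
  rcases k1 with k1 | k1 <;> rcases k2 with k2 | k2
  · exact two_out3 hmx hz hz' hzz k1.1 k2.2.1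
  · exact two_out hmx hz hz' hzz k1.1 k2.1
  · exact two_out hmx hz' hz hzz.symm k2.1 k1.1
  · exact two_out3 r1 y1 y2 hzz k1.1 k2.2.1

theorem SC.K2rho (h : SC G H C) {a1 a2 : V} {s1 s2 : List V}
    (hL : Dec G (Att G H C) C [(a1, s1), (a2, s2)])
    (hc : C.length + H.card < Fintype.card V) : False := by
  have e2 := h.E2 hL (by simp)
  have e3 := h.num hL
  have sg1 := h.seg2 hL (by simp) (a1, s1) (by simp)
  have sg2 := h.seg2 hL (by simp) (a2, s2) (by simp)
  simp only [List.length_cons, List.length_nil] at e2 e3 sg1 sg2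
  have hlen := hL.perm.length_eq
  simp only [flat_cons, flat_nil, List.append_nil, List.length_cons, List.length_append] at hlen
  obtain ⟨z, hzC, hzH⟩ : ∃ z, z ∉ C ∧ z ∉ H := by
    by_contra hcon
    push Not at hcon
    have : (Finset.univ : Finset V) ⊆ C.toFinset ∪ H := by
      intro z _
      simp only [Finset.mem_union, List.mem_toFinset]
      by_cases hz : z ∈ C
      · exact Or.inl hz
      · exact Or.inr (hcon z hz)
    have := (Finset.card_le_card this).trans (Finset.card_union_le _ _)
    rw [Finset.card_univ] at this
    have := List.toFinset_card_le C
    omega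
  have degz : ∀ z, z ∉ C → z ∉ H → Fintype.card V ≤ G.degree z + 5 + H.card := by
    intro z hzC hzH
    have := h.degD hL z hzH (fun hA => hzC hA.1)
    simp at this; omega
  have nH : ∀ z, z ∉ C → z ∉ H → ∀ w, G.Adj z w → w ∉ H := by
    intro z hzC hzH w hw hwH
    rcases h.hN w hwH z hw.symm with h' | h' <;> tauto
  have hmem := fun w => hL.perm.mem_iff (a := w)
  have hpm := hL.perm
  have hmx := hL.mx
  by_cases hr : Fintype.card V = C.length + H.card + 1
  · have hall : ∀ w, w ∉ C → w ∉ H → w = z := by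
      intro w hw hwH
      by_contra hne
      have := out_count h [w, z] (by simpa using hne) (by simp; tauto)
      simp at this; omega
    have hd := deg_ei z (flat [(a1, s1), (a2, s2)]) (by
      intro w hw
      by_contra hwC
      rw [hmem] at hwC
      exact hw.ne (hall w hwC (nH z hzC hzH w hw)).symm)
    have hdz := degz z hzC hzH
    have hzf : z ∉ flat [(a1, s1), (a2, s2)] := fun hh => hzC ((hmem z).1 hh)
    by_cases h9 : C.length = 9
    · obtain ⟨c1, c2, c3, c4, c5, c6, c7, c8, c9, e⟩ := len9 (l := flat [(a1, s1), (a2, s2)])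
        (hL.perm.length_eq.trans h9)
      rw [e] at hmx hd hzf
      exact alt9 hmx hzf (by omega)
    · have h8 : C.length = 8 := by omega
      have hA : ∀ w, Att G H C w → w = a1 ∨ w = a2 := by
        intro w hw
        have := (SC.attL hL w).1 hw
        simpa using this
      obtain ⟨c1, c2, c3, c4, c5, c6, c7, c8, e⟩ := len8 (l := flat [(a1, s1), (a2, s2)])
        (hL.perm.length_eq.trans h8)
      rw [e] at hmx hd hzf hpm
      have r1 := hmx.rot (l := [c1])
      simp only [List.cons_append, List.nil_append] at r1
      simp only [flat_cons, flat_nil, List.append_nil] at e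
      injection e with ea e
      subst ea
      rcases alt8 hmx hzf (by omega) with k | k
      · exact rho1 h hmx hpm hzC hzH hall hA (by simp) k.1 k.2.1 k.2.2.1 k.2.2.2.1 k.2.2.2.2.1
          k.2.2.2.2.2.1 k.2.2.2.2.2.2.1 k.2.2.2.2.2.2.2
      · by_cases ha2 : a2 ∈ [c2, c4, c6, c8]
        · exact rho1 h r1 ((perm_of_cnt fun w => by simp only [cnt_cons]; omega).trans hpm)
            hzC hzH hall (fun w hw => (hA w hw).symm) ha2 k.1 k.2.1 k.2.2.1 k.2.2.2.1 k.2.2.2.2.2.1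
            k.2.2.2.2.2.2.1 k.2.2.2.2.2.2.2 k.2.2.2.2.1
        · -- the middle case, `a2 = c5`
          have : s1.length = 3 := by
            by_contra hne
            have : s1.length = 2 ∨ s1.length = 4 := by omega
            rcases this with h' | h'
            · obtain ⟨x, y, rfl⟩ := len2 h'
              simp at e; simp [e] at ha2
            · obtain ⟨x, y, x', y', rfl⟩ := len4 h'
              simp at e; simp [e] at ha2
          obtain ⟨x, y, w, rfl⟩ := len3 this
          simp only [List.cons_append, List.nil_append] at e
          injection e with q1 e; injection e with q2 e; injection e with q3 e
          injection e with q4 e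
          subst q1 q2 q3 q4 e
          obtain ⟨b1, cc1, d1, b2, cc2, d2, W1, W2, ar⟩ := hL.arcs (p := (a1, [x, y, w]))
            (q := (a2, [c6, c7, c8])) (by simp) (by simp) (by
              have := hL.nodup_fst
              simp at this
              simp [this]) (by simp) (by simp)
          have := ar.p2.head_eq; subst this
          exact h.conn_a ar (hL.hA (a1, [x, y, w]) (by simp)).2 (u := []) (y := x) (w := [y, w]) rfl
            (by simp) (O := [z]) (by simp) (by simp; tauto)
            (((Pth.single x).cons k.1).cons k.2.2.1.symm)
  · have hr2 : Fintype.card V = C.length + H.card + 2 := by omega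
    obtain ⟨z', hzC', hzH', hzz⟩ : ∃ z', z' ∉ C ∧ z' ∉ H ∧ z' ≠ z := by
      by_contra hcon
      push Not at hcon
      have : (Finset.univ : Finset V) ⊆ insert z (C.toFinset ∪ H) := by
        intro w _
        simp only [Finset.mem_insert, Finset.mem_union, List.mem_toFinset]
        have := hcon w; tauto
      have := (Finset.card_le_card this).trans (Finset.card_insert_le _ _)
      have := Finset.card_union_le C.toFinset H
      rw [Finset.card_univ] at *
      have := List.toFinset_card_le C
      omega
    have hall : ∀ w, w ∉ C → w ∉ H → w = z ∨ w = z' := by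
      intro w hw hwH
      by_contra hne
      have := out_count h [w, z, z'] (by simp; tauto) (by simp; tauto)
      simp at this; omega
    have h8 : C.length = 8 := by omega
    have hd := deg_ei z (z' :: flat [(a1, s1), (a2, s2)]) (by
      intro w hw
      by_contra hwC
      rw [List.mem_cons, hmem] at hwC
      push Not at hwC
      rcases hall w hwC.2 (nH z hzC hzH w hw) with rfl | rfl
      · exact hw.ne rfl
      · exact hwC.1 rfl)
    have hd' := deg_ei z' (z :: flat [(a1, s1), (a2, s2)]) (by
      intro w hw
      by_contra hwC
      rw [List.mem_cons, hmem] at hwC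
      push Not at hwC
      rcases hall w hwC.2 (nH z' hzC' hzH' w hw) with rfl | rfl
      · exact hwC.1 rfl
      · exact hw.ne rfl)
    have d1 := degz z hzC hzH
    have d2 := degz z' hzC' hzH'
    have hzf : z ∉ flat [(a1, s1), (a2, s2)] := fun hh => hzC ((hmem z).1 hh)
    have hzf' : z' ∉ flat [(a1, s1), (a2, s2)] := fun hh => hzC' ((hmem z').1 hh)
    obtain ⟨c1, c2, c3, c4, c5, c6, c7, c8, e⟩ := len8 (l := flat [(a1, s1), (a2, s2)])
        (hL.perm.length_eq.trans h8)
    rw [List.map_cons, List.sum_cons] at hd hd'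
    rw [ei_comm z' z] at hd'
    rw [e] at hmx hd hd' hzf hzf'
    exact rho2 hmx hzf hzf' (by omega) (by omega)

end
end HT

namespace HT
set_option linter.unusedSectionVars false
set_option linter.unusedSimpArgs false
variable {V : Type u} {G : SimpleGraph V}
section
variable [Fintype V] [DecidableEq V] [DecidableRel G.Adj] {H : Finset V} {C : List V}
  {L : List (V × List V)}

structure Two (G : SimpleGraph V) [DecidableRel G.Adj] (H : Finset V) (C : List V) (a1 : V)
    (s1 : List V) (a2 : V) (s2 : List V) : Prop where
  sc : SC G H C
  dec : Dec G (Att G H C) C [(a1, s1), (a2, s2)]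
  full : C.length + H.card = Fintype.card V

variable {a1 a2 : V} {s1 s2 : List V}

theorem Two.swap (h : Two G H C a1 s1 a2 s2) : Two G H C a2 s2 a1 s1 :=
  ⟨h.sc, Dec.rot (L := [(a1, s1)]) h.dec, h.full⟩

theorem Two.mirror (h : Two G H C a1 s1 a2 s2) : Two G H C a1 s2.reverse a2 s1.reverse := by
  obtain ⟨h1, ⟨m1, m2, m3⟩, h3⟩ := h
  have hp : (flat [(a1, s2.reverse), (a2, s1.reverse)]).Perm (flat [(a1, s1), (a2, s2)]) :=
    perm_of_cnt fun z => by
      simp only [flat_cons, flat_nil, cnt_cons, List.count_append, List.count_reverse,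
        List.append_nil]; omega
  refine ⟨h1, ⟨?_, hp.trans m2, ?_⟩, h3⟩
  · have := (m1.rot (l := [a1]) (m := s1 ++ a2 :: (s2 ++ []))).rev
    simpa using this
  · have k1 := m3 (a1, s1) (by simp)
    have k2 := m3 (a2, s2) (by simp)
    intro p hp
    simp at hp
    rcases hp with rfl | rfl
    · exact ⟨k1.1, by simpa using k2.2⟩
    · exact ⟨k2.1, by simpa using k1.2⟩

theorem Two.ne (h : Two G H C a1 s1 a2 s2) : a1 ≠ a2 := by
  have := h.dec.nodup_fst
  simp at this; exact this

theorem Two.att1 (h : Two G H C a1 s1 a2 s2) : Att G H C a1 := (h.dec.hA (a1, s1) (by simp)).1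
theorem Two.att2 (h : Two G H C a1 s1 a2 s2) : Att G H C a2 := h.swap.att1
theorem Two.nat (h : Two G H C a1 s1 a2 s2) {w : V} (hw : w ∈ s1 ++ s2) : ¬ Att G H C w := by
  rcases List.mem_append.1 hw with hw | hw
  · exact (h.dec.hA (a1, s1) (by simp)).2 w hw
  · exact (h.dec.hA (a2, s2) (by simp)).2 w hw
theorem Two.memC (h : Two G H C a1 s1 a2 s2) (w : V) : w ∈ C ↔ w ∈ a1 :: (s1 ++ a2 :: s2) := by
  rw [← h.dec.perm.mem_iff]; simp

theorem Two.no (h : Two G H C a1 s1 a2 s2) {Q : List V} (hc : Q.IsChain G.Adj)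
    (h1 : Q.head? = some a1) (h2 : Q.getLast? = some a2)
    (hp : ∀ z, Q.count z = (a1 :: (s1 ++ a2 :: s2)).count z) : False := by
  refine h.sc.noQ (O := []) (Q := Q) h.att1 h.att2 h.ne ⟨hc, h1, h2⟩ (by simp) (by simp) ?_
  refine (perm_of_cnt fun z => ?_).trans h.dec.perm
  simpa using hp z

theorem Two.no1 (h : Two G H C a1 s1 a2 s2) {Q : List V} (w : V) (hw : w ∈ s1 ++ s2)
    (hc : Q.IsChain G.Adj)
    (h1 : Q.head? = some a1) (h2 : Q.getLast? = some a2)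
    (hp : ∀ z, (w :: Q).count z = (a1 :: (s1 ++ a2 :: s2)).count z) : False := by
  refine h.sc.noQ1 (O := []) (Q := Q) (w := w) h.att1 h.att2 h.ne (h.nat hw) ⟨hc, h1, h2⟩ (by simp)
    (by simp) ?_
  refine (perm_of_cnt fun z => ?_).trans h.dec.perm
  simpa using hp z

theorem Two.inC (h : Two G H C a1 s1 a2 s2) {y : V} (hy : y ∈ s1 ++ s2) : y ∈ C :=
  (h.memC y).2 (by simp at hy ⊢; tauto)

theorem Two.nb (h : Two G H C a1 s1 a2 s2) {y w : V} (hy : y ∈ s1 ++ s2) (hw : G.Adj y w) :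
    w ∈ a1 :: (s1 ++ a2 :: s2) :=
  (h.memC w).1 (h.sc.nbrC h.full (h.inC hy) (h.nat hy) hw)

theorem Two.deg (h : Two G H C a1 s1 a2 s2) {y : V} (hy : y ∈ s1 ++ s2) :
    C.length ≤ G.degree y + 5 := by
  have := h.sc.degD h.dec y (fun hH => h.sc.hHC y hH (h.inC hy)) (h.nat hy)
  have := h.full
  simp at *
  omega

theorem Two.degs (h : Two G H C a1 s1 a2 s2) {y : V} (hy : y ∈ s1 ++ s2) :
    C.length ≤ ((a1 :: (s1 ++ a2 :: s2)).map (ei G y)).sum + 5 :=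
  (h.deg hy).trans (Nat.add_le_add_right (deg_ei y _ fun _ hw => h.nb hy hw) 5)

theorem Two.clen (h : Two G H C a1 s1 a2 s2) : C.length = s1.length + s2.length + 2 := by
  have := h.dec.perm.length_eq
  simp at this; omega

theorem Two.conn (h : Two G H C a1 s1 a2 s2) (hn : ∀ y ∈ s1, ∀ y' ∈ s2, ¬ G.Adj y y') : False := by
  refine h.sc.noconn_false h.dec (by simp) ?_
  have key : ∀ O : List V, (∀ z ∈ O, z ∉ C ∧ z ∉ H) → O = [] := by
    intro O hO
    cases O with
    | nil => rfl
    | cons z O =>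
      have := hO z (by simp)
      exact absurd (all_of_card h.sc h.full z this.2) this.1
  intro p hp q hq hpq y hy y' hy' O _ hO hP
  have := key O hO; subst this
  have ha : G.Adj y y' := by
    have := hP.1
    simpa using this
  simp at hp hq
  rcases hp with rfl | rfl <;> rcases hq with rfl | rfl
  · exact hpq rfl
  · exact hn y hy y' hy' ha
  · exact hn y' hy' y hy ha.symm
  · exact hpq rfl

theorem Two.chain (h : Two G H C a1 s1 a2 s2) :
    (a1 :: (s1 ++ a2 :: (s2 ++ [a1]))).IsChain G.Adj := by
  have := Cyc.chain (x := a1) h.dec.mx.2.1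
  simpa using this

theorem Two.nodup (h : Two G H C a1 s1 a2 s2) : (a1 :: (s1 ++ a2 :: s2)).Nodup := by
  simpa using h.dec.mx.1

theorem Two.nH (h : Two G H C a1 s1 a2 s2) {v y : V} (hv : v ∈ H) (hy : y ∈ s1 ++ s2) :
    ¬ G.Adj v y ∧ v ≠ y := by
  refine ⟨fun e => h.nat hy ⟨h.inC hy, v, hv, e.symm⟩, ?_⟩
  rintro rfl
  exact h.sc.hHC v hv (h.inC hy)

theorem Two.degH (h : Two G H C a1 s1 a2 s2) {v : V} (hv : v ∈ H) (h1 : s1 ≠ []) (h2 : s2 ≠ []) :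
    2 * H.card + C.length ≤ 2 * G.degree v + 8 := by
  obtain ⟨b1, t1, rfl⟩ := List.exists_cons_of_ne_nil h1
  obtain ⟨b2, t2, rfl⟩ := List.exists_cons_of_ne_nil h2
  have hp : Pth G a1 (a1 :: ((b1 :: t1) ++ a2 :: ((b2 :: t2) ++ [a1]))) a1 :=
    ⟨h.chain, rfl, by simp [List.getLast?_cons]⟩
  obtain ⟨c, d, k1, k2, k3⟩ := Pth.split (l := a1 :: ((b1 :: t1) ++ [a2])) (m := (b2 :: t2) ++ [a1])
    (by simpa using hp) (by simp) (by simp)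
  have := Pth.last_eq (l := a1 :: b1 :: t1) k1; subst this
  have := k3.head_eq; subst this
  obtain ⟨d, k4, k5⟩ := k1.tail (by simp)
  have := k5.head_eq; subst this
  have := h.sc.pair (U1 := b1 :: t1 ++ [a2]) (U2 := b2 :: t2 ++ [a1]) h.att1 h.att2 h.ne
    k5 k3 k4 k2 (by
      refine (perm_of_cnt fun z => ?_).trans h.dec.perm
      simp only [flat_cons, flat_nil, cnt_cons, List.count_append, List.count_nil,
        List.append_nil, List.cons_append]; omega)
  obtain ⟨n1, n1'⟩ := h.nH (y := b1) hv (by simp)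
  obtain ⟨n2, n2'⟩ := h.nH (y := b2) hv (by simp)
  have := h.sc.cx.sig v b1 n1' n1
  have := h.sc.cx.sig v b2 n2' n2
  have := h.full
  omega

theorem Two.nbH (h : Two G H C a1 s1 a2 s2) {v w : V} (hv : v ∈ H) (hw : G.Adj v w) :
    w ∈ H.erase v ∪ {a1, a2} := by
  rcases h.sc.hN v hv w hw with h' | h'
  · simp [h', hw.ne.symm]
  · have := (SC.attL h.dec w).1 ⟨h', v, hv, hw.symm⟩
    simp at this ⊢; tauto

theorem Two.nin (h : Two G H C a1 s1 a2 s2) : a1 ∉ H ∧ a2 ∉ H :=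
  ⟨fun hh => h.sc.hHC _ hh h.att1.1, fun hh => h.sc.hHC _ hh h.att2.1⟩

theorem Two.cardH (h : Two G H C a1 s1 a2 s2) {v : V} (hv : v ∈ H) :
    (H.erase v ∪ {a1, a2}).card = H.card + 1 := by
  have := h.nin
  rw [Finset.card_union_of_disjoint, Finset.card_erase_of_mem hv, Finset.card_pair h.ne]
  · have := Finset.card_pos.2 ⟨v, hv⟩; omega
  · rw [Finset.disjoint_left]; intro z hz hz'
    simp at hz hz'
    rcases hz' with rfl | rfl <;> tauto

theorem Two.full2 (h : Two G H C a1 s1 a2 s2) (h1 : s1 ≠ []) (h2 : s2 ≠ []) (h8 : C.length = 8)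
    {v : V} (hv : v ∈ H) {u u' : V} (hu : u ∈ H.erase v ∪ {a1, a2})
    (hu' : u' ∈ H.erase v ∪ {a1, a2}) (hne : u ≠ u') : G.Adj v u ∨ G.Adj v u' := by
  by_contra hcon
  push Not at hcon
  have hd := h.degH hv h1 h2
  have hs : G.neighborFinset v ⊆ ((H.erase v ∪ {a1, a2}).erase u).erase u' := by
    intro w hw
    simp only [SimpleGraph.mem_neighborFinset] at hw
    simp only [Finset.mem_erase]
    exact ⟨fun e => hcon.2 (e ▸ hw), fun e => hcon.1 (e ▸ hw), h.nbH hv hw⟩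
  have := Finset.card_le_card hs
  rw [Finset.card_erase_of_mem (by simp only [Finset.mem_erase]; exact ⟨hne.symm, hu'⟩),
    Finset.card_erase_of_mem hu, h.cardH hv, SimpleGraph.card_neighborFinset_eq_degree] at this
  have := Finset.card_pos.2 ⟨v, hv⟩
  omega

theorem Two.full3 (h : Two G H C a1 s1 a2 s2) (h1 : s1 ≠ []) (h2 : s2 ≠ []) (h9 : C.length = 9)
    {v : V} (hv : v ∈ H) {u : V} (hu : u ∈ H.erase v ∪ {a1, a2}) : G.Adj v u := by
  by_contra hcon
  have hd := h.degH hv h1 h2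
  have hs : G.neighborFinset v ⊆ (H.erase v ∪ {a1, a2}).erase u := by
    intro w hw
    simp only [SimpleGraph.mem_neighborFinset] at hw
    simp only [Finset.mem_erase]
    exact ⟨fun e => hcon (e ▸ hw), h.nbH hv hw⟩
  have := Finset.card_le_card hs
  rw [Finset.card_erase_of_mem hu, h.cardH hv, SimpleGraph.card_neighborFinset_eq_degree] at this
  have := Finset.card_pos.2 ⟨v, hv⟩
  omega

/-- closing a path of `C` through vertices of `H` -/
theorem Two.close (h : Two G H C a1 s1 a2 s2) {Q P : List V} {u v w w' : V} (hQ : Pth G a1 Q a2)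
    (hp : (w :: w' :: Q).Perm C) (hP : Pth G u P v) (hPn : P.Nodup) (hPH : ∀ z ∈ P, z ∈ H)
    (h1 : G.Adj v a1) (h2 : G.Adj a2 u) : (P ++ Q).Nodup ∧ Cyc G (P ++ Q) := by
  constructor
  · have := hp.nodup_iff.2 h.sc.mx.1
    simp only [List.nodup_cons] at this
    rw [List.nodup_append]
    refine ⟨hPn, this.2.2, ?_⟩
    rintro a ha _ hb rfl
    exact h.sc.hHC a (hPH a ha) (hp.mem_iff.1 (by simp [hb]))
  · exact ⟨u, a2, hP.app h1 hQ, h2⟩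

theorem Two.no2E2 (h : Two G H C a1 s1 a2 s2) (h1 : s1 ≠ []) (h2 : s2 ≠ []) (h8 : C.length = 8)
    {Q : List V} {w w' : V} (hQ : Pth G a1 Q a2) (hp : (w :: w' :: Q).Perm C) : False := by
  have hh : 3 ≤ H.card := by have := h.full; have := h.sc.cx.n11; omega
  have nin := h.nin
  suffices hs : ∃ v1 v2 v3, v1 ∈ H ∧ v2 ∈ H ∧ v3 ∈ H ∧ G.Adj v1 v2 ∧ G.Adj v2 v3 ∧ v1 ≠ v3 ∧
      G.Adj a1 v1 ∧ G.Adj a2 v3 by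
    obtain ⟨v1, v2, v3, m1, m2, m3, e1, e2, e3, e4, e5⟩ := hs
    have k := h.close hQ hp (P := [v3, v2, v1]) (((Pth.single v1).cons e1.symm).cons e2.symm)
      (by have := e1.ne; have := e2.ne; simp; tauto) (by simp; tauto) e4.symm e5
    have := h.sc.mx.2.2 _ k.1 k.2
    have := hp.length_eq
    simp at *
    omega
  have F : ∀ v ∈ H, ∀ u u', u ∈ H.erase v ∪ {a1, a2} → u' ∈ H.erase v ∪ {a1, a2} → u ≠ u' →
      G.Adj v u ∨ G.Adj v u' := fun v hv u u' hu hu' hne => h.full2 h1 h2 h8 hv hu hu' hne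
  simp only [Finset.mem_union, Finset.mem_erase, Finset.mem_insert, Finset.mem_singleton] at F
  have na := h.ne
  -- two special vertices, then a third
  have key : ∀ u v, u ∈ H → v ∈ H → u ≠ v → G.Adj a1 u → G.Adj a2 v →
      ∃ v1 v2 v3, v1 ∈ H ∧ v2 ∈ H ∧ v3 ∈ H ∧ G.Adj v1 v2 ∧ G.Adj v2 v3 ∧ v1 ≠ v3 ∧
      G.Adj a1 v1 ∧ G.Adj a2 v3 := by
    intro u v hu hv huv e1 e2
    obtain ⟨w, hw⟩ : ∃ w, w ∈ (H.erase u).erase v := by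
      apply Finset.card_pos.1
      rw [Finset.card_erase_of_mem (by simp [hv, huv.symm]), Finset.card_erase_of_mem hu]
      omega
    simp only [Finset.mem_erase] at hw
    obtain ⟨wv, wu, hw⟩ := hw
    have wa1 : w ≠ a1 := fun e => nin.1 (e ▸ hw)
    have wa2 : w ≠ a2 := fun e => nin.2 (e ▸ hw)
    have ua1 : u ≠ a1 := fun e => nin.1 (e ▸ hu)
    have ua2 : u ≠ a2 := fun e => nin.2 (e ▸ hu)
    have va1 : v ≠ a1 := fun e => nin.1 (e ▸ hv)
    have va2 : v ≠ a2 := fun e => nin.2 (e ▸ hv)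
    by_cases uw : G.Adj u w
    · by_cases vw : G.Adj v w
      · exact ⟨u, w, v, hu, hw, hv, uw, vw.symm, huv, e1, e2⟩
      · have vw' : ¬ G.Adj w v := fun e => vw e.symm
        have x1 := F w hw v a1 (by tauto) (by tauto) va1
        have x2 := F v hv w u (by tauto) (by tauto) wu
        exact ⟨w, u, v, hw, hu, hv, uw.symm, (x2.resolve_left vw).symm, wv,
          (x1.resolve_left vw').symm, e2⟩
    · have uw' : ¬ G.Adj w u := fun e => uw e.symm
      have x1 := F w hw u a2 (by tauto) (by tauto) ua2
      have x2 := F u hu w v (by tauto) (by tauto) wv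
      have x3 := F w hw u v (by tauto) (by tauto) huv
      exact ⟨u, v, w, hu, hv, hw, x2.resolve_left uw, (x3.resolve_left uw').symm, wu.symm, e1,
        (x1.resolve_left uw').symm⟩
  obtain ⟨-, u, hu, e1⟩ := h.att1
  by_cases hex : ∃ v ∈ H, v ≠ u ∧ G.Adj a2 v
  · obtain ⟨v, hv, hne, e2⟩ := hex
    exact key u v hu hv hne.symm e1 e2
  · push Not at hex
    obtain ⟨-, u', hu', e2⟩ := h.att2
    have : u' = u := by by_contra hne; exact hex u' hu' hne e2
    subst this
    obtain ⟨w, hw⟩ : ∃ w, w ∈ H.erase u' := by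
      apply Finset.card_pos.1
      rw [Finset.card_erase_of_mem hu]
      omega
    simp only [Finset.mem_erase] at hw
    have x1 := F w hw.2 a1 a2 (by tauto) (by tauto) na
    exact key w u' hw.2 hu hw.1
      ((x1.resolve_right (fun e => hex w hw.2 hw.1 e.symm)).symm) e2

theorem Two.no2E3 (h : Two G H C a1 s1 a2 s2) (h1 : s1 ≠ []) (h2 : s2 ≠ []) (h9 : C.length = 9)
    {Q : List V} {w w' : V} (hw : w ∈ s1 ++ s2) (hw' : w' ∈ s1 ++ s2) (e : G.Adj w w')
    (hQ : Pth G a1 Q a2) (hp : (w :: w' :: Q).Perm C) : False := by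
  have hh : 2 ≤ H.card := by have := h.full; have := h.sc.cx.n11; omega
  have nin := h.nin
  have F : ∀ v ∈ H, ∀ u, u ∈ H.erase v ∪ {a1, a2} → G.Adj v u :=
    fun v hv u hu => h.full3 h1 h2 h9 hv hu
  simp only [Finset.mem_union, Finset.mem_erase, Finset.mem_insert, Finset.mem_singleton] at F
  obtain ⟨u, hu, v, hv, huv⟩ := Finset.one_lt_card.1 (show 1 < H.card by omega)
  have euv := F u hu v (by tauto)
  have eu1 := F u hu a1 (by tauto)
  have ev2 := F v hv a2 (by tauto)
  by_cases h3 : ∃ t ∈ H, t ≠ u ∧ t ≠ v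
  · obtain ⟨t, ht, tu, tv⟩ := h3
    have etu := F t ht u (by tauto)
    have etv := F t ht v (by tauto)
    have k := h.close hQ hp (P := [v, t, u]) (((Pth.single u).cons etu).cons etv.symm)
      (by simp; tauto) (by simp; tauto) eu1 ev2.symm
    have := h.sc.mx.2.2 _ k.1 k.2
    have := hp.length_eq
    simp at *
    omega
  · push Not at h3
    obtain ⟨kn, kc⟩ := h.close hQ hp (P := [v, u]) ((Pth.single u).cons euv.symm)
      (by simp; tauto) (by simp; tauto) eu1 ev2.symm
    have hlen : ([v, u] ++ Q).length = C.length := by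
      have := hp.length_eq
      simp at *; omega
    have mx' : IsMx G ([v, u] ++ Q) := ⟨kn, kc, fun l hl hc => hlen ▸ h.sc.mx.2.2 l hl hc⟩
    have hnd := hp.nodup_iff.2 h.sc.mx.1
    simp only [List.nodup_cons, List.mem_cons, not_or] at hnd
    have hwH : w ∉ H := fun hh => h.sc.hHC w hh (h.inC hw)
    have hwH' : w' ∉ H := fun hh => h.sc.hHC w' hh (h.inC hw')
    have hw0 : w ∉ [v, u] ++ Q := by
      simp
      exact ⟨fun e => hwH (e ▸ hv), fun e => hwH (e ▸ hu), hnd.1.2⟩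
    have hw0' : w' ∉ [v, u] ++ Q := by
      simp
      exact ⟨fun e => hwH' (e ▸ hv), fun e => hwH' (e ▸ hu), hnd.2.1⟩
    have hall : ∀ z, z = w ∨ z = w' ∨ z ∈ [v, u] ++ Q := by
      intro z
      by_cases hz : z ∈ H
      · by_cases hzu : z = u
        · simp [hzu]
        · simp [h3 z hz hzu]
      · have := hp.mem_iff.2 (all_of_card h.sc h.full z hz)
        simp at this ⊢; tauto
    have hcomp : Comp G ([v, u] ++ Q) {w, w'} := by
      refine ⟨by simp, ?_, ?_, ?_⟩
      · intro z hz
        simp only [Finset.mem_insert, Finset.mem_singleton] at hz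
        rcases hz with rfl | rfl <;> assumption
      · intro x _ y _
        have := hall y
        simp only [Finset.mem_insert, Finset.mem_singleton]; tauto
      · intro x hx y hy
        simp only [Finset.mem_insert, Finset.mem_singleton] at hx hy ⊢
        rcases hx with rfl | rfl <;> rcases hy with rfl | rfl
        · exact ⟨_, Pth.single _, by simp⟩
        · exact ⟨_, (Pth.single _).cons e, by simp⟩
        · exact ⟨_, (Pth.single _).cons e.symm, by simp⟩
        · exact ⟨_, Pth.single _, by simp⟩
    have hcard : ({w, w'} : Finset V).card = 2 := Finset.card_pair e.ne
    have sc' : SC G {w, w'} ([v, u] ++ Q) := ⟨h.sc.cx, mx', hcomp.hne, hcomp.hHC, hcomp.hN,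
      partA_S1 h.sc.cx mx' hcomp (by omega)⟩
    obtain ⟨L', hL', h2'⟩ := sc'.dec
    have q1 := sc'.E2 hL' h2'
    have q2 := sc'.degv hL' w (by simp)
    have q3 := h.deg hw
    omega

end
end HT

namespace HT
set_option linter.unusedSectionVars false
set_option linter.unusedSimpArgs false
set_option linter.unusedVariables false
variable {V : Type u} {G : SimpleGraph V}
section
variable [Fintype V] [DecidableEq V] [DecidableRel G.Adj] {H : Finset V} {C : List V}
  {L : List (V × List V)} {a1 a2 : V} {s1 s2 : List V}

theorem Two.no2a (h : Two G H C a1 s1 a2 s2) {Q : List V} (w w' : V) (hw : w ∈ s1 ++ s2)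
    (hw' : w' ∈ s1 ++ s2) (h8 : C.length = 8) (hc : Q.IsChain G.Adj)
    (h1 : Q.head? = some a1) (h2 : Q.getLast? = some a2)
    (hp : ∀ z, (w :: w' :: Q).count z = (a1 :: (s1 ++ a2 :: s2)).count z) : False := by
  have sg1 := h.sc.seg2 h.dec (by simp) (a1, s1) (by simp)
  have sg2 := h.sc.seg2 h.dec (by simp) (a2, s2) (by simp)
  refine h.no2E2 (by rintro rfl; simp at sg1) (by rintro rfl; simp at sg2) h8 ⟨hc, h1, h2⟩
    (w := w) (w' := w') ?_
  refine (perm_of_cnt fun z => ?_).trans h.dec.perm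
  simpa using hp z

theorem Two.no2b (h : Two G H C a1 s1 a2 s2) {Q : List V} (w w' : V) (hw : w ∈ s1 ++ s2)
    (hw' : w' ∈ s1 ++ s2) (h9 : C.length = 9) (e : G.Adj w w') (hc : Q.IsChain G.Adj)
    (h1 : Q.head? = some a1) (h2 : Q.getLast? = some a2)
    (hp : ∀ z, (w :: w' :: Q).count z = (a1 :: (s1 ++ a2 :: s2)).count z) : False := by
  have sg1 := h.sc.seg2 h.dec (by simp) (a1, s1) (by simp)
  have sg2 := h.sc.seg2 h.dec (by simp) (a2, s2) (by simp)
  refine h.no2E3 (by rintro rfl; simp at sg1) (by rintro rfl; simp at sg2) h9 hw hw' e ⟨hc, h1, h2⟩ ?_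
  refine (perm_of_cnt fun z => ?_).trans h.dec.perm
  simpa using hp z

theorem Two.c62 {p1 p2 p3 p4 p5 p6 q1 q2 : V}
    (h : Two G H C a1 [p1, p2, p3, p4, p5, p6] a2 [q1, q2]) : False := by
  have hch := h.chain
  have hl := h.clen
  simp only [List.cons_append, List.nil_append, List.isChain_cons_cons, List.isChain_singleton, and_true] at hch
  simp only [List.length_cons, List.length_nil] at hl
  obtain ⟨c0, c1, c2, c3, c4, c5, c6, c7, c8, c9⟩ := hch
  have f0 : ei G p6 q2 = 0 := ei_zero fun k0 => h.no (Q := [a1, p1, p2, p3, p4, p5, p6, q2, q1, a2]) 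
    (by simp only [List.isChain_cons_cons, List.isChain_singleton, and_true]; exact ⟨c0, c1, c2, c3, c4, c5, k0, c8.symm, c7.symm⟩)
    rfl rfl (fun z => by simp only [cnt_cons, List.cons_append, List.nil_append, List.count_nil]; omega)
  have f1 : ei G p1 q1 = 0 := ei_zero fun k0 => h.no (Q := [a1, q2, q1, p1, p2, p3, p4, p5, p6, a2]) 
    (by simp only [List.isChain_cons_cons, List.isChain_singleton, and_true]; exact ⟨c9.symm, c8.symm, k0.symm, c1, c2, c3, c4, c5, c6⟩)
    rfl rfl (fun z => by simp only [cnt_cons, List.cons_append, List.nil_append, List.count_nil]; omega)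
  have f2 : ei G p2 q1 = 0 := ei_zero fun k0 => h.no1 (Q := [a1, q2, q1, p2, p3, p4, p5, p6, a2]) p1 (by simp) 
    (by simp only [List.isChain_cons_cons, List.isChain_singleton, and_true]; exact ⟨c9.symm, c8.symm, k0.symm, c2, c3, c4, c5, c6⟩)
    rfl rfl (fun z => by simp only [cnt_cons, List.cons_append, List.nil_append, List.count_nil]; omega)
  have f3 : ei G p5 q2 = 0 := ei_zero fun k0 => h.no1 (Q := [a1, p1, p2, p3, p4, p5, q2, q1, a2]) p6 (by simp) 
    (by simp only [List.isChain_cons_cons, List.isChain_singleton, and_true]; exact ⟨c0, c1, c2, c3, c4, k0, c8.symm, c7.symm⟩)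
    rfl rfl (fun z => by simp only [cnt_cons, List.cons_append, List.nil_append, List.count_nil]; omega)
  have f4 : ei G p1 q2 = 0 := ei_zero fun k0 => h.no1 (Q := [a1, q2, p1, p2, p3, p4, p5, p6, a2]) q1 (by simp) 
    (by simp only [List.isChain_cons_cons, List.isChain_singleton, and_true]; exact ⟨c9.symm, k0.symm, c1, c2, c3, c4, c5, c6⟩)
    rfl rfl (fun z => by simp only [cnt_cons, List.cons_append, List.nil_append, List.count_nil]; omega)
  have f5 : ei G p6 q1 = 0 := ei_zero fun k0 => h.no1 (Q := [a1, p1, p2, p3, p4, p5, p6, q1, a2]) q2 (by simp) 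
    (by simp only [List.isChain_cons_cons, List.isChain_singleton, and_true]; exact ⟨c0, c1, c2, c3, c4, c5, k0, c7.symm⟩)
    rfl rfl (fun z => by simp only [cnt_cons, List.cons_append, List.nil_append, List.count_nil]; omega)
  have f6 : ei G p4 q2 + ei G p5 q1 ≤ 1 := ei_or fun k0 k1 => h.no (Q := [a1, p1, p2, p3, p4, q2, q1, p5, p6, a2]) 
    (by simp only [List.isChain_cons_cons, List.isChain_singleton, and_true]; exact ⟨c0, c1, c2, c3, k0, c8.symm, k1.symm, c5, c6⟩)
    rfl rfl (fun z => by simp only [cnt_cons, List.cons_append, List.nil_append, List.count_nil]; omega)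
  have f7 : ei G p4 q1 + ei G p3 q2 ≤ 1 := ei_or fun k0 k1 => h.no (Q := [a1, p1, p2, p3, q2, q1, p4, p5, p6, a2]) 
    (by simp only [List.isChain_cons_cons, List.isChain_singleton, and_true]; exact ⟨c0, c1, c2, k1, c8.symm, k0.symm, c4, c5, c6⟩)
    rfl rfl (fun z => by simp only [cnt_cons, List.cons_append, List.nil_append, List.count_nil]; omega)
  have f8 : ei G p2 q2 + ei G p3 q1 ≤ 1 := ei_or fun k0 k1 => h.no (Q := [a1, p1, p2, q2, q1, p3, p4, p5, p6, a2]) 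
    (by simp only [List.isChain_cons_cons, List.isChain_singleton, and_true]; exact ⟨c0, c1, k0, c8.symm, k1.symm, c3, c4, c5, c6⟩)
    rfl rfl (fun z => by simp only [cnt_cons, List.cons_append, List.nil_append, List.count_nil]; omega)
  have dq1 := h.degs (y := q1) (by simp)
  have dq2 := h.degs (y := q2) (by simp)
  simp only [List.cons_append, List.nil_append, List.map_cons, List.map_nil, List.sum_cons, List.sum_nil, ei_self] at dq1 dq2
  simp only [ei_comm q1 a1, ei_comm q1 p1, ei_comm q1 p2, ei_comm q1 p3, ei_comm q1 p4, ei_comm q1 p5, ei_comm q1 p6, ei_comm q1 a2, ei_comm q2 a1, ei_comm q2 p1, ei_comm q2 p2, ei_comm q2 p3, ei_comm q2 p4, ei_comm q2 p5, ei_comm q2 p6, ei_comm q2 a2, ei_comm q2 q1] at dq1 dq2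
  have _ := ei_le (G := G) a1 q1
  have _ := ei_le (G := G) p1 q1
  have _ := ei_le (G := G) p2 q1
  have _ := ei_le (G := G) p3 q1
  have _ := ei_le (G := G) p4 q1
  have _ := ei_le (G := G) p5 q1
  have _ := ei_le (G := G) p6 q1
  have _ := ei_le (G := G) a2 q1
  have _ := ei_le (G := G) q1 q2
  have _ := ei_le (G := G) a1 q2
  have _ := ei_le (G := G) p1 q2
  have _ := ei_le (G := G) p2 q2
  have _ := ei_le (G := G) p3 q2
  have _ := ei_le (G := G) p4 q2
  have _ := ei_le (G := G) p5 q2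
  have _ := ei_le (G := G) p6 q2
  have _ := ei_le (G := G) a2 q2
  omega

theorem Two.c53 {p1 p2 p3 p4 p5 q1 q2 q3 : V}
    (h : Two G H C a1 [p1, p2, p3, p4, p5] a2 [q1, q2, q3]) : False := by
  have hch := h.chain
  have hl := h.clen
  simp only [List.cons_append, List.nil_append, List.isChain_cons_cons, List.isChain_singleton, and_true] at hch
  simp only [List.length_cons, List.length_nil] at hl
  obtain ⟨c0, c1, c2, c3, c4, c5, c6, c7, c8, c9⟩ := hch
  have f0 : ei G p5 q3 = 0 := ei_zero fun k0 => h.no (Q := [a1, p1, p2, p3, p4, p5, q3, q2, q1, a2]) 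
    (by simp only [List.isChain_cons_cons, List.isChain_singleton, and_true]; exact ⟨c0, c1, c2, c3, c4, k0, c8.symm, c7.symm, c6.symm⟩)
    rfl rfl (fun z => by simp only [cnt_cons, List.cons_append, List.nil_append, List.count_nil]; omega)
  have f1 : ei G p1 q1 = 0 := ei_zero fun k0 => h.no (Q := [a1, q3, q2, q1, p1, p2, p3, p4, p5, a2]) 
    (by simp only [List.isChain_cons_cons, List.isChain_singleton, and_true]; exact ⟨c9.symm, c8.symm, c7.symm, k0.symm, c1, c2, c3, c4, c5⟩)
    rfl rfl (fun z => by simp only [cnt_cons, List.cons_append, List.nil_append, List.count_nil]; omega)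
  have f2 : ei G p2 q1 = 0 := ei_zero fun k0 => h.no1 (Q := [a1, q3, q2, q1, p2, p3, p4, p5, a2]) p1 (by simp) 
    (by simp only [List.isChain_cons_cons, List.isChain_singleton, and_true]; exact ⟨c9.symm, c8.symm, c7.symm, k0.symm, c2, c3, c4, c5⟩)
    rfl rfl (fun z => by simp only [cnt_cons, List.cons_append, List.nil_append, List.count_nil]; omega)
  have f3 : ei G p4 q3 = 0 := ei_zero fun k0 => h.no1 (Q := [a1, p1, p2, p3, p4, q3, q2, q1, a2]) p5 (by simp) 
    (by simp only [List.isChain_cons_cons, List.isChain_singleton, and_true]; exact ⟨c0, c1, c2, c3, k0, c8.symm, c7.symm, c6.symm⟩)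
    rfl rfl (fun z => by simp only [cnt_cons, List.cons_append, List.nil_append, List.count_nil]; omega)
  have f4 : ei G p1 q2 = 0 := ei_zero fun k0 => h.no1 (Q := [a1, q3, q2, p1, p2, p3, p4, p5, a2]) q1 (by simp) 
    (by simp only [List.isChain_cons_cons, List.isChain_singleton, and_true]; exact ⟨c9.symm, c8.symm, k0.symm, c1, c2, c3, c4, c5⟩)
    rfl rfl (fun z => by simp only [cnt_cons, List.cons_append, List.nil_append, List.count_nil]; omega)
  have f5 : ei G p5 q2 = 0 := ei_zero fun k0 => h.no1 (Q := [a1, p1, p2, p3, p4, p5, q2, q1, a2]) q3 (by simp) 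
    (by simp only [List.isChain_cons_cons, List.isChain_singleton, and_true]; exact ⟨c0, c1, c2, c3, c4, k0, c7.symm, c6.symm⟩)
    rfl rfl (fun z => by simp only [cnt_cons, List.cons_append, List.nil_append, List.count_nil]; omega)
  have f6 : ei G a2 q3 + ei G p5 q1 ≤ 1 := ei_or fun k0 k1 => h.no (Q := [a1, p1, p2, p3, p4, p5, q1, q2, q3, a2]) 
    (by simp only [List.isChain_cons_cons, List.isChain_singleton, and_true]; exact ⟨c0, c1, c2, c3, c4, k1, c7, c8, k0.symm⟩)
    rfl rfl (fun z => by simp only [cnt_cons, List.cons_append, List.nil_append, List.count_nil]; omega)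
  have f7 : ei G p2 p5 + ei G p3 q3 ≤ 1 := ei_or fun k0 k1 => h.no (Q := [a1, p1, p2, p5, p4, p3, q3, q2, q1, a2]) 
    (by simp only [List.isChain_cons_cons, List.isChain_singleton, and_true]; exact ⟨c0, c1, k0, c4.symm, c3.symm, k1, c8.symm, c7.symm, c6.symm⟩)
    rfl rfl (fun z => by simp only [cnt_cons, List.cons_append, List.nil_append, List.count_nil]; omega)
  have f8 : ei G p2 q3 + ei G p3 q1 ≤ 1 := ei_or fun k0 k1 => h.no (Q := [a1, p1, p2, q3, q2, q1, p3, p4, p5, a2]) 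
    (by simp only [List.isChain_cons_cons, List.isChain_singleton, and_true]; exact ⟨c0, c1, k0, c8.symm, c7.symm, k1.symm, c3, c4, c5⟩)
    rfl rfl (fun z => by simp only [cnt_cons, List.cons_append, List.nil_append, List.count_nil]; omega)
  have f9 : ei G p2 q3 + ei G p1 p5 ≤ 1 := ei_or fun k0 k1 => h.no (Q := [a1, p1, p5, p4, p3, p2, q3, q2, q1, a2]) 
    (by simp only [List.isChain_cons_cons, List.isChain_singleton, and_true]; exact ⟨c0, k1, c4.symm, c3.symm, c2.symm, k0, c8.symm, c7.symm, c6.symm⟩)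
    rfl rfl (fun z => by simp only [cnt_cons, List.cons_append, List.nil_append, List.count_nil]; omega)
  have f10 : ei G p1 q3 + ei G a1 p5 ≤ 1 := ei_or fun k0 k1 => h.no (Q := [a1, p5, p4, p3, p2, p1, q3, q2, q1, a2]) 
    (by simp only [List.isChain_cons_cons, List.isChain_singleton, and_true]; exact ⟨k1, c4.symm, c3.symm, c2.symm, c1.symm, k0, c8.symm, c7.symm, c6.symm⟩)
    rfl rfl (fun z => by simp only [cnt_cons, List.cons_append, List.nil_append, List.count_nil]; omega)
  have f11 : ei G p1 q3 + ei G a1 q1 ≤ 1 := ei_or fun k0 k1 => h.no (Q := [a1, q1, q2, q3, p1, p2, p3, p4, p5, a2]) 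
    (by simp only [List.isChain_cons_cons, List.isChain_singleton, and_true]; exact ⟨k1, c7, c8, k0.symm, c1, c2, c3, c4, c5⟩)
    rfl rfl (fun z => by simp only [cnt_cons, List.cons_append, List.nil_append, List.count_nil]; omega)
  have f12 : ei G p5 q1 + ei G p1 a2 ≤ 1 := ei_or fun k0 k1 => h.no (Q := [a1, q3, q2, q1, p5, p4, p3, p2, p1, a2]) 
    (by simp only [List.isChain_cons_cons, List.isChain_singleton, and_true]; exact ⟨c9.symm, c8.symm, c7.symm, k0.symm, c4.symm, c3.symm, c2.symm, c1.symm, k1⟩)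
    rfl rfl (fun z => by simp only [cnt_cons, List.cons_append, List.nil_append, List.count_nil]; omega)
  have f13 : ei G p4 q1 + ei G p2 p5 ≤ 1 := ei_or fun k0 k1 => h.no1 (Q := [a1, q3, q2, q1, p4, p3, p2, p5, a2]) p1 (by simp) 
    (by simp only [List.isChain_cons_cons, List.isChain_singleton, and_true]; exact ⟨c9.symm, c8.symm, c7.symm, k0.symm, c3.symm, c2.symm, k1, c5⟩)
    rfl rfl (fun z => by simp only [cnt_cons, List.cons_append, List.nil_append, List.count_nil]; omega)
  have f14 : ei G p1 p5 + ei G p3 q3 ≤ 1 := ei_or fun k0 k1 => h.no1 (Q := [a1, p1, p5, p4, p3, q3, q2, q1, a2]) p2 (by simp) 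
    (by simp only [List.isChain_cons_cons, List.isChain_singleton, and_true]; exact ⟨c0, k0, c4.symm, c3.symm, k1, c8.symm, c7.symm, c6.symm⟩)
    rfl rfl (fun z => by simp only [cnt_cons, List.cons_append, List.nil_append, List.count_nil]; omega)
  have dp1 := h.degs (y := p1) (by simp)
  have dp5 := h.degs (y := p5) (by simp)
  have dq1 := h.degs (y := q1) (by simp)
  have dq3 := h.degs (y := q3) (by simp)
  simp only [List.cons_append, List.nil_append, List.map_cons, List.map_nil, List.sum_cons, List.sum_nil, ei_self] at dp1 dp5 dq1 dq3
  simp only [ei_comm p1 a1, ei_comm p5 a1, ei_comm p5 p1, ei_comm p5 p2, ei_comm p5 p3, ei_comm p5 p4, ei_comm q1 a1, ei_comm q1 p1, ei_comm q1 p2, ei_comm q1 p3, ei_comm q1 p4, ei_comm q1 p5, ei_comm q1 a2, ei_comm q3 a1, ei_comm q3 p1, ei_comm q3 p2, ei_comm q3 p3, ei_comm q3 p4, ei_comm q3 p5, ei_comm q3 a2, ei_comm q3 q1, ei_comm q3 q2] at dp1 dp5 dq1 dq3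
  have _ := ei_le (G := G) a1 p1
  have _ := ei_le (G := G) p1 p2
  have _ := ei_le (G := G) p1 p3
  have _ := ei_le (G := G) p1 p4
  have _ := ei_le (G := G) p1 p5
  have _ := ei_le (G := G) p1 a2
  have _ := ei_le (G := G) p1 q1
  have _ := ei_le (G := G) p1 q2
  have _ := ei_le (G := G) p1 q3
  have _ := ei_le (G := G) a1 p5
  have _ := ei_le (G := G) p2 p5
  have _ := ei_le (G := G) p3 p5
  have _ := ei_le (G := G) p4 p5
  have _ := ei_le (G := G) p5 a2
  have _ := ei_le (G := G) p5 q1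
  have _ := ei_le (G := G) p5 q2
  have _ := ei_le (G := G) p5 q3
  have _ := ei_le (G := G) a1 q1
  have _ := ei_le (G := G) p2 q1
  have _ := ei_le (G := G) p3 q1
  have _ := ei_le (G := G) p4 q1
  have _ := ei_le (G := G) a2 q1
  have _ := ei_le (G := G) q1 q2
  have _ := ei_le (G := G) q1 q3
  have _ := ei_le (G := G) a1 q3
  have _ := ei_le (G := G) p2 q3
  have _ := ei_le (G := G) p3 q3
  have _ := ei_le (G := G) p4 q3
  have _ := ei_le (G := G) a2 q3
  have _ := ei_le (G := G) q2 q3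
  omega

theorem Two.c42 {p1 p2 p3 p4 q1 q2 : V}
    (h : Two G H C a1 [p1, p2, p3, p4] a2 [q1, q2]) : False := by
  have hch := h.chain
  have hl := h.clen
  simp only [List.cons_append, List.nil_append, List.isChain_cons_cons, List.isChain_singleton, and_true] at hch
  simp only [List.length_cons, List.length_nil] at hl
  obtain ⟨c0, c1, c2, c3, c4, c5, c6, c7⟩ := hch
  exact h.no2a (Q := [a1, p1, p2, p3, p4, a2]) q1 q2 (by simp) (by simp) (by omega) 
    (by simp only [List.isChain_cons_cons, List.isChain_singleton, and_true]; exact ⟨c0, c1, c2, c3, c4⟩)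
    rfl rfl (fun z => by simp only [cnt_cons, List.cons_append, List.nil_append, List.count_nil]; omega)

theorem Two.c52 {p1 p2 p3 p4 p5 q1 q2 : V}
    (h : Two G H C a1 [p1, p2, p3, p4, p5] a2 [q1, q2]) : False := by
  have hch := h.chain
  have hl := h.clen
  simp only [List.cons_append, List.nil_append, List.isChain_cons_cons, List.isChain_singleton, and_true] at hch
  simp only [List.length_cons, List.length_nil] at hl
  obtain ⟨c0, c1, c2, c3, c4, c5, c6, c7, c8⟩ := hch
  exact h.no2b (Q := [a1, p1, p2, p3, p4, p5, a2]) q1 q2 (by simp) (by simp) (by omega) c7 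
    (by simp only [List.isChain_cons_cons, List.isChain_singleton, and_true]; exact ⟨c0, c1, c2, c3, c4, c5⟩)
    rfl rfl (fun z => by simp only [cnt_cons, List.cons_append, List.nil_append, List.count_nil]; omega)

theorem Two.c33 {p1 p2 p3 q1 q2 q3 : V}
    (h : Two G H C a1 [p1, p2, p3] a2 [q1, q2, q3]) : False := by
  have hch := h.chain
  have hl := h.clen
  simp only [List.cons_append, List.nil_append, List.isChain_cons_cons, List.isChain_singleton, and_true] at hch
  simp only [List.length_cons, List.length_nil] at hl
  obtain ⟨c0, c1, c2, c3, c4, c5, c6, c7⟩ := hch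
  have f0 : ei G p3 q3 = 0 := ei_zero fun k0 => h.no (Q := [a1, p1, p2, p3, q3, q2, q1, a2]) 
    (by simp only [List.isChain_cons_cons, List.isChain_singleton, and_true]; exact ⟨c0, c1, c2, k0, c6.symm, c5.symm, c4.symm⟩)
    rfl rfl (fun z => by simp only [cnt_cons, List.cons_append, List.nil_append, List.count_nil]; omega)
  have f1 : ei G p1 q1 = 0 := ei_zero fun k0 => h.no (Q := [a1, q3, q2, q1, p1, p2, p3, a2]) 
    (by simp only [List.isChain_cons_cons, List.isChain_singleton, and_true]; exact ⟨c7.symm, c6.symm, c5.symm, k0.symm, c1, c2, c3⟩)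
    rfl rfl (fun z => by simp only [cnt_cons, List.cons_append, List.nil_append, List.count_nil]; omega)
  have f2 : ei G p2 q1 = 0 := ei_zero fun k0 => h.no1 (Q := [a1, q3, q2, q1, p2, p3, a2]) p1 (by simp) 
    (by simp only [List.isChain_cons_cons, List.isChain_singleton, and_true]; exact ⟨c7.symm, c6.symm, c5.symm, k0.symm, c2, c3⟩)
    rfl rfl (fun z => by simp only [cnt_cons, List.cons_append, List.nil_append, List.count_nil]; omega)
  have f3 : ei G p2 q3 = 0 := ei_zero fun k0 => h.no1 (Q := [a1, p1, p2, q3, q2, q1, a2]) p3 (by simp) 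
    (by simp only [List.isChain_cons_cons, List.isChain_singleton, and_true]; exact ⟨c0, c1, k0, c6.symm, c5.symm, c4.symm⟩)
    rfl rfl (fun z => by simp only [cnt_cons, List.cons_append, List.nil_append, List.count_nil]; omega)
  have f4 : ei G p1 q2 = 0 := ei_zero fun k0 => h.no1 (Q := [a1, q3, q2, p1, p2, p3, a2]) q1 (by simp) 
    (by simp only [List.isChain_cons_cons, List.isChain_singleton, and_true]; exact ⟨c7.symm, c6.symm, k0.symm, c1, c2, c3⟩)
    rfl rfl (fun z => by simp only [cnt_cons, List.cons_append, List.nil_append, List.count_nil]; omega)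
  have f5 : ei G p3 q2 = 0 := ei_zero fun k0 => h.no1 (Q := [a1, p1, p2, p3, q2, q1, a2]) q3 (by simp) 
    (by simp only [List.isChain_cons_cons, List.isChain_singleton, and_true]; exact ⟨c0, c1, c2, k0, c5.symm, c4.symm⟩)
    rfl rfl (fun z => by simp only [cnt_cons, List.cons_append, List.nil_append, List.count_nil]; omega)
  have f6 : ei G p3 q1 = 0 := ei_zero fun k0 => h.no2a (Q := [a1, q3, q2, q1, p3, a2]) p1 p2 (by simp) (by simp) (by omega) 
    (by simp only [List.isChain_cons_cons, List.isChain_singleton, and_true]; exact ⟨c7.symm, c6.symm, c5.symm, k0.symm, c3⟩)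
    rfl rfl (fun z => by simp only [cnt_cons, List.cons_append, List.nil_append, List.count_nil]; omega)
  have f7 : ei G p2 q2 = 0 := ei_zero fun k0 => h.no2a (Q := [a1, q3, q2, p2, p3, a2]) p1 q1 (by simp) (by simp) (by omega) 
    (by simp only [List.isChain_cons_cons, List.isChain_singleton, and_true]; exact ⟨c7.symm, c6.symm, k0.symm, c2, c3⟩)
    rfl rfl (fun z => by simp only [cnt_cons, List.cons_append, List.nil_append, List.count_nil]; omega)
  have f8 : ei G p1 q3 = 0 := ei_zero fun k0 => h.no2a (Q := [a1, p1, q3, q2, q1, a2]) p2 p3 (by simp) (by simp) (by omega) 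
    (by simp only [List.isChain_cons_cons, List.isChain_singleton, and_true]; exact ⟨c0, k0, c6.symm, c5.symm, c4.symm⟩)
    rfl rfl (fun z => by simp only [cnt_cons, List.cons_append, List.nil_append, List.count_nil]; omega)
  have z11 : ¬ G.Adj p1 q1 := fun hA => by
    have := ei_pos hA
    omega
  have z12 : ¬ G.Adj p1 q2 := fun hA => by
    have := ei_pos hA
    omega
  have z13 : ¬ G.Adj p1 q3 := fun hA => by
    have := ei_pos hA
    omega
  have z21 : ¬ G.Adj p2 q1 := fun hA => by
    have := ei_pos hA
    omega
  have z22 : ¬ G.Adj p2 q2 := fun hA => by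
    have := ei_pos hA
    omega
  have z23 : ¬ G.Adj p2 q3 := fun hA => by
    have := ei_pos hA
    omega
  have z31 : ¬ G.Adj p3 q1 := fun hA => by
    have := ei_pos hA
    omega
  have z32 : ¬ G.Adj p3 q2 := fun hA => by
    have := ei_pos hA
    omega
  have z33 : ¬ G.Adj p3 q3 := fun hA => by
    have := ei_pos hA
    omega
  refine h.conn ?_
  simp only [List.forall_mem_cons, List.not_mem_nil, false_imp_iff, implies_true, and_true]
  exact ⟨⟨z11, z12, z13⟩, ⟨z21, z22, z23⟩, ⟨z31, z32, z33⟩⟩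

theorem Two.c43 {p1 p2 p3 p4 q1 q2 q3 : V}
    (h : Two G H C a1 [p1, p2, p3, p4] a2 [q1, q2, q3]) : False := by
  have hch := h.chain
  have hl := h.clen
  simp only [List.cons_append, List.nil_append, List.isChain_cons_cons, List.isChain_singleton, and_true] at hch
  simp only [List.length_cons, List.length_nil] at hl
  obtain ⟨c0, c1, c2, c3, c4, c5, c6, c7, c8⟩ := hch
  have f0 : ei G p4 q3 = 0 := ei_zero fun k0 => h.no (Q := [a1, p1, p2, p3, p4, q3, q2, q1, a2]) 
    (by simp only [List.isChain_cons_cons, List.isChain_singleton, and_true]; exact ⟨c0, c1, c2, c3, k0, c7.symm, c6.symm, c5.symm⟩)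
    rfl rfl (fun z => by simp only [cnt_cons, List.cons_append, List.nil_append, List.count_nil]; omega)
  have f1 : ei G p1 q1 = 0 := ei_zero fun k0 => h.no (Q := [a1, q3, q2, q1, p1, p2, p3, p4, a2]) 
    (by simp only [List.isChain_cons_cons, List.isChain_singleton, and_true]; exact ⟨c8.symm, c7.symm, c6.symm, k0.symm, c1, c2, c3, c4⟩)
    rfl rfl (fun z => by simp only [cnt_cons, List.cons_append, List.nil_append, List.count_nil]; omega)
  have f2 : ei G p2 q1 = 0 := ei_zero fun k0 => h.no1 (Q := [a1, q3, q2, q1, p2, p3, p4, a2]) p1 (by simp) 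
    (by simp only [List.isChain_cons_cons, List.isChain_singleton, and_true]; exact ⟨c8.symm, c7.symm, c6.symm, k0.symm, c2, c3, c4⟩)
    rfl rfl (fun z => by simp only [cnt_cons, List.cons_append, List.nil_append, List.count_nil]; omega)
  have f3 : ei G p3 q3 = 0 := ei_zero fun k0 => h.no1 (Q := [a1, p1, p2, p3, q3, q2, q1, a2]) p4 (by simp) 
    (by simp only [List.isChain_cons_cons, List.isChain_singleton, and_true]; exact ⟨c0, c1, c2, k0, c7.symm, c6.symm, c5.symm⟩)
    rfl rfl (fun z => by simp only [cnt_cons, List.cons_append, List.nil_append, List.count_nil]; omega)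
  have f4 : ei G p1 q2 = 0 := ei_zero fun k0 => h.no1 (Q := [a1, q3, q2, p1, p2, p3, p4, a2]) q1 (by simp) 
    (by simp only [List.isChain_cons_cons, List.isChain_singleton, and_true]; exact ⟨c8.symm, c7.symm, k0.symm, c1, c2, c3, c4⟩)
    rfl rfl (fun z => by simp only [cnt_cons, List.cons_append, List.nil_append, List.count_nil]; omega)
  have f5 : ei G p4 q2 = 0 := ei_zero fun k0 => h.no1 (Q := [a1, p1, p2, p3, p4, q2, q1, a2]) q3 (by simp) 
    (by simp only [List.isChain_cons_cons, List.isChain_singleton, and_true]; exact ⟨c0, c1, c2, c3, k0, c6.symm, c5.symm⟩)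
    rfl rfl (fun z => by simp only [cnt_cons, List.cons_append, List.nil_append, List.count_nil]; omega)
  have f6 : ei G p3 q1 = 0 := ei_zero fun k0 => h.no2b (Q := [a1, q3, q2, q1, p3, p4, a2]) p1 p2 (by simp) (by simp) (by omega) c1 
    (by simp only [List.isChain_cons_cons, List.isChain_singleton, and_true]; exact ⟨c8.symm, c7.symm, c6.symm, k0.symm, c3, c4⟩)
    rfl rfl (fun z => by simp only [cnt_cons, List.cons_append, List.nil_append, List.count_nil]; omega)
  have f7 : ei G p2 q3 = 0 := ei_zero fun k0 => h.no2b (Q := [a1, p1, p2, q3, q2, q1, a2]) p3 p4 (by simp) (by simp) (by omega) c3 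
    (by simp only [List.isChain_cons_cons, List.isChain_singleton, and_true]; exact ⟨c0, c1, k0, c7.symm, c6.symm, c5.symm⟩)
    rfl rfl (fun z => by simp only [cnt_cons, List.cons_append, List.nil_append, List.count_nil]; omega)
  have f8 : ei G p1 q3 = 0 := ei_zero fun k0 => h.no2b (Q := [a1, q3, p1, p2, p3, p4, a2]) q1 q2 (by simp) (by simp) (by omega) c6 
    (by simp only [List.isChain_cons_cons, List.isChain_singleton, and_true]; exact ⟨c8.symm, k0.symm, c1, c2, c3, c4⟩)
    rfl rfl (fun z => by simp only [cnt_cons, List.cons_append, List.nil_append, List.count_nil]; omega)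
  have f9 : ei G p4 q1 = 0 := ei_zero fun k0 => h.no2b (Q := [a1, p1, p2, p3, p4, q1, a2]) q2 q3 (by simp) (by simp) (by omega) c7 
    (by simp only [List.isChain_cons_cons, List.isChain_singleton, and_true]; exact ⟨c0, c1, c2, c3, k0, c5.symm⟩)
    rfl rfl (fun z => by simp only [cnt_cons, List.cons_append, List.nil_append, List.count_nil]; omega)
  have f10 : ei G q1 q3 + ei G p2 q2 ≤ 1 := ei_or fun k0 k1 => h.no1 (Q := [a1, q3, q1, q2, p2, p3, p4, a2]) p1 (by simp) 
    (by simp only [List.isChain_cons_cons, List.isChain_singleton, and_true]; exact ⟨c8.symm, k0.symm, c6, k1.symm, c2, c3, c4⟩)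
    rfl rfl (fun z => by simp only [cnt_cons, List.cons_append, List.nil_append, List.count_nil]; omega)
  have f11 : ei G p3 q2 + ei G q1 q3 ≤ 1 := ei_or fun k0 k1 => h.no1 (Q := [a1, p1, p2, p3, q2, q3, q1, a2]) p4 (by simp) 
    (by simp only [List.isChain_cons_cons, List.isChain_singleton, and_true]; exact ⟨c0, c1, c2, k0, c7, k1.symm, c5.symm⟩)
    rfl rfl (fun z => by simp only [cnt_cons, List.cons_append, List.nil_append, List.count_nil]; omega)
  have dq1 := h.degs (y := q1) (by simp)
  have dq3 := h.degs (y := q3) (by simp)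
  simp only [List.cons_append, List.nil_append, List.map_cons, List.map_nil, List.sum_cons, List.sum_nil, ei_self] at dq1 dq3
  simp only [ei_comm q1 a1, ei_comm q1 p1, ei_comm q1 p2, ei_comm q1 p3, ei_comm q1 p4, ei_comm q1 a2, ei_comm q3 a1, ei_comm q3 p1, ei_comm q3 p2, ei_comm q3 p3, ei_comm q3 p4, ei_comm q3 a2, ei_comm q3 q1, ei_comm q3 q2] at dq1 dq3
  have _ := ei_le (G := G) a1 q1
  have _ := ei_le (G := G) p1 q1
  have _ := ei_le (G := G) p2 q1
  have _ := ei_le (G := G) p3 q1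
  have _ := ei_le (G := G) p4 q1
  have _ := ei_le (G := G) a2 q1
  have _ := ei_le (G := G) q1 q2
  have _ := ei_le (G := G) q1 q3
  have _ := ei_le (G := G) a1 q3
  have _ := ei_le (G := G) p1 q3
  have _ := ei_le (G := G) p2 q3
  have _ := ei_le (G := G) p3 q3
  have _ := ei_le (G := G) p4 q3
  have _ := ei_le (G := G) a2 q3
  have _ := ei_le (G := G) q2 q3
  have z11 : ¬ G.Adj p1 q1 := fun hA => by
    have := ei_pos hA
    omega
  have z12 : ¬ G.Adj p1 q2 := fun hA => by
    have := ei_pos hA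
    omega
  have z13 : ¬ G.Adj p1 q3 := fun hA => by
    have := ei_pos hA
    omega
  have z21 : ¬ G.Adj p2 q1 := fun hA => by
    have := ei_pos hA
    omega
  have z22 : ¬ G.Adj p2 q2 := fun hA => by
    have := ei_pos hA
    omega
  have z23 : ¬ G.Adj p2 q3 := fun hA => by
    have := ei_pos hA
    omega
  have z31 : ¬ G.Adj p3 q1 := fun hA => by
    have := ei_pos hA
    omega
  have z32 : ¬ G.Adj p3 q2 := fun hA => by
    have := ei_pos hA
    omega
  have z33 : ¬ G.Adj p3 q3 := fun hA => by
    have := ei_pos hA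
    omega
  have z41 : ¬ G.Adj p4 q1 := fun hA => by
    have := ei_pos hA
    omega
  have z42 : ¬ G.Adj p4 q2 := fun hA => by
    have := ei_pos hA
    omega
  have z43 : ¬ G.Adj p4 q3 := fun hA => by
    have := ei_pos hA
    omega
  refine h.conn ?_
  simp only [List.forall_mem_cons, List.not_mem_nil, false_imp_iff, implies_true, and_true]
  exact ⟨⟨z11, z12, z13⟩, ⟨z21, z22, z23⟩, ⟨z31, z32, z33⟩, ⟨z41, z42, z43⟩⟩

set_option maxHeartbeats 1000000 in
theorem Two.c44 {p1 p2 p3 p4 q1 q2 q3 q4 : V}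
    (h : Two G H C a1 [p1, p2, p3, p4] a2 [q1, q2, q3, q4]) : False := by
  have hch := h.chain
  have hl := h.clen
  simp only [List.cons_append, List.nil_append, List.isChain_cons_cons, List.isChain_singleton, and_true] at hch
  simp only [List.length_cons, List.length_nil] at hl
  obtain ⟨c0, c1, c2, c3, c4, c5, c6, c7, c8, c9⟩ := hch
  have f0 : ei G p4 q4 = 0 := ei_zero fun k0 => h.no (Q := [a1, p1, p2, p3, p4, q4, q3, q2, q1, a2]) 
    (by simp only [List.isChain_cons_cons, List.isChain_singleton, and_true]; exact ⟨c0, c1, c2, c3, k0, c8.symm, c7.symm, c6.symm, c5.symm⟩)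
    rfl rfl (fun z => by simp only [cnt_cons, List.cons_append, List.nil_append, List.count_nil]; omega)
  have f1 : ei G p1 q1 = 0 := ei_zero fun k0 => h.no (Q := [a1, q4, q3, q2, q1, p1, p2, p3, p4, a2]) 
    (by simp only [List.isChain_cons_cons, List.isChain_singleton, and_true]; exact ⟨c9.symm, c8.symm, c7.symm, c6.symm, k0.symm, c1, c2, c3, c4⟩)
    rfl rfl (fun z => by simp only [cnt_cons, List.cons_append, List.nil_append, List.count_nil]; omega)
  have f2 : ei G p2 q1 = 0 := ei_zero fun k0 => h.no1 (Q := [a1, q4, q3, q2, q1, p2, p3, p4, a2]) p1 (by simp) 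
    (by simp only [List.isChain_cons_cons, List.isChain_singleton, and_true]; exact ⟨c9.symm, c8.symm, c7.symm, c6.symm, k0.symm, c2, c3, c4⟩)
    rfl rfl (fun z => by simp only [cnt_cons, List.cons_append, List.nil_append, List.count_nil]; omega)
  have f3 : ei G p3 q4 = 0 := ei_zero fun k0 => h.no1 (Q := [a1, p1, p2, p3, q4, q3, q2, q1, a2]) p4 (by simp) 
    (by simp only [List.isChain_cons_cons, List.isChain_singleton, and_true]; exact ⟨c0, c1, c2, k0, c8.symm, c7.symm, c6.symm, c5.symm⟩)
    rfl rfl (fun z => by simp only [cnt_cons, List.cons_append, List.nil_append, List.count_nil]; omega)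
  have f4 : ei G p1 q2 = 0 := ei_zero fun k0 => h.no1 (Q := [a1, q4, q3, q2, p1, p2, p3, p4, a2]) q1 (by simp) 
    (by simp only [List.isChain_cons_cons, List.isChain_singleton, and_true]; exact ⟨c9.symm, c8.symm, c7.symm, k0.symm, c1, c2, c3, c4⟩)
    rfl rfl (fun z => by simp only [cnt_cons, List.cons_append, List.nil_append, List.count_nil]; omega)
  have f5 : ei G p4 q3 = 0 := ei_zero fun k0 => h.no1 (Q := [a1, p1, p2, p3, p4, q3, q2, q1, a2]) q4 (by simp) 
    (by simp only [List.isChain_cons_cons, List.isChain_singleton, and_true]; exact ⟨c0, c1, c2, c3, k0, c7.symm, c6.symm, c5.symm⟩)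
    rfl rfl (fun z => by simp only [cnt_cons, List.cons_append, List.nil_append, List.count_nil]; omega)
  have f6 : ei G p4 q1 + ei G a2 q4 ≤ 1 := ei_or fun k0 k1 => h.no (Q := [a1, p1, p2, p3, p4, q1, q2, q3, q4, a2]) 
    (by simp only [List.isChain_cons_cons, List.isChain_singleton, and_true]; exact ⟨c0, c1, c2, c3, k0, c6, c7, c8, k1.symm⟩)
    rfl rfl (fun z => by simp only [cnt_cons, List.cons_append, List.nil_append, List.count_nil]; omega)
  have f7 : ei G p4 q2 + ei G q1 q4 ≤ 1 := ei_or fun k0 k1 => h.no (Q := [a1, p1, p2, p3, p4, q2, q3, q4, q1, a2]) 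
    (by simp only [List.isChain_cons_cons, List.isChain_singleton, and_true]; exact ⟨c0, c1, c2, c3, k0, c7, c8, k1.symm, c5.symm⟩)
    rfl rfl (fun z => by simp only [cnt_cons, List.cons_append, List.nil_append, List.count_nil]; omega)
  have f8 : ei G p2 q4 + ei G p3 q1 ≤ 1 := ei_or fun k0 k1 => h.no (Q := [a1, p1, p2, q4, q3, q2, q1, p3, p4, a2]) 
    (by simp only [List.isChain_cons_cons, List.isChain_singleton, and_true]; exact ⟨c0, c1, k0, c8.symm, c7.symm, c6.symm, k1.symm, c3, c4⟩)
    rfl rfl (fun z => by simp only [cnt_cons, List.cons_append, List.nil_append, List.count_nil]; omega)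
  have f9 : ei G p2 q4 + ei G p1 p4 ≤ 1 := ei_or fun k0 k1 => h.no (Q := [a1, p1, p4, p3, p2, q4, q3, q2, q1, a2]) 
    (by simp only [List.isChain_cons_cons, List.isChain_singleton, and_true]; exact ⟨c0, k1, c3.symm, c2.symm, k0, c8.symm, c7.symm, c6.symm, c5.symm⟩)
    rfl rfl (fun z => by simp only [cnt_cons, List.cons_append, List.nil_append, List.count_nil]; omega)
  have f10 : ei G p1 q4 + ei G a1 p4 ≤ 1 := ei_or fun k0 k1 => h.no (Q := [a1, p4, p3, p2, p1, q4, q3, q2, q1, a2]) 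
    (by simp only [List.isChain_cons_cons, List.isChain_singleton, and_true]; exact ⟨k1, c3.symm, c2.symm, c1.symm, k0, c8.symm, c7.symm, c6.symm, c5.symm⟩)
    rfl rfl (fun z => by simp only [cnt_cons, List.cons_append, List.nil_append, List.count_nil]; omega)
  have f11 : ei G p1 q4 + ei G a1 q1 ≤ 1 := ei_or fun k0 k1 => h.no (Q := [a1, q1, q2, q3, q4, p1, p2, p3, p4, a2]) 
    (by simp only [List.isChain_cons_cons, List.isChain_singleton, and_true]; exact ⟨k1, c6, c7, c8, k0.symm, c1, c2, c3, c4⟩)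
    rfl rfl (fun z => by simp only [cnt_cons, List.cons_append, List.nil_append, List.count_nil]; omega)
  have f12 : ei G p1 q3 + ei G q1 q4 ≤ 1 := ei_or fun k0 k1 => h.no (Q := [a1, q4, q1, q2, q3, p1, p2, p3, p4, a2]) 
    (by simp only [List.isChain_cons_cons, List.isChain_singleton, and_true]; exact ⟨c9.symm, k1.symm, c6, c7, k0.symm, c1, c2, c3, c4⟩)
    rfl rfl (fun z => by simp only [cnt_cons, List.cons_append, List.nil_append, List.count_nil]; omega)
  have f13 : ei G p3 q1 + ei G p1 p4 ≤ 1 := ei_or fun k0 k1 => h.no (Q := [a1, q4, q3, q2, q1, p3, p2, p1, p4, a2]) 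
    (by simp only [List.isChain_cons_cons, List.isChain_singleton, and_true]; exact ⟨c9.symm, c8.symm, c7.symm, c6.symm, k0.symm, c2.symm, c1.symm, k1, c4⟩)
    rfl rfl (fun z => by simp only [cnt_cons, List.cons_append, List.nil_append, List.count_nil]; omega)
  have f14 : ei G q1 q4 + ei G p2 q3 ≤ 1 := ei_or fun k0 k1 => h.no1 (Q := [a1, q4, q1, q2, q3, p2, p3, p4, a2]) p1 (by simp) 
    (by simp only [List.isChain_cons_cons, List.isChain_singleton, and_true]; exact ⟨c9.symm, k0.symm, c6, c7, k1.symm, c2, c3, c4⟩)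
    rfl rfl (fun z => by simp only [cnt_cons, List.cons_append, List.nil_append, List.count_nil]; omega)
  have f15 : ei G q1 q3 + ei G p2 q2 ≤ 1 := ei_or fun k0 k1 => h.no1 (Q := [a1, q4, q3, q1, q2, p2, p3, p4, a2]) p1 (by simp) 
    (by simp only [List.isChain_cons_cons, List.isChain_singleton, and_true]; exact ⟨c9.symm, c8.symm, k0.symm, c6, k1.symm, c2, c3, c4⟩)
    rfl rfl (fun z => by simp only [cnt_cons, List.cons_append, List.nil_append, List.count_nil]; omega)
  have f16 : ei G p4 q1 + ei G p2 a2 ≤ 1 := ei_or fun k0 k1 => h.no1 (Q := [a1, q4, q3, q2, q1, p4, p3, p2, a2]) p1 (by simp) 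
    (by simp only [List.isChain_cons_cons, List.isChain_singleton, and_true]; exact ⟨c9.symm, c8.symm, c7.symm, c6.symm, k0.symm, c3.symm, c2.symm, k1⟩)
    rfl rfl (fun z => by simp only [cnt_cons, List.cons_append, List.nil_append, List.count_nil]; omega)
  have f17 : ei G q1 q4 + ei G p3 q2 ≤ 1 := ei_or fun k0 k1 => h.no1 (Q := [a1, p1, p2, p3, q2, q3, q4, q1, a2]) p4 (by simp) 
    (by simp only [List.isChain_cons_cons, List.isChain_singleton, and_true]; exact ⟨c0, c1, c2, k1, c7, c8, k0.symm, c5.symm⟩)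
    rfl rfl (fun z => by simp only [cnt_cons, List.cons_append, List.nil_append, List.count_nil]; omega)
  have f18 : ei G q2 q4 + ei G p3 q3 ≤ 1 := ei_or fun k0 k1 => h.no1 (Q := [a1, p1, p2, p3, q3, q4, q2, q1, a2]) p4 (by simp) 
    (by simp only [List.isChain_cons_cons, List.isChain_singleton, and_true]; exact ⟨c0, c1, c2, k1, c8, k0.symm, c6.symm, c5.symm⟩)
    rfl rfl (fun z => by simp only [cnt_cons, List.cons_append, List.nil_append, List.count_nil]; omega)
  have dp1 := h.degs (y := p1) (by simp)
  have dp2 := h.degs (y := p2) (by simp)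
  have dp3 := h.degs (y := p3) (by simp)
  have dp4 := h.degs (y := p4) (by simp)
  have dq1 := h.degs (y := q1) (by simp)
  have dq2 := h.degs (y := q2) (by simp)
  have dq3 := h.degs (y := q3) (by simp)
  have dq4 := h.degs (y := q4) (by simp)
  simp only [List.cons_append, List.nil_append, List.map_cons, List.map_nil, List.sum_cons, List.sum_nil, ei_self] at dp1 dp2 dp3 dp4 dq1 dq2 dq3 dq4
  simp only [ei_comm p1 a1, ei_comm p2 a1, ei_comm p2 p1, ei_comm p3 a1, ei_comm p3 p1, ei_comm p3 p2, ei_comm p4 a1, ei_comm p4 p1, ei_comm p4 p2, ei_comm p4 p3, ei_comm q1 a1, ei_comm q1 p1, ei_comm q1 p2, ei_comm q1 p3, ei_comm q1 p4, ei_comm q1 a2, ei_comm q2 a1, ei_comm q2 p1, ei_comm q2 p2, ei_comm q2 p3, ei_comm q2 p4, ei_comm q2 a2, ei_comm q2 q1, ei_comm q3 a1, ei_comm q3 p1, ei_comm q3 p2, ei_comm q3 p3, ei_comm q3 p4, ei_comm q3 a2, ei_comm q3 q1, ei_comm q3 q2, ei_comm q4 a1, ei_comm q4 p1, ei_comm q4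 p2, ei_comm q4 p3, ei_comm q4 p4, ei_comm q4 a2, ei_comm q4 q1, ei_comm q4 q2, ei_comm q4 q3] at dp1 dp2 dp3 dp4 dq1 dq2 dq3 dq4
  have _ := ei_le (G := G) a1 p1
  have _ := ei_le (G := G) p1 p2
  have _ := ei_le (G := G) p1 p3
  have _ := ei_le (G := G) p1 p4
  have _ := ei_le (G := G) p1 a2
  have _ := ei_le (G := G) p1 q1
  have _ := ei_le (G := G) p1 q2
  have _ := ei_le (G := G) p1 q3
  have _ := ei_le (G := G) p1 q4
  have _ := ei_le (G := G) a1 p2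
  have _ := ei_le (G := G) p2 p3
  have _ := ei_le (G := G) p2 p4
  have _ := ei_le (G := G) p2 a2
  have _ := ei_le (G := G) p2 q1
  have _ := ei_le (G := G) p2 q2
  have _ := ei_le (G := G) p2 q3
  have _ := ei_le (G := G) p2 q4
  have _ := ei_le (G := G) a1 p3
  have _ := ei_le (G := G) p3 p4
  have _ := ei_le (G := G) p3 a2
  have _ := ei_le (G := G) p3 q1
  have _ := ei_le (G := G) p3 q2
  have _ := ei_le (G := G) p3 q3
  have _ := ei_le (G := G) p3 q4
  have _ := ei_le (G := G) a1 p4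
  have _ := ei_le (G := G) p4 a2
  have _ := ei_le (G := G) p4 q1
  have _ := ei_le (G := G) p4 q2
  have _ := ei_le (G := G) p4 q3
  have _ := ei_le (G := G) p4 q4
  have _ := ei_le (G := G) a1 q1
  have _ := ei_le (G := G) a2 q1
  have _ := ei_le (G := G) q1 q2
  have _ := ei_le (G := G) q1 q3
  have _ := ei_le (G := G) q1 q4
  have _ := ei_le (G := G) a1 q2
  have _ := ei_le (G := G) a2 q2
  have _ := ei_le (G := G) q2 q3
  have _ := ei_le (G := G) q2 q4
  have _ := ei_le (G := G) a1 q3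
  have _ := ei_le (G := G) a2 q3
  have _ := ei_le (G := G) q3 q4
  have _ := ei_le (G := G) a1 q4
  have _ := ei_le (G := G) a2 q4
  have _ : ei G p2 p4 = 1 := by omega
  have _ : ei G p3 q1 = 0 := by omega
  have _ : ei G p3 q3 = 0 := by omega
  have _ : ei G q2 q4 = 1 := by omega
  have _ : ei G p2 q2 = 0 := by omega
  have _ : ei G q1 q3 = 1 := by omega
  have _ : ei G p1 q3 = 0 := by omega
  have _ : ei G p2 q3 = 0 := by omega
  have _ : ei G p3 q2 = 0 := by omega
  have _ : ei G p4 q2 = 0 := by omega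
  have _ : ei G q1 q4 = 1 := by omega
  have _ : ei G p1 p4 = 1 := by omega
  have _ : ei G p2 q4 = 0 := by omega
  have _ : ei G p2 a2 = 1 := by omega
  have _ : ei G p4 q1 = 0 := by omega
  have _ : ei G a1 p4 = 1 := by omega
  have _ : ei G p1 q4 = 0 := by omega
  have z11 : ¬ G.Adj p1 q1 := fun hA => by
    have := ei_pos hA
    omega
  have z12 : ¬ G.Adj p1 q2 := fun hA => by
    have := ei_pos hA
    omega
  have z13 : ¬ G.Adj p1 q3 := fun hA => by
    have := ei_pos hA
    omega
  have z14 : ¬ G.Adj p1 q4 := fun hA => by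
    have := ei_pos hA
    omega
  have z21 : ¬ G.Adj p2 q1 := fun hA => by
    have := ei_pos hA
    omega
  have z22 : ¬ G.Adj p2 q2 := fun hA => by
    have := ei_pos hA
    omega
  have z23 : ¬ G.Adj p2 q3 := fun hA => by
    have := ei_pos hA
    omega
  have z24 : ¬ G.Adj p2 q4 := fun hA => by
    have := ei_pos hA
    omega
  have z31 : ¬ G.Adj p3 q1 := fun hA => by
    have := ei_pos hA
    omega
  have z32 : ¬ G.Adj p3 q2 := fun hA => by
    have := ei_pos hA
    omega
  have z33 : ¬ G.Adj p3 q3 := fun hA => by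
    have := ei_pos hA
    omega
  have z34 : ¬ G.Adj p3 q4 := fun hA => by
    have := ei_pos hA
    omega
  have z41 : ¬ G.Adj p4 q1 := fun hA => by
    have := ei_pos hA
    omega
  have z42 : ¬ G.Adj p4 q2 := fun hA => by
    have := ei_pos hA
    omega
  have z43 : ¬ G.Adj p4 q3 := fun hA => by
    have := ei_pos hA
    omega
  have z44 : ¬ G.Adj p4 q4 := fun hA => by
    have := ei_pos hA
    omega
  refine h.conn ?_
  simp only [List.forall_mem_cons, List.not_mem_nil, false_imp_iff, implies_true, and_true]
  exact ⟨⟨z11, z12, z13, z14⟩, ⟨z21, z22, z23, z24⟩, ⟨z31, z32, z33, z34⟩, ⟨z41, z42, z43, z44⟩⟩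


theorem SC.false (h : SC G H C) : False := by
  obtain ⟨L, hL, h2⟩ := h.dec
  have e2 := h.E2 hL h2
  have e3 := h.num hL
  have e4 := card_le h
  have hK : L.length = 2 ∨ L.length = 3 := by omega
  rcases hK with hK | hK
  · obtain ⟨⟨a1, s1⟩, ⟨a2, s2⟩, rfl⟩ := List.length_eq_two.1 hK
    by_cases hc : C.length + H.card < Fintype.card V
    · exact h.K2rho hL hc
    have T : Two G H C a1 s1 a2 s2 := ⟨h, hL, by omega⟩
    have sg1 : 2 ≤ s1.length := h.seg2 hL (by simp) (a1, s1) (by simp)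
    have sg2 : 2 ≤ s2.length := h.seg2 hL (by simp) (a2, s2) (by simp)
    have hl := T.clen
    simp only [List.length_cons, List.length_nil] at e2 e3
    clear hL
    wlog hw : s2.length ≤ s1.length generalizing a1 a2 s1 s2
    · exact this a2 s2 a1 s1 (by simp) (by simp) T.swap sg2 sg1 (by omega) (by omega)
    have hcs : (s1.length = 4 ∧ s2.length = 2) ∨ (s1.length = 3 ∧ s2.length = 3) ∨
        (s1.length = 5 ∧ s2.length = 2) ∨ (s1.length = 4 ∧ s2.length = 3) ∨
        (s1.length = 6 ∧ s2.length = 2) ∨ (s1.length = 5 ∧ s2.length = 3) ∨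
        (s1.length = 4 ∧ s2.length = 4) := by omega
    rcases hcs with ⟨k1, k2⟩ | ⟨k1, k2⟩ | ⟨k1, k2⟩ | ⟨k1, k2⟩ | ⟨k1, k2⟩ | ⟨k1, k2⟩ | ⟨k1, k2⟩
    · obtain ⟨p1, p2, p3, p4, rfl⟩ := len4 k1
      obtain ⟨q1, q2, rfl⟩ := len2 k2
      exact T.c42
    · obtain ⟨p1, p2, p3, rfl⟩ := len3 k1
      obtain ⟨q1, q2, q3, rfl⟩ := len3 k2
      exact T.c33
    · obtain ⟨p1, p2, p3, p4, p5, rfl⟩ := len5 k1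
      obtain ⟨q1, q2, rfl⟩ := len2 k2
      exact T.c52
    · obtain ⟨p1, p2, p3, p4, rfl⟩ := len4 k1
      obtain ⟨q1, q2, q3, rfl⟩ := len3 k2
      exact T.c43
    · obtain ⟨p1, p2, p3, p4, p5, p6, rfl⟩ := len6 k1
      obtain ⟨q1, q2, rfl⟩ := len2 k2
      exact T.c62
    · obtain ⟨p1, p2, p3, p4, p5, rfl⟩ := len5 k1
      obtain ⟨q1, q2, q3, rfl⟩ := len3 k2
      exact T.c53
    · obtain ⟨p1, p2, p3, p4, rfl⟩ := len4 k1
      obtain ⟨q1, q2, q3, q4, rfl⟩ := len4 k2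
      exact T.c44
  · exact h.K3 hL hK

end
end HT

namespace HT
set_option linter.unusedSectionVars false
set_option linter.unusedSimpArgs false
variable {V : Type u} {G : SimpleGraph V}
section
variable [Fintype V] [DecidableEq V] [DecidableRel G.Adj] {H : Finset V} {C : List V}
  {L : List (V × List V)}

/-- Part A: every longest cycle is dominating. -/
theorem Ctx.dom (cx : Ctx G) (mx : IsMx G C) {u v : V} (hu : u ∉ C) (hv : v ∉ C) :
    ¬ G.Adj u v := by
  classical
  intro huv
  let H : Finset V := Finset.univ.filter (fun z => ∃ l, Pth G u l z ∧ ∀ w ∈ l, w ∉ C)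
  have mH : ∀ z, z ∈ H ↔ ∃ l, Pth G u l z ∧ ∀ w ∈ l, w ∉ C := by intro z; simp [H]
  have ex : ∀ l z, Pth G u l z → (∀ w ∈ l, w ∉ C) → ∀ w ∈ l, w ∈ H := by
    intro l z hl hlC w hw
    obtain ⟨l1, l2, e⟩ := List.append_of_mem hw
    rw [mH]
    subst e
    by_cases h2 : l2 = []
    · subst h2
      exact ⟨l1 ++ [w], by rw [← hl.last_eq] at hl; exact hl, hlC⟩
    · rw [show l1 ++ w :: l2 = (l1 ++ [w]) ++ l2 by simp] at hl
      obtain ⟨c, d, k1, k2, k3⟩ := hl.split (by simp) h2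
      have := k1.last_eq
      subst this
      exact ⟨_, k1, fun z hz => hlC z (by simp at hz ⊢; tauto)⟩
  have hC : Comp G C H := by
    refine ⟨⟨u, (mH u).2 ⟨[u], Pth.single u, by simpa using hu⟩⟩, ?_, ?_, ?_⟩
    · intro z hz
      obtain ⟨l, h1, h2⟩ := (mH z).1 hz
      exact h2 z h1.last_mem
    · intro z hz w hw
      by_cases hwC : w ∈ C
      · exact Or.inr hwC
      · left
        obtain ⟨l, h1, h2⟩ := (mH z).1 hz
        refine (mH w).2 ⟨l ++ [w], h1.app hw (Pth.single w), ?_⟩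
        intro y hy
        rcases List.mem_append.1 hy with hy | hy
        · exact h2 y hy
        · simp at hy; subst hy; exact hwC
    · intro y hy z hz
      obtain ⟨l, h1, h2⟩ := (mH y).1 hy
      obtain ⟨m, k1, k2⟩ := (mH z).1 hz
      obtain ⟨q, e1, e2⟩ := h1.rev.trans' k1
      refine ⟨q, e1, fun w hw => ?_⟩
      rcases List.mem_append.1 (e2 hw) with hw | hw
      · exact ex l y h1 h2 w (by simpa using hw)
      · exact ex m z k1 k2 w hw
  have h2 : 2 ≤ H.card := by
    have : 1 < H.card := Finset.one_lt_card.2 ⟨u, (mH u).2 ⟨[u], Pth.single u, by simpa using hu⟩, v,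
      (mH v).2 ⟨[u, v], Pth.cons huv (Pth.single v), by simp [hu, hv]⟩, huv.ne⟩
    omega
  exact SC.false (⟨cx, mx, hC.hne, hC.hHC, hC.hN, partA_S1 cx mx hC h2⟩ : SC G H C)

theorem Ctx.exists_mx (cx : Ctx G) : ∃ C, IsMx G C := by
  classical
  have hE : ∃ u v, G.Adj u v := by
    have hc : 1 < Fintype.card V := by have := cx.n11; omega
    obtain ⟨u, v, huv⟩ := Fintype.one_lt_card_iff.1 hc
    by_cases h : G.Adj u v
    · exact ⟨u, v, h⟩
    · have := cx.sig u v huv h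
      have := cx.n11
      have : 0 < G.degree u ∨ 0 < G.degree v := by omega
      rcases this with h | h
      · obtain ⟨w, hw⟩ := (G.degree_pos_iff_exists_adj u).1 h; exact ⟨_, w, hw⟩
      · obtain ⟨w, hw⟩ := (G.degree_pos_iff_exists_adj v).1 h; exact ⟨_, w, hw⟩
  obtain ⟨u, v, huv⟩ := hE
  let P : ℕ → Prop := fun k => ∃ l : List V, l.Nodup ∧ Cyc G l ∧ l.length = k
  have hP : P 2 := ⟨[u, v], by simp [huv.ne], ⟨u, v, Pth.cons huv (Pth.single v), huv.symm⟩, rfl⟩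
  have hb : ∀ k, P k → k ≤ Fintype.card V := by
    rintro k ⟨l, h1, h2, rfl⟩; exact (cx.nonham l h1 h2).le
  obtain ⟨l, h1, h2, h3⟩ := Nat.findGreatest_spec (hb 2 hP) hP
  refine ⟨l, h1, h2, fun m k1 k2 => ?_⟩
  rw [h3]
  exact Nat.le_findGreatest (hb _ ⟨m, k1, k2, rfl⟩) ⟨m, k1, k2, rfl⟩

/-- Part B: a missable vertex of maximum degree has large degree. -/
theorem Ctx.high (cx : Ctx G) : ∃ C x, IsMx G C ∧ x ∉ C ∧
    (∀ y, Missable G y → G.degree y ≤ G.degree x) ∧ Fintype.card V ≤ 2 * G.degree x + 4 := by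
  classical
  obtain ⟨C0, mx0⟩ := cx.exists_mx
  have hx0 : ∃ x, Missable G x := by
    by_contra hno
    push Not at hno
    have hall : ∀ x, x ∈ C0 := fun x => by
      by_contra hx; exact hno x ⟨C0, mx0, hx⟩
    have := cx.nonham C0 mx0.1 mx0.2.1
    have h2 : (Finset.univ : Finset V).card ≤ C0.length :=
      le_trans (Finset.card_le_card (t := C0.toFinset) (fun z _ => by simpa using hall z))
        (List.toFinset_card_le C0)
    rw [Finset.card_univ] at h2
    omega
  obtain ⟨x, hxm, hmax⟩ := Finset.exists_max_image (Finset.univ.filter (Missable G)) (fun x => G.degree x)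
    (by obtain ⟨x, hx⟩ := hx0; exact ⟨x, by simpa using hx⟩)
  have hmax' : ∀ y, Missable G y → G.degree y ≤ G.degree x := fun y hy => hmax y (by simpa using hy)
  obtain ⟨C, mx, hxC⟩ : Missable G x := by simpa using hxm
  refine ⟨C, x, mx, hxC, hmax', ?_⟩
  by_contra hlow
  refine SC.false (G := G) (H := {x}) (C := C) ⟨cx, mx, by simp, by simpa using hxC, ?_, ?_⟩
  · intro v hv w hw
    simp at hv
    subst hv
    right
    by_contra hwC
    exact cx.dom mx hxC hwC hw
  · rintro a a' w ⟨haC, h, hh, ha⟩ ⟨haC', h', hh', ha'⟩ hne hw Q hQ hnd hQH hcov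
    simp at hh hh'
    rw [hh] at ha; rw [hh'] at ha'; clear hh hh' h h'
    have hxQ : x ∉ Q := fun hq => hQH x hq (by simp)
    have hc : Cyc G (x :: Q) := ⟨x, a', Pth.cons ha.symm hQ, ha'⟩
    have hn : (x :: Q).Nodup := by simp [hxQ, hnd]
    have hle := mx.2.2 _ hn hc
    simp at hle
    by_cases hwC : w ∈ C ∧ w ∉ Q
    · have hwh : w ≠ x := by rintro rfl; exact hxC hwC.1
      have hmiss : Missable G w := by
        refine ⟨x :: Q, ⟨hn, hc, fun l h1 h2 => (mx.2.2 l h1 h2).trans ?_⟩, by simp [hwh, hwC.2]⟩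
        have : C ⊆ w :: Q := fun z hz => by simpa using hcov z hz
        have := (List.subperm_of_subset mx.1 this).length_le
        simpa using this
      have hna : ¬ G.Adj w x := fun e => hw ⟨hwC.1, x, by simp, e⟩
      have h1 := cx.sig w x hwh hna
      have h2 := hmax' w hmiss
      omega
    · have : C ⊆ Q := fun z hz => by
        rcases hcov z hz with rfl | hz'
        · by_contra hzQ; exact hwC ⟨hz, hzQ⟩
        · exact hz'
      have := (List.subperm_of_subset mx.1 this).length_le
      omega

end
end HT

namespace HT
set_option linter.unusedSectionVars false
set_option linter.unusedSimpArgs false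
variable {V : Type u} {G : SimpleGraph V}

/-- `y` can be exchanged for `x` on the longest cycle with vertex list `F`. -/
def Ms (G : SimpleGraph V) (x : V) (F : List V) (y : V) : Prop :=
  ∃ l, IsMx G l ∧ (y :: l).Perm (x :: F)

def K1 (G : SimpleGraph V) (s : List V) (b' : V) : Prop :=
  ∀ b y z w, s = b :: y :: z :: w → G.Adj b' y → ¬ G.Adj b z

/-- Relation between two distinct segments. -/
def R0 (G : SimpleGraph V) (s s' : List V) : Prop :=
  ∀ b w b' w', s = b :: w → s' = b' :: w' → ¬ G.Adj b b' ∧ K1 G s b' ∧ K1 G s' b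

def R1 (G : SimpleGraph V) (s s' : List V) : Prop := R0 G s s' ∧ R0 G s.reverse s'.reverse

theorem R0.symm {s s' : List V} (h : R0 G s s') : R0 G s' s := fun b w b' w' e e' =>
  have := h b' w' b w e' e
  ⟨fun k => this.1 k.symm, this.2.2, this.2.1⟩

theorem R1.symm {s s' : List V} (h : R1 G s s') : R1 G s' s := ⟨h.1.symm, h.2.symm⟩
theorem R1.rev {s s' : List V} (h : R1 G s s') : R1 G s.reverse s'.reverse :=
  ⟨h.2, by simpa using h.1⟩

theorem Ms.perm {x y : V} {F F' : List V} (h : Ms G x F y) (hp : F.Perm F') : Ms G x F' y := by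
  obtain ⟨l, h1, h2⟩ := h
  exact ⟨l, h1, h2.trans (hp.cons x)⟩

theorem Ms.missable {x y : V} {F : List V} (h : Ms G x F y) (hF : F.Nodup) (hx : x ∉ F) :
    Missable G y := by
  obtain ⟨l, h1, h2⟩ := h
  have := h2.nodup_iff.2 (by simp [hx, hF])
  simp at this
  exact ⟨l, h1, this.1⟩

section
variable [Fintype V] [DecidableEq V] [DecidableRel G.Adj] {C : List V}
  {L : List (V × List V)} {x : V}

theorem Ms.out (cx : Ctx G) {y w : V} {F : List V} (h : Ms G x F y) (hF : F.Nodup) (hx : x ∉ F)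
    (hw : w ∉ F) (hwx : w ≠ x) : ¬ G.Adj y w := by
  obtain ⟨l, h1, h2⟩ := h
  have := h2.nodup_iff.2 (by simp [hx, hF])
  simp at this
  intro e
  refine cx.dom h1 this.1 ?_ e
  intro hwl
  have := h2.mem_iff.1 (List.mem_cons_of_mem y hwl)
  simp at this
  tauto

variable {a1 b1 c1 d1 a2 b2 c2 d2 : V} {s1 W1 s2 W2 : List V}

theorem ar_head (mx : IsMx G C) (hx : x ∉ C)
    (ar : Arcs G (G.Adj x) C a1 b1 c1 d1 a2 b2 c2 d2 s1 W1 s2 W2) : ¬ G.Adj b1 b2 := by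
  intro e
  refine mx.no1 hx (l := [x] ++ (W2.reverse ++ (s2.reverse ++ (s1 ++ W1))))
    ⟨_, _, (Pth.single x).app ar.A1 (ar.w2.rev.app ar.f2.symm
      (ar.p2.rev.app e.symm (ar.p1.app ar.f1 ar.w1))), ar.A2.symm⟩ ?_
  refine List.Perm.trans (perm_of_cnt fun z => ?_) (ar.perm.cons x)
  simp only [cnt_cons, List.count_append, List.count_reverse, List.cons_append,
    List.nil_append]; omega

theorem ar_sec (mx : IsMx G C) (hx : x ∉ C) {b y : V} {w : List V}
    (ar : Arcs G (G.Adj x) C a1 b1 c1 d1 a2 b2 c2 d2 s1 W1 s2 W2) (e : s1 = b :: y :: w)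
    (h : G.Adj b2 y) : Ms G x C b ∧ ∀ z w', w = z :: w' → ¬ G.Adj b z := by
  subst e
  obtain ⟨d, k1, k2⟩ := ar.p1.tail (by simp)
  have := k2.head_eq; subst this
  have := ar.p1.head_eq; subst this
  have hc : Cyc G ([x] ++ (W2.reverse ++ (s2.reverse ++ ((y :: w) ++ W1)))) :=
    ⟨_, _, (Pth.single x).app ar.A1 (ar.w2.rev.app ar.f2.symm
      (ar.p2.rev.app h (k2.app ar.f1 ar.w1))), ar.A2.symm⟩
  have hp : (b :: ([x] ++ (W2.reverse ++ (s2.reverse ++ ((y :: w) ++ W1))))).Perm (x :: C) := by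
    refine List.Perm.trans (perm_of_cnt fun z => ?_) (ar.perm.cons x)
    simp only [cnt_cons, List.count_append, List.count_reverse, List.cons_append,
      List.nil_append]; omega
  obtain ⟨m1, m2⟩ := mx.swap hx hc hp
  refine ⟨⟨_, m1, hp⟩, ?_⟩
  rintro z w' rfl hbz
  have m3 := IsMx.rot (l := [x] ++ (W2.reverse ++ (s2.reverse ++ [y, z]))) (m := w' ++ W1)
    (by simpa using m1)
  refine m3.insert (y := b) (m := w' ++ W1 ++ [x] ++ W2.reverse ++ s2.reverse) (p := y) (q := z)
    ?_ (by simp) k1 hbz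
  intro hb
  apply m2
  simp at hb ⊢
  tauto

theorem ar_single (mx : IsMx G C) (hx : x ∉ C)
    (ar : Arcs G (G.Adj x) C a1 b1 c1 d1 a2 b2 c2 d2 s1 W1 s2 W2) {t : V} (e : s1 = [t]) :
    Ms G x C t := by
  subst e
  have hc : Cyc G ([x] ++ (W1 ++ (s2 ++ W2))) :=
    ⟨_, _, (Pth.single x).app ar.D1 (ar.w1.app ar.e2 (ar.p2.app ar.f2 ar.w2)), ar.A1.symm⟩
  have hp : (t :: ([x] ++ (W1 ++ (s2 ++ W2)))).Perm (x :: C) := by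
    refine List.Perm.trans (perm_of_cnt fun z => ?_) (ar.perm.cons x)
    simp only [cnt_cons, List.count_append, List.count_reverse, List.cons_append,
      List.nil_append]; omega
  exact ⟨_, (mx.swap hx hc hp).1, hp⟩

/-- The relation `R1` and second-vertex facts hold between distinct segments. -/
theorem Dec.rel (mx : IsMx G C) (hx : x ∉ C) (hL : Dec G (G.Adj x) C L)
    {p q : V × List V} (hp : p ∈ L) (hq : q ∈ L) (hpq : p ≠ q) : R1 G p.2 q.2 := by
  have key : ∀ (a1 b1 c1 d1 a2 b2 c2 d2 : V) (s1 W1 s2 W2 : List V),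
      Arcs G (G.Adj x) C a1 b1 c1 d1 a2 b2 c2 d2 s1 W1 s2 W2 → R0 G s1 s2 := by
    rintro a1 b1 c1 d1 a2 b2 c2 d2 s1 W1 s2 W2 ar b w b' w' e e'
    have h1 : b = b1 := by have := ar.p1; rw [e] at this; exact this.head_eq
    have h2 : b' = b2 := by have := ar.p2; rw [e'] at this; exact this.head_eq
    subst h1 h2
    exact ⟨ar_head mx hx ar, fun _ _ _ _ k1 k2 => (ar_sec mx hx ar k1 k2).2 _ _ rfl,
      fun _ _ _ _ k1 k2 => (ar_sec mx hx ar.swap k1 k2).2 _ _ rfl⟩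
  by_cases hp2 : p.2 = []
  · refine ⟨fun b w b' w' e => ?_, fun b w b' w' e => ?_⟩ <;> simp [hp2] at e
  by_cases hq2 : q.2 = []
  · refine ⟨fun b w b' w' e e' => ?_, fun b w b' w' e e' => ?_⟩ <;> simp [hq2] at e'
  obtain ⟨b1, c1, d1, b2, c2, d2, W1, W2, ar⟩ := hL.arcs hp hq hpq hp2 hq2
  exact ⟨key _ _ _ _ _ _ _ _ _ _ _ _ ar, key _ _ _ _ _ _ _ _ _ _ _ _ ar.mirror⟩

theorem Dec.sec (mx : IsMx G C) (hx : x ∉ C) (hL : Dec G (G.Adj x) C L)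
    {p q : V × List V} (hp : p ∈ L) (hq : q ∈ L) (hpq : p ≠ q) {t b y : V} {w : List V}
    (hqt : q.2 = [t]) (e : p.2 = b :: y :: w ∨ p.2.reverse = b :: y :: w) (h : G.Adj t y) :
    Ms G x C b ∧ ∀ z w', w = z :: w' → ¬ G.Adj b z := by
  have hp2 : p.2 ≠ [] := by
    intro h0; rw [h0] at e; simp at e
  obtain ⟨b1, c1, d1, b2, c2, d2, W1, W2, ar⟩ := hL.arcs hp hq hpq hp2 (by simp [hqt])
  rw [hqt] at ar
  have h1 : t = b2 := ar.p2.head_eq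
  have h2 : t = c2 := Pth.last_eq (l := []) ar.p2
  rcases e with e | e
  · exact ar_sec mx hx ar e (h1 ▸ h)
  · exact ar_sec mx hx ar.mirror e (h2 ▸ h)

theorem Dec.sgl (mx : IsMx G C) (hx : x ∉ C) (hL : Dec G (G.Adj x) C L)
    {p q : V × List V} (hp : p ∈ L) (hq : q ∈ L) (hpq : p ≠ q) (hq2 : q.2 ≠ []) {t : V}
    (e : p.2 = [t]) : Ms G x C t := by
  obtain ⟨b1, c1, d1, b2, c2, d2, W1, W2, ar⟩ := hL.arcs hp hq hpq (by simp [e]) hq2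
  exact ar_single mx hx ar e

end
end HT

namespace HT
set_option linter.unusedSectionVars false
set_option linter.unusedSimpArgs false
variable {V : Type u} {G : SimpleGraph V}

/-- Alternating list `α₁ t₁ α₂ t₂ … a`. -/
def Wp (M : List (V × V)) (a : V) : List V := M.flatMap (fun p => [p.1, p.2]) ++ [a]

def hd (M : List (V × V)) (a : V) : V :=
  match M with
  | [] => a
  | p :: _ => p.1

abbrev Bk (V : Type u) := List V × List (V × V) × V

def fl (B : List (Bk V)) : List V := B.flatMap (fun b => b.1 ++ Wp b.2.1 b.2.2)
def As (B : List (Bk V)) : List V := B.flatMap (fun b => b.2.1.map Prod.fst ++ [b.2.2])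
def Sg (B : List (Bk V)) : List V := B.flatMap (fun b => b.2.1.map Prod.snd)

theorem fl_nil : fl ([] : List (Bk V)) = [] := rfl
theorem fl_cons (s : List V) (M : List (V × V)) (a : V) (B : List (Bk V)) :
    fl ((s, M, a) :: B) = s ++ (Wp M a ++ fl B) := by simp [fl]
theorem As_nil : As ([] : List (Bk V)) = [] := rfl
theorem As_cons (s : List V) (M : List (V × V)) (a : V) (B : List (Bk V)) :
    As ((s, M, a) :: B) = M.map Prod.fst ++ a :: As B := by simp [As]
theorem Sg_nil : Sg ([] : List (Bk V)) = [] := rfl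
theorem Sg_cons (s : List V) (M : List (V × V)) (a : V) (B : List (Bk V)) :
    Sg ((s, M, a) :: B) = M.map Prod.snd ++ Sg B := by simp [Sg]

theorem Wp_nil (a : V) : Wp [] a = [a] := rfl
theorem hd_nil (a : V) : hd [] a = a := rfl
theorem Wp_cons (α t a : V) (M : List (V × V)) : Wp ((α, t) :: M) a = α :: t :: Wp M a := by
  simp [Wp]
theorem Wp_split (N1 N2 : List (V × V)) (α t a : V) :
    Wp (N1 ++ (α, t) :: N2) a = Wp N1 α ++ t :: Wp N2 a := by simp [Wp]
theorem hd_split (N1 N2 : List (V × V)) (α t a : V) : hd (N1 ++ (α, t) :: N2) a = hd N1 α := by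
  cases N1 <;> rfl

theorem Wp_head (M : List (V × V)) (a : V) : (Wp M a).head? = some (hd M a) := by
  cases M <;> simp [Wp, hd]
theorem Wp_last (M : List (V × V)) (a : V) : (Wp M a).getLast? = some a := by
  simp [Wp]
theorem Wp_length (M : List (V × V)) (a : V) : (Wp M a).length = 2 * M.length + 1 := by
  induction M with
  | nil => rfl
  | cons p M ih => obtain ⟨α, t⟩ := p; rw [Wp_cons]; simp [ih]; omega

theorem ch_gen {u h b : V} {l m : List V} (h1 : l.head? = some h) (h2 : l.getLast? = some b) :
    (u :: (l ++ m)).IsChain G.Adj ↔ G.Adj u h ∧ l.IsChain G.Adj ∧ (b :: m).IsChain G.Adj := by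
  rw [List.isChain_cons, List.isChain_append, List.head?_append, h1, h2]
  simp [List.isChain_cons]
  tauto

theorem chW (u a : V) (M : List (V × V)) (m : List V) : (u :: (Wp M a ++ m)).IsChain G.Adj ↔
    G.Adj u (hd M a) ∧ (Wp M a).IsChain G.Adj ∧ (a :: m).IsChain G.Adj :=
  ch_gen (Wp_head M a) (Wp_last M a)
theorem chR (u a : V) (M : List (V × V)) (m : List V) :
    (u :: ((Wp M a).reverse ++ m)).IsChain G.Adj ↔
    G.Adj u a ∧ (Wp M a).IsChain G.Adj ∧ (hd M a :: m).IsChain G.Adj := by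
  rw [ch_gen (l := (Wp M a).reverse) (h := a) (b := hd M a) (by simp [Wp_last])
    (by simp [Wp_head]), List.isChain_reverse]
  simp only [SimpleGraph.adj_comm]
theorem chE (u a : V) (M : List (V × V)) : (u :: Wp M a).IsChain G.Adj ↔
    G.Adj u (hd M a) ∧ (Wp M a).IsChain G.Adj := by
  have := chW (G := G) u a M []
  simpa using this
theorem chS (N1 N2 : List (V × V)) (α t a : V) : (Wp (N1 ++ (α, t) :: N2) a).IsChain G.Adj ↔
    (Wp N1 α).IsChain G.Adj ∧ G.Adj α t ∧ G.Adj t (hd N2 a) ∧ (Wp N2 a).IsChain G.Adj := by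
  rw [Wp_split, List.isChain_append, Wp_last, chE]
  simp
  tauto

/-- All the marked vertices are adjacent to `x`. -/
def Xw (G : SimpleGraph V) (x : V) (M : List (V × V)) (a : V) : Prop :=
  ∀ w ∈ M.map Prod.fst ++ [a], G.Adj x w

theorem Xw_split (x : V) (N1 N2 : List (V × V)) (α t a : V) :
    Xw G x (N1 ++ (α, t) :: N2) a ↔ Xw G x N1 α ∧ Xw G x N2 a := by
  simp only [Xw, List.map_append, List.map_cons, List.append_assoc, List.cons_append,
    List.forall_mem_append, List.forall_mem_cons, List.not_mem_nil, false_imp_iff, implies_true,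
    and_true]
  tauto
theorem Xw.hd {x a : V} {M : List (V × V)} (h : Xw G x M a) : G.Adj x (hd M a) := by
  apply h
  cases M <;> simp [HT.hd]
theorem Xw.last {x a : V} {M : List (V × V)} (h : Xw G x M a) : G.Adj x a := h a (by simp)

section
variable [Fintype V] [DecidableEq V] [DecidableRel G.Adj] {C : List V} {x : V}
  {B B' : List (Bk V)}

/-- Block configuration of a longest cycle relative to a missed vertex `x` of large degree. -/
structure Cf (G : SimpleGraph V) [DecidableRel G.Adj] (x : V) (B : List (Bk V)) : Prop where
  cx : Ctx G
  mx : IsMx G (fl B)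
  hx : x ∉ fl B
  nx : ∀ w, G.Adj x w ↔ w ∈ As B
  mxd : ∀ y, Missable G y → G.degree y ≤ G.degree x
  hi : Fintype.card V ≤ 2 * G.degree x + 4
  sm : ∀ t ∈ Sg B, Ms G x (fl B) t
  ss : ∀ t ∈ Sg B, ∀ t' ∈ Sg B, ¬ G.Adj t t'
  sh : ∀ t ∈ Sg B, ∀ s ∈ B.map Prod.fst, ∀ y w, s = y :: w ∨ s.reverse = y :: w → ¬ G.Adj t y
  h2 : ∀ t ∈ Sg B, ∀ s ∈ B.map Prod.fst, ∀ b y w, s = b :: y :: w ∨ s.reverse = b :: y :: w →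
    G.Adj t y → Ms G x (fl B) b ∧ ∀ z w', w = z :: w' → ¬ G.Adj b z
  hh : (B.map Prod.fst).Pairwise (R1 G)

theorem fl_perm (B : List (Bk V)) : (fl B).Perm (As B ++ (Sg B ++ (B.map Prod.fst).flatten)) := by
  have hW : ∀ (M : List (V × V)) (a z : V),
      (Wp M a).count z = (M.map Prod.fst).count z + ind a z + (M.map Prod.snd).count z := by
    intro M a z
    induction M with
    | nil => simp [Wp_nil, cnt_cons]
    | cons p M ih =>
      obtain ⟨α, t⟩ := p
      rw [Wp_cons]
      simp only [List.map_cons, cnt_cons, ih]; omega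
  refine perm_of_cnt fun z => ?_
  induction B with
  | nil => rfl
  | cons b B ih =>
    obtain ⟨s, M, a⟩ := b
    simp only [fl_cons, As_cons, Sg_cons, List.map_cons, List.flatten_cons, List.count_append,
      cnt_cons, hW] at ih ⊢
    omega

theorem Cf.perm (h : Cf G x B) (hc : Cyc G (fl B')) (hp : (fl B').Perm (fl B))
    (hA : (As B').Perm (As B)) (hS : (Sg B').Perm (Sg B))
    (hT : (B'.map Prod.fst).Perm (B.map Prod.fst)) : Cf G x B' := by
  refine ⟨h.cx, h.mx.perm hc hp, fun k => h.hx (hp.mem_iff.1 k), fun w => ?_, h.mxd, h.hi, ?_, ?_,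
    ?_, ?_, ?_⟩
  · rw [h.nx, hA.mem_iff]
  · exact fun t ht => (h.sm t (hS.mem_iff.1 ht)).perm hp.symm
  · exact fun t ht t' ht' => h.ss t (hS.mem_iff.1 ht) t' (hS.mem_iff.1 ht')
  · exact fun t ht s hs => h.sh t (hS.mem_iff.1 ht) s (hT.mem_iff.1 hs)
  · intro t ht s hs b y w e k
    have := h.h2 t (hS.mem_iff.1 ht) s (hT.mem_iff.1 hs) b y w e k
    exact ⟨this.1.perm hp.symm, this.2⟩
  · exact (hT.pairwise_iff (fun {a b} => R1.symm)).2 h.hh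

theorem Cf.rot {B1 B2 : List (Bk V)} (h : Cf G x (B1 ++ B2)) : Cf G x (B2 ++ B1) := by
  refine h.perm ?_ ?_ ?_ ?_ ?_
  · have := h.mx.2.1
    simp only [fl, List.flatMap_append] at *
    exact this.rot
  · simp only [fl, List.flatMap_append]; exact List.perm_append_comm
  · simp only [As, List.flatMap_append]; exact List.perm_append_comm
  · simp only [Sg, List.flatMap_append]; exact List.perm_append_comm
  · simp only [List.map_append]; exact List.perm_append_comm

theorem Cf.revp (h : Cf G x B) (hc : Cyc G (fl B')) (hp : (fl B').Perm (fl B))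
    (hA : (As B').Perm (As B)) (hS : (Sg B').Perm (Sg B))
    (hT : (B'.map Prod.fst).Perm (B.map (fun b => b.1.reverse))) : Cf G x B' := by
  have hT' : ∀ s ∈ B'.map Prod.fst, s.reverse ∈ B.map Prod.fst := by
    intro s hs
    have := hT.mem_iff.1 hs
    simp only [List.mem_map] at this ⊢
    obtain ⟨b, hb, rfl⟩ := this
    exact ⟨b, hb, by simp⟩
  refine ⟨h.cx, h.mx.perm hc hp, fun k => h.hx (hp.mem_iff.1 k), fun w => ?_, h.mxd, h.hi, ?_, ?_,
    ?_, ?_, ?_⟩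
  · rw [h.nx, hA.mem_iff]
  · exact fun t ht => (h.sm t (hS.mem_iff.1 ht)).perm hp.symm
  · exact fun t ht t' ht' => h.ss t (hS.mem_iff.1 ht) t' (hS.mem_iff.1 ht')
  · intro t ht s hs y w e
    exact h.sh t (hS.mem_iff.1 ht) _ (hT' s hs) y w (by simpa using e.symm)
  · intro t ht s hs b y w e k
    have := h.h2 t (hS.mem_iff.1 ht) _ (hT' s hs) b y w (by simpa using e.symm) k
    exact ⟨this.1.perm hp.symm, this.2⟩
  · refine (hT.pairwise_iff (fun {a b} => R1.symm)).2 ?_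
    have := h.hh
    rw [List.pairwise_map] at this ⊢
    exact this.imp R1.rev

theorem Cf.chain (h : Cf G x B) : (fl B ++ (fl B).take 1).IsChain G.Adj := by
  obtain ⟨-, hc, -⟩ := h.mx
  cases e : fl B with
  | nil => simp
  | cons y l => rw [e] at hc; exact hc.chain

theorem Cf.xw (h : Cf G x B) : ∀ b ∈ B, Xw G x b.2.1 b.2.2 := by
  intro b hb w hw
  rw [h.nx]
  exact List.mem_flatMap.2 ⟨b, hb, hw⟩

theorem Cf.no (h : Cf G x B) {y : V} {l : List V} (hc : (y :: (l ++ [y])).IsChain G.Adj)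
    (hp : ∀ z, (y :: l).count z = ind x z + (fl B).count z) : False := by
  refine h.mx.no1 h.hx (cyc_of_chain (x := y) (l := l) hc) (perm_of_cnt fun z => ?_)
  rw [hp, cnt_cons]

theorem Cf.ms (h : Cf G x B) {y : V} {l : List V} (t : V) (hc : (y :: (l ++ [y])).IsChain G.Adj)
    (hp : ∀ z, (t :: y :: l).count z = ind x z + (fl B).count z) : Ms G x (fl B) t := by
  have hp' : (t :: y :: l).Perm (x :: fl B) := perm_of_cnt fun z => by rw [hp, cnt_cons]
  exact ⟨_, (h.mx.swap h.hx (cyc_of_chain (x := y) (l := l) hc) hp').1, hp'⟩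

theorem Cf.nodup (h : Cf G x B) : (As B ++ (Sg B ++ (B.map Prod.fst).flatten)).Nodup :=
  (fl_perm B).nodup_iff.1 h.mx.1

theorem Cf.deg (h : Cf G x B) : G.degree x = (As B).length := by
  rw [← SimpleGraph.card_neighborFinset_eq_degree,
    ← List.toFinset_card_of_nodup (List.nodup_append.1 h.nodup).1]
  congr 1
  ext w
  simp [h.nx]

theorem Cf.degle (h : Cf G x B) {t : V} (ht : Ms G x (fl B) t) : G.degree t ≤ G.degree x :=
  h.mxd t (ht.missable h.mx.1 h.hx)

theorem Cf.mem (h : Cf G x B) {w : V} : w ∈ fl B ↔ w ∈ As B ∨ w ∈ Sg B ∨ ∃ b ∈ B, w ∈ b.1 := by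
  rw [(fl_perm B).mem_iff]; simp

/-- Neighbours of an exchangeable vertex. -/
theorem Cf.nbr (h : Cf G x B) {t w : V} (ht : Ms G x (fl B) t) (htA : t ∉ As B) (e : G.Adj t w) :
    w ∈ As B ∨ w ∈ Sg B ∨ ∃ b ∈ B, w ∈ b.1 := by
  rw [← h.mem]
  by_contra hw
  by_cases hwx : w = x
  · subst hwx; exact htA ((h.nx t).1 e.symm)
  · exact ht.out h.cx h.mx.1 h.hx hw hwx e

theorem Cf.sA (h : Cf G x B) {t : V} (ht : t ∈ Sg B) : t ∉ As B := fun hA =>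
  (List.nodup_append.1 h.nodup).2.2 _ hA _ (by simp [ht]) rfl

theorem Cf.bA (h : Cf G x B) {t : V} (ht : ∃ b ∈ B, t ∈ b.1) : t ∉ As B := fun hA =>
  (List.nodup_append.1 h.nodup).2.2 _ hA _ (by
    obtain ⟨b, hb, ht⟩ := ht; simp only [List.mem_append, List.mem_flatten, List.mem_map]
    exact Or.inr ⟨_, ⟨b, hb, rfl⟩, ht⟩) rfl

theorem Cf.bS (h : Cf G x B) {t : V} (ht : ∃ b ∈ B, t ∈ b.1) : t ∉ Sg B := fun hA =>
  (List.nodup_append.1 (List.nodup_append.1 h.nodup).2.1).2.2 _ hA _ (by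
    obtain ⟨b, hb, ht⟩ := ht; simp only [List.mem_flatten, List.mem_map]
    exact ⟨_, ⟨b, hb, rfl⟩, ht⟩) rfl

theorem Cf.sN (h : Cf G x B) {t w : V} (ht : t ∈ Sg B) (e : G.Adj t w) :
    w ∈ As B ∨ ∃ b ∈ B, w ∈ b.1 := by
  rcases h.nbr (h.sm t ht) (h.sA ht) e with k | k | k
  · exact Or.inl k
  · exact absurd e (h.ss t ht w k)
  · exact Or.inr k

theorem Cf.xN (h : Cf G x B) : x ∉ As B ∧ x ∉ Sg B ∧ ∀ b ∈ B, x ∉ b.1 := by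
  have := h.hx
  rw [h.mem] at this
  push Not at this
  exact this

theorem Cf.k4 (h : Cf G x B) : 4 ≤ G.degree x := by
  have := h.cx.n11; have := h.hi; omega

/-- If the longest cycle misses only `x` … -/
theorem Cf.cov (h : Cf G x B) (hr : Fintype.card V ≤ (fl B).length + 1) (w : V) :
    w = x ∨ w ∈ fl B := by
  by_contra hw
  push Not at hw
  have : (w :: x :: fl B).Nodup := by simp [hw.1, hw.2, h.hx, h.mx.1]
  have := List.Nodup.length_le_card this
  simp at this
  omega

end
end HT

namespace HT
set_option linter.unusedSectionVars false
set_option linter.unusedSimpArgs false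
variable {V : Type u} {G : SimpleGraph V}

theorem bl_exists (L : List (V × List V)) (f : V) (hL : ∀ p ∈ L, p.2 ≠ []) :
    ∃ (M : List (V × V)) (a : V) (B : List (Bk V)), flat L ++ [f] = Wp M a ++ fl B ∧
      L.map Prod.fst ++ [f] = M.map Prod.fst ++ a :: As B ∧
      (∀ t ∈ M.map Prod.snd ++ Sg B, ∃ p ∈ L, p.2 = [t]) ∧
      (B.map Prod.fst).Sublist (L.map Prod.snd) ∧ ∀ s ∈ B.map Prod.fst, 2 ≤ s.length := by
  induction L with
  | nil => exact ⟨[], f, [], by simp [Wp_nil, fl_nil, As_nil, Sg_nil]⟩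
  | cons p L ih =>
    obtain ⟨M, a, B, h1, h2, h3, h4, h5⟩ := ih (fun q hq => hL q (by simp [hq]))
    obtain ⟨α, s⟩ := p
    have hs := hL (α, s) (by simp)
    match s, hs with
    | [t], _ =>
      refine ⟨(α, t) :: M, a, B, ?_, ?_, ?_, ?_, h5⟩
      · simp [Wp_cons, h1]
      · simp [h2]
      · intro t' ht'
        simp only [List.map_cons, List.cons_append, List.mem_cons] at ht'
        rcases ht' with rfl | ht'
        · exact ⟨_, List.mem_cons_self, rfl⟩
        · obtain ⟨p, hp, e⟩ := h3 t' ht'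
          exact ⟨p, by simp [hp], e⟩
      · simpa using h4.cons [t]
    | b :: y :: w, _ =>
      refine ⟨[], α, (b :: y :: w, M, a) :: B, ?_, ?_, ?_, ?_, ?_⟩
      · simp [Wp_nil, fl_cons, h1]
      · simp [As_cons, h2]
      · intro t' ht'
        simp only [List.map_nil, List.nil_append, Sg_cons] at ht'
        obtain ⟨p, hp, e⟩ := h3 t' ht'
        exact ⟨p, by simp [hp], e⟩
      · simpa using h4
      · intro s hs
        simp only [List.map_cons, List.mem_cons] at hs
        rcases hs with rfl | hs
        · simp
        · exact h5 s hs

section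
variable [Fintype V] [DecidableEq V] [DecidableRel G.Adj] {C : List V} {x : V}
  {B B' : List (Bk V)} {L : List (V × List V)}

theorem Dec.segne (mx : IsMx G C) (hx : x ∉ C) (hL : Dec G (G.Adj x) C L) :
    ∀ p ∈ L, p.2 ≠ [] := by
  intro p hp h0
  obtain ⟨M, hM, -⟩ := hL.front hp
  obtain ⟨a, s⟩ := p
  simp only at h0; subst h0
  have hx' : x ∉ flat ((a, []) :: M) := fun h => hx (hM.perm.mem_iff.1 h)
  have ha := (hM.hA (a, []) (by simp)).1
  cases M with
  | nil =>
    obtain ⟨u, v, h1, h2⟩ := hM.mx.2.1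
    simp at h1
    have e1 := h1.head_eq
    have e2 := Pth.last_eq (l := []) h1
    subst e1; subst e2
    exact h2.ne rfl
  | cons q M =>
    obtain ⟨b, s⟩ := q
    have hb := (hM.hA (b, s) (by simp)).1
    have e : flat ((a, []) :: (b, s) :: M) = [a, b] ++ (s ++ flat M) := by simp
    have hm := hM.mx
    rw [e] at hm hx'
    exact hm.rot.insert (fun h => hx' (by simp at h ⊢; tauto)) rfl ha hb

theorem fl_len (B : List (Bk V)) :
    (fl B).length + B.length = 2 * (As B).length + (B.map Prod.fst).flatten.length := by
  induction B with
  | nil => rfl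
  | cons b B ih =>
    obtain ⟨s, M, a⟩ := b
    simp only [fl_cons, As_cons, List.map_cons, List.flatten_cons, List.length_append,
      List.length_cons, Wp_length, List.length_map]
    omega

theorem Ctx.cf (cx : Ctx G) : ∃ x B, Cf G x B ∧ B ≠ [] ∧ ∀ s ∈ B.map Prod.fst, 2 ≤ s.length := by
  obtain ⟨C, x, mx, hx, hmax, hi⟩ := cx.high
  have hxC : ∀ w, G.Adj x w → w ∈ C := fun w hw => by
    by_contra h; exact cx.dom mx hx h hw
  have hn := cx.n11
  have : 0 < G.degree x := by omega
  rw [SimpleGraph.degree_pos_iff_exists_adj] at this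
  obtain ⟨a0, ha0⟩ := this
  obtain ⟨L, hL⟩ := dec_exists (G.Adj x) mx a0 (hxC _ ha0) ha0
  have hne := hL.segne mx hx
  have hk : G.degree x = L.length := by
    rw [← List.length_map (f := Prod.fst), ← List.toFinset_card_of_nodup hL.nodup_fst,
      ← SimpleGraph.card_neighborFinset_eq_degree]
    congr 1
    ext w
    rw [List.mem_toFinset, ← hL.mem]
    simp only [SimpleGraph.mem_neighborFinset]
    exact ⟨fun h => ⟨hxC _ h, h⟩, fun h => h.2⟩
  have hother : ∀ p ∈ L, ∃ q ∈ L, p ≠ q := by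
    intro p hp
    by_contra hc
    push Not at hc
    have : L.length ≤ [p].length := (hL.nodup.subperm (l₂ := [p]) (fun q hq => by
      rw [← hc q hq]; simp)).length_le
    simp at this
    omega
  have hsgl : ∀ p ∈ L, ∀ t, p.2 = [t] → Ms G x C t := by
    intro p hp t e
    obtain ⟨q, hq, hpq⟩ := hother p hp
    exact hL.sgl mx hx hp hq hpq (hne q hq) e
  have hss : ∀ p ∈ L, ∀ q ∈ L, ∀ t t', p.2 = [t] → q.2 = [t'] → ¬ G.Adj t t' := by
    intro p hp q hq t t' e e'
    by_cases hpq : p = q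
    · subst hpq
      rw [e] at e'
      simp at e'
      subst e'
      exact fun h => h.ne rfl
    · exact ((hL.rel mx hx hp hq hpq).1 _ _ _ _ e e').1
  by_cases hlong : ∃ p ∈ L, 2 ≤ p.2.length
  · obtain ⟨p, hp, hp2⟩ := hlong
    obtain ⟨L', hM, hperm⟩ := hL.front hp
    obtain ⟨a1, s1⟩ := p
    obtain ⟨M, a, B, h1, h2, h3, h4, h5⟩ := bl_exists L' a1
      (fun q hq => hne q (hperm.mem_iff.1 (by simp [hq])))
    have hfl : fl ((s1, M, a) :: B) = s1 ++ flat L' ++ [a1] := by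
      rw [fl_cons, ← h1]; simp
    have hm := hM.mx
    have hfp : (fl ((s1, M, a) :: B)).Perm C := by
      refine List.Perm.trans ?_ hM.perm
      rw [hfl]
      simp only [flat_cons]
      exact List.perm_append_comm
    have hsub : ((s1 :: B.map Prod.fst)).Sublist (((a1, s1) :: L').map Prod.snd) := by
      simpa using h4
    have h5' : ∀ s ∈ (((s1, M, a) :: B).map Prod.fst), 2 ≤ s.length := by
      intro s hs
      simp only [List.map_cons, List.mem_cons] at hs
      rcases hs with rfl | hs
      · exact hp2
      · exact h5 s hs
    have hin : ∀ s ∈ (((s1, M, a) :: B).map Prod.fst), ∃ q ∈ L, q.2 = s := by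
      intro s hs
      have := hsub.subset hs
      obtain ⟨q, hq, e⟩ := List.mem_map.1 this
      exact ⟨q, hperm.mem_iff.1 hq, e⟩
    have h3' : ∀ t ∈ Sg ((s1, M, a) :: B), ∃ p ∈ L, p.2 = [t] := by
      intro t ht
      rw [Sg_cons] at ht
      obtain ⟨p, hp, e⟩ := h3 t ht
      exact ⟨p, hperm.mem_iff.1 (by simp [hp]), e⟩
    refine ⟨x, (s1, M, a) :: B, ⟨cx, ?_, ?_, ?_, hmax, hi, ?_, ?_, ?_, ?_, ?_⟩, by simp, h5'⟩
    · rw [hfl]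
      have : flat ((a1, s1) :: L') = [a1] ++ (s1 ++ flat L') := by simp
      rw [this] at hm
      exact hm.rot
    · exact fun h => hx (hfp.mem_iff.1 h)
    · intro w
      rw [As_cons, ← h2]
      have := hM.mem w
      simp only [List.map_cons, List.mem_cons, List.mem_append, List.mem_singleton] at this ⊢
      constructor
      · intro h; exact (this.1 ⟨hxC _ h, h⟩).symm.imp_right (by simp)
      · intro h
        exact (this.2 (by rcases h with h | h | h
                          · exact Or.inr h
                          · exact Or.inl h
                          · simp at h)).2
    · intro t ht
      obtain ⟨p, hp, e⟩ := h3' t ht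
      exact (hsgl p hp t e).perm hfp.symm
    · intro t ht t' ht'
      obtain ⟨p, hp, e⟩ := h3' t ht
      obtain ⟨q, hq, e'⟩ := h3' t' ht'
      exact hss p hp q hq t t' e e'
    · intro t ht s hs y w e
      obtain ⟨p, hp, ep⟩ := h3' t ht
      obtain ⟨q, hq, eq⟩ := hin s hs
      have hpq : p ≠ q := by
        rintro rfl
        have := h5' s hs
        rw [← eq, ep] at this
        simp at this
      have hr := hL.rel mx hx hp hq hpq
      rw [ep, eq] at hr
      rcases e with e | e
      · exact (hr.1 _ _ _ _ rfl e).1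
      · exact (hr.2 _ _ _ _ rfl e).1
    · intro t ht s hs b y w e had
      obtain ⟨p, hp, ep⟩ := h3' t ht
      obtain ⟨q, hq, eq⟩ := hin s hs
      have hpq : p ≠ q := by
        rintro rfl
        have := h5' s hs
        rw [← eq, ep] at this
        simp at this
      have := hL.sec mx hx hq hp (Ne.symm hpq) ep (by rw [eq]; exact e) had
      exact ⟨this.1.perm hfp.symm, this.2⟩
    · refine List.Pairwise.sublist hsub ?_
      rw [List.pairwise_map]
      refine List.Pairwise.imp_of_mem ?_ hM.nodup
      intro p q hp hq hpq
      exact hL.rel mx hx (hperm.mem_iff.1 hp) (hperm.mem_iff.1 hq) hpq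
  · exfalso
    push Not at hlong
    have h1 : ∀ p ∈ L, ∃ t, p.2 = [t] := by
      intro p hp
      have := hlong p hp
      have h0 := List.length_pos_iff.2 (hne p hp)
      exact List.length_eq_one_iff.1 (by omega)
    have hflat : ∀ L' : List (V × List V), (∀ p ∈ L', ∃ t, p.2 = [t]) →
        ((L'.map Prod.snd).flatten).length = L'.length := by
      intro L' h
      induction L' with
      | nil => rfl
      | cons p L' ih =>
        obtain ⟨t, ht⟩ := h p (by simp)
        simp only [List.map_cons, List.flatten_cons, ht, List.length_append, List.length_cons,
          ih (fun q hq => h q (by simp [hq]))]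
        simp; omega
    have hpf : ∀ L' : List (V × List V),
        (flat L').Perm (L'.map Prod.fst ++ (L'.map Prod.snd).flatten) := by
      intro L'
      refine perm_of_cnt fun z => ?_
      induction L' with
      | nil => rfl
      | cons p L' ih =>
        simp only [List.map_cons, List.flatten_cons, flat_cons, List.count_append, cnt_cons,
          List.cons_append] at ih ⊢
        omega
    have hnd : (L.map Prod.fst ++ (L.map Prod.snd).flatten).Nodup :=
      (hpf L).nodup_iff.1 hL.mx.1
    have hmemT : ∀ t, t ∈ (L.map Prod.snd).flatten → ∃ p ∈ L, p.2 = [t] := by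
      intro t ht
      obtain ⟨l, hl, htl⟩ := List.mem_flatten.1 ht
      obtain ⟨p, hp, rfl⟩ := List.mem_map.1 hl
      obtain ⟨t', ht'⟩ := h1 p hp
      rw [ht'] at htl
      simp at htl
      subst htl
      exact ⟨p, hp, ht'⟩
    have hmemC : ∀ w, w ∈ C ↔ w ∈ L.map Prod.fst ∨ w ∈ (L.map Prod.snd).flatten := by
      intro w
      rw [← hL.perm.mem_iff, (hpf L).mem_iff, List.mem_append]
    have hxA : x ∉ L.map Prod.fst := fun h => hx ((hmemC x).2 (Or.inl h))
    have hxT : x ∉ (L.map Prod.snd).flatten := fun h => hx ((hmemC x).2 (Or.inr h))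
    have := tough_iso cx.tough (x :: (L.map Prod.snd).flatten) (L.map Prod.fst)
      (List.nodup_cons.2 ⟨hxT, (List.nodup_append.1 hnd).2.1⟩)
      (by
        intro v hv hv'
        rcases List.mem_cons.1 hv with rfl | hv
        · exact hxA hv'
        · exact (List.nodup_append.1 hnd).2.2 _ hv' _ hv rfl)
      (by
        intro v hv w hvw
        rcases List.mem_cons.1 hv with rfl | hvT
        · exact (hL.mem w).1 ⟨hxC w hvw, hvw⟩
        · obtain ⟨p, hp, e⟩ := hmemT v hvT
          have hwC : w ∈ C := by
            by_contra hw
            by_cases hwx : w = x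
            · rw [hwx] at hvw
              exact (List.nodup_append.1 hnd).2.2 _
                ((hL.mem v).1 ⟨(hmemC v).2 (Or.inr hvT), hvw.symm⟩) _ hvT rfl
            · exact (hsgl p hp v e).out cx mx.1 hx hw hwx hvw
          rcases (hmemC w).1 hwC with h | h
          · exact h
          · obtain ⟨q, hq, e'⟩ := hmemT w h
            exact absurd hvw (hss p hp q hq v w e e'))
      (by simp only [List.length_cons, hflat L h1]; omega)
    simp only [List.length_cons, hflat L h1, List.length_map] at this
    omega

end
end HT

namespace HT
set_option linter.unusedSectionVars false
set_option linter.unusedSimpArgs false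
variable {V : Type u} {G : SimpleGraph V}

theorem mem_fst {w : V} {M : List (V × V)} (h : w ∈ M.map Prod.fst) :
    ∃ N1 t N2, M = N1 ++ (w, t) :: N2 := by
  obtain ⟨⟨α, t⟩, hp, rfl⟩ := List.mem_map.1 h
  obtain ⟨l1, l2, e⟩ := List.append_of_mem hp
  exact ⟨l1, t, l2, e⟩

theorem mem_snd {t : V} {M : List (V × V)} (h : t ∈ M.map Prod.snd) :
    ∃ N1 α N2, M = N1 ++ (α, t) :: N2 := by
  obtain ⟨⟨α, t⟩, hp, rfl⟩ := List.mem_map.1 h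
  obtain ⟨l1, l2, e⟩ := List.append_of_mem hp
  exact ⟨l1, α, l2, e⟩

theorem mem_pre {w a : V} {M : List (V × V)} (h : w ∈ M.map Prod.fst ∨ w = a) :
    w = hd M a ∨ ∃ N1 γ t N2, M = N1 ++ (γ, t) :: N2 ∧ w = hd N2 a := by
  induction M with
  | nil => left; simpa [hd] using h
  | cons p M ih =>
    obtain ⟨α, t⟩ := p
    by_cases hw : w = α
    · left; simpa [hd] using hw
    · right
      have h' : w ∈ M.map Prod.fst ∨ w = a := by
        rcases h with h | h
        · simp only [List.map_cons, List.mem_cons] at h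
          exact Or.inl (h.resolve_left hw)
        · exact Or.inr h
      rcases ih h' with e | ⟨N1, γ, t', N2, e1, e2⟩
      · exact ⟨[], α, t, M, rfl, e⟩
      · exact ⟨(α, t) :: N1, γ, t', N2, by rw [e1]; rfl, e2⟩

/-- reversal of alternating lists -/
theorem rv_exists (M : List (V × V)) (a : V) : ∃ M' : List (V × V),
    Wp M' (hd M a) = (Wp M a).reverse ∧ M'.length = M.length ∧ hd M' (hd M a) = a ∧
    (M'.map Prod.fst ++ [hd M a]).Perm (M.map Prod.fst ++ [a]) ∧
    (M'.map Prod.snd).Perm (M.map Prod.snd) := by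
  induction M with
  | nil => exact ⟨[], by simp [Wp_nil, hd]⟩
  | cons p M ih =>
    obtain ⟨α, t⟩ := p
    obtain ⟨M', h1, h2, h3, h4, h5⟩ := ih
    refine ⟨M' ++ [(hd M a, t)], ?_, ?_, ?_, ?_, ?_⟩
    · rw [Wp_split, h1, Wp_cons, Wp_nil]; simp [hd]
    · simp [h2]
    · rw [hd_split, h3]
    · rw [show hd ((α, t) :: M) a = α from rfl]
      simp only [List.map_append, List.map_cons, List.map_nil]
      refine List.Perm.trans (List.perm_append_comm) ?_
      simpa using h4
    · simp only [List.map_append, List.map_cons, List.map_nil]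
      refine List.Perm.trans (List.perm_append_comm) ?_
      simpa using h5

theorem Sg_len (B : List (Bk V)) : (Sg B).length + B.length = (As B).length := by
  induction B with
  | nil => rfl
  | cons b B ih =>
    obtain ⟨s, M, a⟩ := b
    simp only [Sg_cons, As_cons, List.length_append, List.length_cons, List.length_map]
    omega

section
variable [Fintype V] [DecidableEq V] [DecidableRel G.Adj] {C : List V} {x : V}
  {B B' : List (Bk V)}

theorem Cf.len (h : Cf G x B) :
    (fl B).length + B.length = 2 * G.degree x + (B.map Prod.fst).flatten.length := by
  rw [h.deg]; exact fl_len B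

theorem Cf.lt (h : Cf G x B) : (fl B).length + 1 ≤ Fintype.card V := by
  have : (x :: fl B).Nodup := by simp [h.hx, h.mx.1]
  simpa using List.Nodup.length_le_card this

theorem rv_cnt {M M' : List (V × V)} {a a' : V}
    (h : (M'.map Prod.fst ++ [a']).Perm (M.map Prod.fst ++ [a])) (z : V) :
    (M'.map Prod.fst).count z + ind a' z = (M.map Prod.fst).count z + ind a z := by
  have := h.count_eq z
  simpa only [List.count_append, cnt_cons, List.count_nil, Nat.add_zero] using this

theorem Cf.rev1 {s1 : List V} {M1 : List (V × V)} {a1 : V} (h : Cf G x [(s1, M1, a1)]) :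
    ∃ M1' a1', M1'.length = M1.length ∧ Cf G x [(s1.reverse, M1', a1')] := by
  obtain ⟨M1', w1, l1, d1, f1, g1⟩ := rv_exists M1 a1
  refine ⟨M1', hd M1 a1, l1, h.revp ?_ ?_ ?_ ?_ ?_⟩
  · have := h.mx.2.1
    simp only [fl_cons, fl_nil, List.append_nil] at this ⊢
    rw [w1]
    simpa only [List.reverse_append] using this.rot.rev
  · refine perm_of_cnt fun z => ?_
    simp only [fl_cons, fl_nil, w1, List.count_append, List.count_reverse]
  · simpa only [As_cons, As_nil] using f1
  · simpa only [Sg_cons, Sg_nil, List.append_nil] using g1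
  · simp

theorem Cf.rev2 {s1 s2 : List V} {M1 M2 : List (V × V)} {a1 a2 : V}
    (h : Cf G x [(s1, M1, a2), (s2, M2, a1)]) :
    ∃ M1' M2' a1' a2', M1'.length = M1.length ∧ M2'.length = M2.length ∧
      Cf G x [(s1.reverse, M2', a1'), (s2.reverse, M1', a2')] := by
  obtain ⟨M1', w1, l1, d1, f1, g1⟩ := rv_exists M1 a2
  obtain ⟨M2', w2, l2, d2, f2, g2⟩ := rv_exists M2 a1
  refine ⟨M1', M2', hd M2 a1, hd M1 a2, l1, l2, h.revp ?_ ?_ ?_ ?_ ?_⟩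
  · have := h.mx.2.1
    simp only [fl_cons, fl_nil, List.append_nil] at this ⊢
    rw [w1, w2]
    simpa only [List.reverse_append, List.append_assoc] using this.rot.rev
  · refine perm_of_cnt fun z => ?_
    simp only [fl_cons, fl_nil, w1, w2, List.count_append, List.count_reverse]
    omega
  · refine perm_of_cnt fun z => ?_
    have k1 := rv_cnt f1 z
    have k2 := rv_cnt f2 z
    simp only [As_cons, As_nil, List.count_append, cnt_cons, List.count_nil]
    omega
  · refine perm_of_cnt fun z => ?_
    have k1 := g1.count_eq z
    have k2 := g2.count_eq z
    simp only [Sg_cons, Sg_nil, List.count_append, cnt_cons, List.count_nil]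
    omega
  · simp

theorem Cf.rev3 {s1 s2 s3 : List V} {M1 M2 M3 : List (V × V)} {a b c : V}
    (h : Cf G x [(s1, M1, a), (s2, M2, b), (s3, M3, c)]) :
    ∃ M1' M2' M3' a' b' c', M1'.length = M1.length ∧ M2'.length = M2.length ∧
      M3'.length = M3.length ∧
      Cf G x [(s1.reverse, M3', c'), (s3.reverse, M2', b'), (s2.reverse, M1', a')] := by
  obtain ⟨M1', w1, l1, d1, f1, g1⟩ := rv_exists M1 a
  obtain ⟨M2', w2, l2, d2, f2, g2⟩ := rv_exists M2 b
  obtain ⟨M3', w3, l3, d3, f3, g3⟩ := rv_exists M3 c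
  refine ⟨M1', M2', M3', hd M1 a, hd M2 b, hd M3 c, l1, l2, l3, h.revp ?_ ?_ ?_ ?_ ?_⟩
  · have := h.mx.2.1
    simp only [fl_cons, fl_nil, List.append_nil] at this ⊢
    rw [w1, w2, w3]
    simpa only [List.reverse_append, List.append_assoc] using this.rot.rev
  · refine perm_of_cnt fun z => ?_
    simp only [fl_cons, fl_nil, w1, w2, w3, List.count_append, List.count_reverse]
    omega
  · refine perm_of_cnt fun z => ?_
    have k1 := rv_cnt f1 z
    have k2 := rv_cnt f2 z
    have k3 := rv_cnt f3 z
    simp only [As_cons, As_nil, List.count_append, cnt_cons, List.count_nil]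
    omega
  · refine perm_of_cnt fun z => ?_
    have k1 := g1.count_eq z
    have k2 := g2.count_eq z
    have k3 := g3.count_eq z
    simp only [Sg_cons, Sg_nil, List.count_append, cnt_cons, List.count_nil]
    omega
  · simp only [List.map_cons, List.map_nil]
    exact List.Perm.cons _ (List.Perm.swap _ _ _)

/-- separating structure common to the toughness arguments -/
theorem Cf.sep (h : Cf G x B) (E F : List V) (hE : E.Nodup) (hEF : ∀ v ∈ E, v ∉ F)
    (hEB : ∀ v ∈ E, ∃ b ∈ B, v ∈ b.1)
    (hFB : ∀ v ∈ F, ∃ b ∈ B, v ∈ b.1)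
    (hEN : ∀ v ∈ E, ∀ w, G.Adj v w → w ∈ F ∨ w ∈ As B)
    (hSN : ∀ t ∈ Sg B, ∀ w, (∃ b ∈ B, w ∈ b.1) → G.Adj t w → w ∈ F) :
    (x :: (E ++ Sg B)).Nodup ∧ (∀ v ∈ x :: (E ++ Sg B), v ∉ F ++ As B) ∧
    (∀ v ∈ x :: (E ++ Sg B), ∀ w, G.Adj v w → w ∈ F ++ As B) := by
  have hxn := h.xN
  have hxb : ¬ ∃ b ∈ B, x ∈ b.1 := fun ⟨b, hb, k⟩ => hxn.2.2 b hb k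
  refine ⟨?_, ?_, ?_⟩
  · rw [List.nodup_cons, List.nodup_append]
    refine ⟨fun k => ?_, hE, ?_, ?_⟩
    · rcases List.mem_append.1 k with k | k
      · exact hxb (hEB x k)
      · exact hxn.2.1 k
    · exact (List.nodup_append.1 (List.nodup_append.1 h.nodup).2.1).1
    · rintro v hv w hw rfl
      exact h.bS (hEB v hv) hw
  · intro v hv hv'
    simp only [List.mem_cons, List.mem_append] at hv hv'
    rcases hv with rfl | hv | hv
    · rcases hv' with k | k
      · exact hxb (hFB _ k)
      · exact hxn.1 k
    · rcases hv' with k | k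
      · exact hEF v hv k
      · exact h.bA (hEB v hv) k
    · rcases hv' with k | k
      · exact h.bS (hFB v k) hv
      · exact h.sA hv k
  · intro v hv w e
    simp only [List.mem_cons, List.mem_append] at hv ⊢
    rcases hv with rfl | hv | hv
    · exact Or.inr ((h.nx w).1 e)
    · exact hEN v hv w e
    · rcases h.sN hv e with k | k
      · exact Or.inr k
      · exact Or.inl (hSN v hv w k e)

theorem Cf.t1 (h : Cf G x B) (E F : List V) (hE : E.Nodup) (hEF : ∀ v ∈ E, v ∉ F)
    (hEB : ∀ v ∈ E, ∃ b ∈ B, v ∈ b.1)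
    (hFB : ∀ v ∈ F, ∃ b ∈ B, v ∈ b.1)
    (hEN : ∀ v ∈ E, ∀ w, G.Adj v w → w ∈ F ∨ w ∈ As B)
    (hSN : ∀ t ∈ Sg B, ∀ w, (∃ b ∈ B, w ∈ b.1) → G.Adj t w → w ∈ F) (h1 : 1 ≤ E.length) :
    E.length + 1 ≤ F.length + B.length := by
  obtain ⟨k1, k2, k3⟩ := h.sep E F hE hEF hEB hFB hEN hSN
  have := tough_iso h.cx.tough _ _ k1 k2 k3 (by simp; omega)
  have hS := Sg_len B
  simp at this
  omega

theorem Cf.t2 (h : Cf G x B) (E F : List V) (hE : E.Nodup) (hEF : ∀ v ∈ E, v ∉ F)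
    (hEB : ∀ v ∈ E, ∃ b ∈ B, v ∈ b.1)
    (hFB : ∀ v ∈ F, ∃ b ∈ B, v ∈ b.1)
    (hEN : ∀ v ∈ E, ∀ w, G.Adj v w → w ∈ F ∨ w ∈ As B)
    (hSN : ∀ t ∈ Sg B, ∀ w, (∃ b ∈ B, w ∈ b.1) → G.Adj t w → w ∈ F) (q : V) (hq : ∃ b ∈ B, q ∈ b.1)
    (hqE : q ∉ E) (hqF : q ∉ F) :
    E.length + 2 ≤ F.length + B.length := by
  obtain ⟨k1, k2, k3⟩ := h.sep E F hE hEF hEB hFB hEN hSN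
  have hxn := h.xN
  have hqx : q ≠ x := by
    rintro rfl
    obtain ⟨b, hb, k⟩ := hq
    exact hxn.2.2 b hb k
  have := tough_iso2 h.cx.tough _ _ k1 k2 k3 (by simp) q (by simp [hqx, hqE, h.bS hq])
    (by simp [hqF, h.bA hq])
  have hS := Sg_len B
  simp at this
  omega

theorem Cf.t3 (h : Cf G x B) (hSN : ∀ t ∈ Sg B, ∀ w, (∃ b ∈ B, w ∈ b.1) → ¬ G.Adj t w)
    (P : V → Prop) (p q : V)
    (hP : ∀ u v, u ∉ As B → v ∉ As B → u ∉ Sg B → v ∉ Sg B → u ≠ x → v ≠ x → G.Adj u v → P u → P v)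
    (hp : P p) (hq : ¬ P q) (hpB : ∃ b ∈ B, p ∈ b.1) (hqB : ∃ b ∈ B, q ∈ b.1) : 3 ≤ B.length := by
  obtain ⟨k1, k2, k3⟩ := h.sep [] [] (by simp) (by simp) (by simp) (by simp) (by simp)
    (fun t ht w hw e => absurd e (hSN t ht w hw))
  have hxn := h.xN
  have hne : ∀ q, (∃ b ∈ B, q ∈ b.1) → q ≠ x := by
    rintro q ⟨b, hb, k⟩ rfl
    exact hxn.2.2 b hb k
  have := tough_iso3 h.cx.tough _ _ P k1 k2 k3 (by
      intro u v a1 a2 a3 a4 a5 a6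
      simp at a1 a2 a3 a4
      exact hP u v a1 a2 a3.2 a4.2 a3.1 a4.1 a5 a6) p q hp hq (by simp [h.bA hpB])
    (by simp [h.bA hqB]) (by simp [h.bS hpB, hne p hpB]) (by simp [h.bS hqB, hne q hqB])
  have hS := Sg_len B
  simp at this
  omega

/-- one segment of length two -/
theorem Cf.e2 {p1 p2 a : V} {M : List (V × V)} (h : Cf G x [([p1, p2], M, a)]) : False := by
  have := h.t2 [] [] (by simp) (by simp) (by simp) (by simp) (by simp)
    (by
      intro t ht w hw e
      have h1 := h.sh t ht [p1, p2] (by simp) p1 _ (Or.inl rfl)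
      have h2 := h.sh t ht [p1, p2] (by simp) p2 _ (Or.inr rfl)
      simp at hw
      rcases hw with rfl | rfl
      · exact absurd e h1
      · exact absurd e h2) p1 (by simp) (by simp) (by simp)
  simp at this

/-- one segment of length three -/
theorem Cf.e3 {p1 p2 p3 a : V} {M : List (V × V)} (h : Cf G x [([p1, p2, p3], M, a)]) :
    False := by
  have h1 : ∀ t ∈ Sg [([p1, p2, p3], M, a)], ¬ G.Adj t p1 := fun t ht =>
    h.sh t ht [p1, p2, p3] (by simp) p1 _ (Or.inl rfl)
  have h3 : ∀ t ∈ Sg [([p1, p2, p3], M, a)], ¬ G.Adj t p3 := fun t ht =>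
    h.sh t ht [p1, p2, p3] (by simp) p3 _ (Or.inr rfl)
  have hnd := h.mx.1
  rw [fl_cons] at hnd
  simp at hnd
  by_cases hs : ∃ t ∈ Sg [([p1, p2, p3], M, a)], G.Adj t p2
  · obtain ⟨t, ht, htp⟩ := hs
    have m1 := h.h2 t ht [p1, p2, p3] (by simp) p1 p2 [p3] (Or.inl rfl) htp
    have m3 := h.h2 t ht [p1, p2, p3] (by simp) p3 p2 [p1] (Or.inr rfl) htp
    have n13 := m1.2 p3 [] rfl
    have := h.t1 [p1, p3] [p2] (by simp [hnd]) (by simp [hnd, Ne.symm]) (by simp) (by simp)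
      (by
        intro v hv w e
        have hvm : Ms G x (fl [([p1, p2, p3], M, a)]) v := by
          simp at hv
          rcases hv with rfl | rfl
          · exact m1.1
          · exact m3.1
        have hvB : ∃ b ∈ [([p1, p2, p3], M, a)], v ∈ b.1 := by simp at hv ⊢; tauto
        rcases h.nbr hvm (h.bA hvB) e with k | k | k
        · exact Or.inr k
        · simp at hv
          rcases hv with rfl | rfl
          · exact absurd e.symm (h1 w k)
          · exact absurd e.symm (h3 w k)
        · left
          simp at hv k ⊢
          rcases hv with rfl | rfl <;> rcases k with rfl | rfl | rfl
          · exact absurd rfl e.ne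
          · rfl
          · exact absurd e n13
          · exact absurd e.symm n13
          · rfl
          · exact absurd rfl e.ne)
      (by
        intro t ht w hw e
        simp at hw ⊢
        rcases hw with rfl | rfl | rfl
        · exact absurd e (h1 t ht)
        · rfl
        · exact absurd e (h3 t ht)) (by simp)
    simp at this
  · push Not at hs
    have := h.t2 [] [] (by simp) (by simp) (by simp) (by simp) (by simp)
      (by
        intro t ht w hw e
        simp at hw
        rcases hw with rfl | rfl | rfl
        · exact absurd e (h1 t ht)
        · exact absurd e (hs t ht)
        · exact absurd e (h3 t ht)) p1 (by simp) (by simp) (by simp)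
    simp at this

end
end HT

namespace HT
set_option linter.unusedSectionVars false
set_option linter.unusedSimpArgs false
variable {V : Type u} {G : SimpleGraph V}
section
variable [Fintype V] [DecidableEq V] [DecidableRel G.Adj] {x : V}

attribute [local simp] fl_cons fl_nil chW chR chE chS hd_split hd_nil Wp_nil Wp_split cnt_cons
  Xw_split

/-- A cycle which is too long, missing one vertex `t` of the longest one. -/
theorem Cf.no2 {B : List (Bk V)} (h : Cf G x B) {v y : V} {l : List V} (t : V) (hv : v ∉ fl B)
    (hvx : v ≠ x) (hc : (y :: (l ++ [y])).IsChain G.Adj)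
    (hp : ∀ z, (t :: y :: l).count z = ind x z + (ind v z + (fl B).count z)) : False := by
  have hp' : (t :: y :: l).Perm (v :: x :: fl B) := perm_of_cnt fun z => by
    rw [hp]; simp only [cnt_cons]; omega
  have hnd : (t :: y :: l).Nodup := hp'.nodup_iff.2 (by simp [hv, hvx, h.hx, h.mx.1])
  have := h.mx.2.2 (y :: l) (List.nodup_cons.1 hnd).2 (cyc_of_chain (x := y) (l := l) hc)
  have hl := hp'.length_eq
  simp at hl this
  omega

theorem Cf.no3 {B : List (Bk V)} (h : Cf G x B) {v y : V} {l : List V} (hv : v ∉ fl B)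
    (hvx : v ≠ x) (hc : (y :: (l ++ [y])).IsChain G.Adj)
    (hp : ∀ z, (y :: l).count z = ind x z + (ind v z + (fl B).count z)) : False := by
  have hp' : (y :: l).Perm (v :: x :: fl B) := perm_of_cnt fun z => by
    rw [hp]; simp only [cnt_cons]; omega
  have hnd : (y :: l).Nodup := hp'.nodup_iff.2 (by simp [hv, hvx, h.hx, h.mx.1])
  have := h.mx.2.2 (y :: l) hnd (cyc_of_chain (x := y) (l := l) hc)
  have hl := hp'.length_eq
  simp at hl this
  omega

theorem Cf.k22m {b1 c1 a2 b2 c2 a1 : V} {M1 M2 : List (V × V)}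
    (h : Cf G x [([b1, c1], M1, a2), ([b2, c2], M2, a1)])
    (e1 : G.Adj b1 c2) : Ms G x (fl [([b1, c1], M1, a2), ([b2, c2], M2, a1)]) c1 := by
  have hch := h.chain
  have hxw := h.xw
  simp at hch hxw
  cases_type* And
  refine h.ms c1 (y := x)
    (l := Wp M1 a2 ++ (b2 :: c2 :: b1 :: (Wp M2 a1).reverse)) ?_ (fun z => ?_)
  · simp
    repeat' apply And.intro
    all_goals
      first
      | assumption
      | exact SimpleGraph.Adj.symm (by assumption)
      | exact Xw.hd (by assumption)
      | exact Xw.last (by assumption)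
      | exact (Xw.hd (by assumption)).symm
      | exact (Xw.last (by assumption)).symm
  · simp; omega

theorem Cf.k22a {b1 c1 a2 α t b2 c2 a1 : V} {N1 N2 M2 : List (V × V)}
    (h : Cf G x [([b1, c1], N1 ++ (α, t) :: N2, a2), ([b2, c2], M2, a1)])
    (e1 : G.Adj b1 c2) (e2 : G.Adj c1 α) (e3 : G.Adj t a1) : False := by
  have hch := h.chain
  have hxw := h.xw
  simp at hch hxw
  cases_type* And
  refine h.no (y := c1)
    (l := (Wp N1 α).reverse ++ (x :: (Wp M2 a1 ++ (t :: (Wp N2 a2 ++ [b2, c2, b1]))))) ?_ (fun z => ?_)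
  · simp
    repeat' apply And.intro
    all_goals
      first
      | assumption
      | exact SimpleGraph.Adj.symm (by assumption)
      | exact Xw.hd (by assumption)
      | exact Xw.last (by assumption)
      | exact (Xw.hd (by assumption)).symm
      | exact (Xw.last (by assumption)).symm
  · simp; omega

theorem Cf.k22b {b1 c1 a2 b2 c2 a1 γ t : V} {M1 N1 N2 : List (V × V)}
    (h : Cf G x [([b1, c1], M1, a2), ([b2, c2], N1 ++ (γ, t) :: N2, a1)])
    (e1 : G.Adj b1 c2) (e2 : G.Adj c1 (hd N2 a1)) (e3 : G.Adj t a1) : False := by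
  have hch := h.chain
  have hxw := h.xw
  simp at hch hxw
  cases_type* And
  refine h.no (y := c1)
    (l := b1 :: (c2 :: (b2 :: ((Wp M1 a2).reverse ++ (x :: (Wp N1 γ ++ (t :: (Wp N2 a1).reverse))))))) ?_ (fun z => ?_)
  · simp
    repeat' apply And.intro
    all_goals
      first
      | assumption
      | exact SimpleGraph.Adj.symm (by assumption)
      | exact Xw.hd (by assumption)
      | exact Xw.last (by assumption)
      | exact (Xw.hd (by assumption)).symm
      | exact (Xw.last (by assumption)).symm
  · simp; omega

theorem Cf.k22c {b1 c1 a2 b2 c2 a1 : V} {M1 M2 : List (V × V)}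
    (h : Cf G x [([b1, c1], M1, a2), ([b2, c2], M2, a1)])
    (e1 : G.Adj b1 c2) (e2 : G.Adj c1 (hd M2 a1)) : False := by
  have hch := h.chain
  have hxw := h.xw
  simp at hch hxw
  cases_type* And
  refine h.no (y := c1)
    (l := b1 :: (c2 :: (b2 :: ((Wp M1 a2).reverse ++ (x :: (Wp M2 a1).reverse))))) ?_ (fun z => ?_)
  · simp
    repeat' apply And.intro
    all_goals
      first
      | assumption
      | exact SimpleGraph.Adj.symm (by assumption)
      | exact Xw.hd (by assumption)
      | exact Xw.last (by assumption)
      | exact (Xw.hd (by assumption)).symm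
      | exact (Xw.last (by assumption)).symm
  · simp; omega

theorem Cf.k22e {b1 c1 a2 b2 c2 a1 : V} {M1 M2 : List (V × V)}
    (h : Cf G x [([b1, c1], M1, a2), ([b2, c2], M2, a1)])
    (e1 : G.Adj b1 c2) (e2 : G.Adj c1 a2) (e3 : G.Adj c1 b2) : False := by
  have hch := h.chain
  have hxw := h.xw
  simp at hch hxw
  cases_type* And
  refine h.no (y := x)
    (l := Wp M1 a2 ++ (c1 :: b2 :: c2 :: b1 :: (Wp M2 a1).reverse)) ?_ (fun z => ?_)
  · simp
    repeat' apply And.intro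
    all_goals
      first
      | assumption
      | exact SimpleGraph.Adj.symm (by assumption)
      | exact Xw.hd (by assumption)
      | exact Xw.last (by assumption)
      | exact (Xw.hd (by assumption)).symm
      | exact (Xw.last (by assumption)).symm
  · simp; omega

theorem Cf.k22f {b1 c1 a2 b2 c2 a1 v : V} {M1 M2 : List (V × V)}
    (h : Cf G x [([b1, c1], M1, a2), ([b2, c2], M2, a1)])
    (hv : v ∉ fl [([b1, c1], M1, a2), ([b2, c2], M2, a1)]) (hvx : v ≠ x)
    (e1 : G.Adj v b1) (e2 : G.Adj v b2) : False := by
  have hch := h.chain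
  have hxw := h.xw
  simp at hch hxw
  cases_type* And
  refine h.no3 hv hvx (y := v)
    (l := b1 :: (c1 :: (Wp M1 a2 ++ (x :: ((Wp M2 a1).reverse ++ [c2, b2]))))) ?_ (fun z => ?_)
  · simp
    repeat' apply And.intro
    all_goals
      first
      | assumption
      | exact SimpleGraph.Adj.symm (by assumption)
      | exact Xw.hd (by assumption)
      | exact Xw.last (by assumption)
      | exact (Xw.hd (by assumption)).symm
      | exact (Xw.last (by assumption)).symm
  · simp; omega

theorem Cf.k22g {b1 c1 a2 b2 c2 a1 v : V} {M1 M2 : List (V × V)}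
    (h : Cf G x [([b1, c1], M1, a2), ([b2, c2], M2, a1)])
    (hv : v ∉ fl [([b1, c1], M1, a2), ([b2, c2], M2, a1)]) (hvx : v ≠ x)
    (e1 : G.Adj v c1) (e2 : G.Adj v c2) : False := by
  have hch := h.chain
  have hxw := h.xw
  simp at hch hxw
  cases_type* And
  refine h.no3 hv hvx (y := v)
    (l := c1 :: (b1 :: ((Wp M2 a1).reverse ++ (x :: (Wp M1 a2 ++ [b2, c2]))))) ?_ (fun z => ?_)
  · simp
    repeat' apply And.intro
    all_goals
      first
      | assumption
      | exact SimpleGraph.Adj.symm (by assumption)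
      | exact Xw.hd (by assumption)
      | exact Xw.last (by assumption)
      | exact (Xw.hd (by assumption)).symm
      | exact (Xw.last (by assumption)).symm
  · simp; omega

theorem Cf.k22h {b1 c1 a2 b2 c2 a1 v : V} {M1 M2 : List (V × V)}
    (h : Cf G x [([b1, c1], M1, a2), ([b2, c2], M2, a1)])
    (hv : v ∉ fl [([b1, c1], M1, a2), ([b2, c2], M2, a1)]) (hvx : v ≠ x)
    (e1 : G.Adj v b1) (e2 : G.Adj v c2) : False := by
  have hch := h.chain
  have hxw := h.xw
  simp at hch hxw
  cases_type* And
  refine h.no2 c1 hv hvx (y := x)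
    (l := Wp M1 a2 ++ (b2 :: c2 :: v :: b1 :: (Wp M2 a1).reverse)) ?_ (fun z => ?_)
  · simp
    repeat' apply And.intro
    all_goals
      first
      | assumption
      | exact SimpleGraph.Adj.symm (by assumption)
      | exact Xw.hd (by assumption)
      | exact Xw.last (by assumption)
      | exact (Xw.hd (by assumption)).symm
      | exact (Xw.last (by assumption)).symm
  · simp; omega

theorem Cf.k4a {p1 p2 p3 p4 a α s : V} {N1 N2 : List (V × V)}
    (h : Cf G x [([p1, p2, p3, p4], N1 ++ (α, s) :: N2, a)])
    (e1 : G.Adj s p2) (e2 : G.Adj s p3) : False := by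
  have hch := h.chain
  have hxw := h.xw
  simp at hch hxw
  cases_type* And
  refine h.no (y := p1)
    (l := p2 :: (s :: (p3 :: (p4 :: (Wp N1 α ++ (x :: Wp N2 a)))))) ?_ (fun z => ?_)
  · simp
    repeat' apply And.intro
    all_goals
      first
      | assumption
      | exact SimpleGraph.Adj.symm (by assumption)
      | exact Xw.hd (by assumption)
      | exact Xw.last (by assumption)
      | exact (Xw.hd (by assumption)).symm
      | exact (Xw.last (by assumption)).symm
  · simp; omega

theorem Cf.k4b {p1 p2 p3 p4 a α s γ t : V} {N1 N2 N3 : List (V × V)}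
    (h : Cf G x [([p1, p2, p3, p4], N1 ++ (α, s) :: (N2 ++ (γ, t) :: N3), a)])
    (e1 : G.Adj s p2) (e2 : G.Adj t p3) : False := by
  have hch := h.chain
  have hxw := h.xw
  simp at hch hxw
  cases_type* And
  refine h.no (y := p1)
    (l := p2 :: (s :: (Wp N2 γ ++ (t :: (p3 :: (p4 :: (Wp N1 α ++ (x :: Wp N3 a)))))))) ?_ (fun z => ?_)
  · simp
    repeat' apply And.intro
    all_goals
      first
      | assumption
      | exact SimpleGraph.Adj.symm (by assumption)
      | exact Xw.hd (by assumption)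
      | exact Xw.last (by assumption)
      | exact (Xw.hd (by assumption)).symm
      | exact (Xw.last (by assumption)).symm
  · simp; omega

theorem Cf.k4c {p1 p2 p3 p4 a α t γ s : V} {N1 N2 N3 : List (V × V)}
    (h : Cf G x [([p1, p2, p3, p4], N1 ++ (α, t) :: (N2 ++ (γ, s) :: N3), a)])
    (e1 : G.Adj s p2) (e2 : G.Adj t p3) : False := by
  have hch := h.chain
  have hxw := h.xw
  simp at hch hxw
  cases_type* And
  refine h.no (y := p1)
    (l := p2 :: (s :: ((Wp N2 γ).reverse ++ (t :: (p3 :: (p4 :: (Wp N1 α ++ (x :: Wp N3 a)))))))) ?_ (fun z => ?_)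
  · simp
    repeat' apply And.intro
    all_goals
      first
      | assumption
      | exact SimpleGraph.Adj.symm (by assumption)
      | exact Xw.hd (by assumption)
      | exact Xw.last (by assumption)
      | exact (Xw.hd (by assumption)).symm
      | exact (Xw.last (by assumption)).symm
  · simp; omega

theorem Cf.k4e {p1 p2 p3 p4 a α s : V} {N1 N2 : List (V × V)}
    (h : Cf G x [([p1, p2, p3, p4], N1 ++ (α, s) :: N2, a)])
    (e1 : G.Adj p1 p4) (e2 : G.Adj s p2) (e3 : G.Adj p1 α) : False := by
  have hch := h.chain
  have hxw := h.xw
  simp at hch hxw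
  cases_type* And
  refine h.no (y := p1)
    (l := (Wp N1 α).reverse ++ (x :: ((Wp N2 a).reverse ++ [s, p2, p3, p4]))) ?_ (fun z => ?_)
  · simp
    repeat' apply And.intro
    all_goals
      first
      | assumption
      | exact SimpleGraph.Adj.symm (by assumption)
      | exact Xw.hd (by assumption)
      | exact Xw.last (by assumption)
      | exact (Xw.hd (by assumption)).symm
      | exact (Xw.last (by assumption)).symm
  · simp; omega

theorem Cf.k4f {p1 p2 p3 p4 a α s γ t : V} {N1 N2 N3 : List (V × V)}
    (h : Cf G x [([p1, p2, p3, p4], N1 ++ (α, s) :: (N2 ++ (γ, t) :: N3), a)])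
    (e1 : G.Adj p1 p4) (e2 : G.Adj s p2) (e3 : G.Adj t (hd N1 α)) (e4 : G.Adj p1 (hd N3 a)) : False := by
  have hch := h.chain
  have hxw := h.xw
  simp at hch hxw
  cases_type* And
  refine h.no (y := p1)
    (l := Wp N3 a ++ (x :: ((Wp N1 α).reverse ++ (t :: ((Wp N2 γ).reverse ++ [s, p2, p3, p4]))))) ?_ (fun z => ?_)
  · simp
    repeat' apply And.intro
    all_goals
      first
      | assumption
      | exact SimpleGraph.Adj.symm (by assumption)
      | exact Xw.hd (by assumption)
      | exact Xw.last (by assumption)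
      | exact (Xw.hd (by assumption)).symm
      | exact (Xw.last (by assumption)).symm
  · simp; omega

theorem Cf.k4g {p1 p2 p3 p4 a β t α s : V} {N1 N2 N3 : List (V × V)}
    (h : Cf G x [([p1, p2, p3, p4], N1 ++ (β, t) :: (N2 ++ (α, s) :: N3), a)])
    (e1 : G.Adj p1 p4) (e2 : G.Adj s p2) (e3 : G.Adj t (hd N1 β)) (e4 : G.Adj p1 β) : False := by
  have hch := h.chain
  have hxw := h.xw
  simp at hch hxw
  cases_type* And
  refine h.no (y := p1)
    (l := (Wp N1 β).reverse ++ (t :: (Wp N2 α ++ (x :: ((Wp N3 a).reverse ++ [s, p2, p3, p4]))))) ?_ (fun z => ?_)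
  · simp
    repeat' apply And.intro
    all_goals
      first
      | assumption
      | exact SimpleGraph.Adj.symm (by assumption)
      | exact Xw.hd (by assumption)
      | exact Xw.last (by assumption)
      | exact (Xw.hd (by assumption)).symm
      | exact (Xw.last (by assumption)).symm
  · simp; omega

theorem Cf.k32a {p1 p2 p3 a2 α s q1 q2 a1 : V} {N1 N2 M2 : List (V × V)}
    (h : Cf G x [([p1, p2, p3], N1 ++ (α, s) :: N2, a2), ([q1, q2], M2, a1)])
    (e1 : G.Adj p1 q2) (e2 : G.Adj s p2) : False := by
  have hch := h.chain
  have hxw := h.xw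
  simp at hch hxw
  cases_type* And
  refine h.no (y := s)
    (l := Wp N2 a2 ++ (q1 :: (q2 :: (p1 :: ((Wp M2 a1).reverse ++ (x :: ((Wp N1 α).reverse ++ [p3, p2]))))))) ?_ (fun z => ?_)
  · simp
    repeat' apply And.intro
    all_goals
      first
      | assumption
      | exact SimpleGraph.Adj.symm (by assumption)
      | exact Xw.hd (by assumption)
      | exact Xw.last (by assumption)
      | exact (Xw.hd (by assumption)).symm
      | exact (Xw.last (by assumption)).symm
  · simp; omega

theorem Cf.k32b {p1 p2 p3 a2 q1 q2 a1 α s : V} {M1 N1 N2 : List (V × V)}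
    (h : Cf G x [([p1, p2, p3], M1, a2), ([q1, q2], N1 ++ (α, s) :: N2, a1)])
    (e1 : G.Adj p1 q2) (e2 : G.Adj s p2) : False := by
  have hch := h.chain
  have hxw := h.xw
  simp at hch hxw
  cases_type* And
  refine h.no (y := s)
    (l := p2 :: (p3 :: (Wp M1 a2 ++ (q1 :: (q2 :: (p1 :: ((Wp N2 a1).reverse ++ (x :: Wp N1 α)))))))) ?_ (fun z => ?_)
  · simp
    repeat' apply And.intro
    all_goals
      first
      | assumption
      | exact SimpleGraph.Adj.symm (by assumption)
      | exact Xw.hd (by assumption)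
      | exact Xw.last (by assumption)
      | exact (Xw.hd (by assumption)).symm
      | exact (Xw.last (by assumption)).symm
  · simp; omega

theorem Cf.k32m {p1 p2 p3 a2 q1 q2 a1 : V} {M1 M2 : List (V × V)}
    (h : Cf G x [([p1, p2, p3], M1, a2), ([q1, q2], M2, a1)])
    (e1 : G.Adj p1 q2) : Ms G x (fl [([p1, p2, p3], M1, a2), ([q1, q2], M2, a1)]) q1 := by
  have hch := h.chain
  have hxw := h.xw
  simp at hch hxw
  cases_type* And
  refine h.ms q1 (y := x)
    (l := (Wp M2 a1).reverse ++ (q2 :: p1 :: p2 :: p3 :: Wp M1 a2)) ?_ (fun z => ?_)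
  · simp
    repeat' apply And.intro
    all_goals
      first
      | assumption
      | exact SimpleGraph.Adj.symm (by assumption)
      | exact Xw.hd (by assumption)
      | exact Xw.last (by assumption)
      | exact (Xw.hd (by assumption)).symm
      | exact (Xw.last (by assumption)).symm
  · simp; omega

theorem Cf.k32c {p1 p2 p3 a2 γ t q1 q2 a1 : V} {N1 M2 : List (V × V)}
    (h : Cf G x [([p1, p2, p3], N1 ++ (γ, t) :: [], a2), ([q1, q2], M2, a1)])
    (e1 : G.Adj p1 q2) (e2 : G.Adj t (hd M2 a1)) : False := by
  have hch := h.chain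
  have hxw := h.xw
  simp at hch hxw
  cases_type* And
  refine h.no (y := q1)
    (l := a2 :: (x :: ((Wp M2 a1).reverse ++ (t :: ((Wp N1 γ).reverse ++ [p3, p2, p1, q2]))))) ?_ (fun z => ?_)
  · simp
    repeat' apply And.intro
    all_goals
      first
      | assumption
      | exact SimpleGraph.Adj.symm (by assumption)
      | exact Xw.hd (by assumption)
      | exact Xw.last (by assumption)
      | exact (Xw.hd (by assumption)).symm
      | exact (Xw.last (by assumption)).symm
  · simp; omega

theorem Cf.k32d {p1 p2 p3 a2 q1 q2 a1 : V} {M2 : List (V × V)}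
    (h : Cf G x [([p1, p2, p3], [], a2), ([q1, q2], M2, a1)])
    (e1 : G.Adj p1 q2) (e2 : G.Adj q1 p3) : False := by
  have hch := h.chain
  have hxw := h.xw
  simp at hch hxw
  cases_type* And
  refine h.no (y := x)
    (l := (Wp M2 a1).reverse ++ [q2, p1, p2, p3, q1, a2]) ?_ (fun z => ?_)
  · simp
    repeat' apply And.intro
    all_goals
      first
      | assumption
      | exact SimpleGraph.Adj.symm (by assumption)
      | exact Xw.hd (by assumption)
      | exact Xw.last (by assumption)
      | exact (Xw.hd (by assumption)).symm
      | exact (Xw.last (by assumption)).symm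
  · simp; omega

theorem Cf.k32e {p1 p2 p3 a2 q1 q2 a1 α t : V} {N1 N2 : List (V × V)}
    (h : Cf G x [([p1, p2, p3], [], a2), ([q1, q2], N1 ++ (α, t) :: N2, a1)])
    (e1 : G.Adj p1 q2) (e2 : G.Adj q1 α) (e3 : G.Adj t (hd N1 α)) : False := by
  have hch := h.chain
  have hxw := h.xw
  simp at hch hxw
  cases_type* And
  refine h.no (y := q1)
    (l := (Wp N1 α).reverse ++ (t :: (Wp N2 a1 ++ [x, a2, p3, p2, p1, q2]))) ?_ (fun z => ?_)
  · simp
    repeat' apply And.intro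
    all_goals
      first
      | assumption
      | exact SimpleGraph.Adj.symm (by assumption)
      | exact Xw.hd (by assumption)
      | exact Xw.last (by assumption)
      | exact (Xw.hd (by assumption)).symm
      | exact (Xw.last (by assumption)).symm
  · simp; omega

theorem Cf.k32f {p1 p2 p3 a2 q1 q2 a1 : V} {M2 : List (V × V)}
    (h : Cf G x [([p1, p2, p3], [], a2), ([q1, q2], M2, a1)])
    (e1 : G.Adj p1 q2) (e2 : G.Adj q1 a1) : False := by
  have hch := h.chain
  have hxw := h.xw
  simp at hch hxw
  cases_type* And
  refine h.no (y := q1)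
    (l := (Wp M2 a1).reverse ++ [x, a2, p3, p2, p1, q2]) ?_ (fun z => ?_)
  · simp
    repeat' apply And.intro
    all_goals
      first
      | assumption
      | exact SimpleGraph.Adj.symm (by assumption)
      | exact Xw.hd (by assumption)
      | exact Xw.last (by assumption)
      | exact (Xw.hd (by assumption)).symm
      | exact (Xw.last (by assumption)).symm
  · simp; omega

theorem Cf.pm {b1 c1 a3 b3 c3 a2 b2 c2 a1 : V} {M1 M3 M2 : List (V × V)}
    (h : Cf G x [([b1, c1], M1, a3), ([b3, c3], M3, a2), ([b2, c2], M2, a1)])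
    (e1 : G.Adj b1 c2) : Ms G x (fl [([b1, c1], M1, a3), ([b3, c3], M3, a2), ([b2, c2], M2, a1)]) c1 := by
  have hch := h.chain
  have hxw := h.xw
  simp at hch hxw
  cases_type* And
  refine h.ms c1 (y := x)
    (l := Wp M1 a3 ++ (b3 :: (c3 :: (Wp M3 a2 ++ (b2 :: c2 :: b1 :: (Wp M2 a1).reverse))))) ?_ (fun z => ?_)
  · simp
    repeat' apply And.intro
    all_goals
      first
      | assumption
      | exact SimpleGraph.Adj.symm (by assumption)
      | exact Xw.hd (by assumption)
      | exact Xw.last (by assumption)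
      | exact (Xw.hd (by assumption)).symm
      | exact (Xw.last (by assumption)).symm
  · simp; omega

theorem Cf.pa {b1 c1 a3 α t b3 c3 a2 b2 c2 a1 : V} {N1 N2 M3 M2 : List (V × V)}
    (h : Cf G x [([b1, c1], N1 ++ (α, t) :: N2, a3), ([b3, c3], M3, a2), ([b2, c2], M2, a1)])
    (e1 : G.Adj b1 c2) (e2 : G.Adj c1 α) (e3 : G.Adj t a1) : False := by
  have hch := h.chain
  have hxw := h.xw
  simp at hch hxw
  cases_type* And
  refine h.no (y := c1)
    (l := (Wp N1 α).reverse ++ (x :: (Wp M2 a1 ++ (t :: (Wp N2 a3 ++ (b3 :: (c3 :: (Wp M3 a2 ++ [b2, c2, b1])))))))) ?_ (fun z => ?_)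
  · simp
    repeat' apply And.intro
    all_goals
      first
      | assumption
      | exact SimpleGraph.Adj.symm (by assumption)
      | exact Xw.hd (by assumption)
      | exact Xw.last (by assumption)
      | exact (Xw.hd (by assumption)).symm
      | exact (Xw.last (by assumption)).symm
  · simp; omega

theorem Cf.pb {b1 c1 a3 b3 c3 a2 α t b2 c2 a1 : V} {M1 N1 N2 M2 : List (V × V)}
    (h : Cf G x [([b1, c1], M1, a3), ([b3, c3], N1 ++ (α, t) :: N2, a2), ([b2, c2], M2, a1)])
    (e1 : G.Adj b1 c2) (e2 : G.Adj c1 α) (e3 : G.Adj t a1) : False := by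
  have hch := h.chain
  have hxw := h.xw
  simp at hch hxw
  cases_type* And
  refine h.no (y := c1)
    (l := (Wp N1 α).reverse ++ (c3 :: (b3 :: ((Wp M1 a3).reverse ++ (x :: (Wp M2 a1 ++ (t :: (Wp N2 a2 ++ [b2, c2, b1])))))))) ?_ (fun z => ?_)
  · simp
    repeat' apply And.intro
    all_goals
      first
      | assumption
      | exact SimpleGraph.Adj.symm (by assumption)
      | exact Xw.hd (by assumption)
      | exact Xw.last (by assumption)
      | exact (Xw.hd (by assumption)).symm
      | exact (Xw.last (by assumption)).symm
  · simp; omega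

theorem Cf.pc {b1 c1 a3 b3 c3 a2 b2 c2 a1 γ t : V} {M1 M3 N1 N2 : List (V × V)}
    (h : Cf G x [([b1, c1], M1, a3), ([b3, c3], M3, a2), ([b2, c2], N1 ++ (γ, t) :: N2, a1)])
    (e1 : G.Adj b1 c2) (e2 : G.Adj c1 (hd N2 a1)) (e3 : G.Adj t a1) : False := by
  have hch := h.chain
  have hxw := h.xw
  simp at hch hxw
  cases_type* And
  refine h.no (y := c1)
    (l := b1 :: (c2 :: (b2 :: ((Wp M3 a2).reverse ++ (c3 :: (b3 :: ((Wp M1 a3).reverse ++ (x :: (Wp N1 γ ++ (t :: (Wp N2 a1).reverse)))))))))) ?_ (fun z => ?_)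
  · simp
    repeat' apply And.intro
    all_goals
      first
      | assumption
      | exact SimpleGraph.Adj.symm (by assumption)
      | exact Xw.hd (by assumption)
      | exact Xw.last (by assumption)
      | exact (Xw.hd (by assumption)).symm
      | exact (Xw.last (by assumption)).symm
  · simp; omega

theorem Cf.pd {b1 c1 a3 b3 c3 a2 b2 c2 a1 : V} {M1 M3 M2 : List (V × V)}
    (h : Cf G x [([b1, c1], M1, a3), ([b3, c3], M3, a2), ([b2, c2], M2, a1)])
    (e1 : G.Adj b1 c2) (e2 : G.Adj c1 (hd M2 a1)) : False := by
  have hch := h.chain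
  have hxw := h.xw
  simp at hch hxw
  cases_type* And
  refine h.no (y := c1)
    (l := b1 :: (c2 :: (b2 :: ((Wp M3 a2).reverse ++ (c3 :: (b3 :: ((Wp M1 a3).reverse ++ (x :: (Wp M2 a1).reverse)))))))) ?_ (fun z => ?_)
  · simp
    repeat' apply And.intro
    all_goals
      first
      | assumption
      | exact SimpleGraph.Adj.symm (by assumption)
      | exact Xw.hd (by assumption)
      | exact Xw.last (by assumption)
      | exact (Xw.hd (by assumption)).symm
      | exact (Xw.last (by assumption)).symm
  · simp; omega

theorem Cf.pf {b1 c1 a3 b3 c3 a2 b2 c2 a1 : V} {M1 M3 M2 : List (V × V)}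
    (h : Cf G x [([b1, c1], M1, a3), ([b3, c3], M3, a2), ([b2, c2], M2, a1)])
    (e1 : G.Adj b1 c2) (e2 : G.Adj c1 b3) : False := by
  have hch := h.chain
  have hxw := h.xw
  simp at hch hxw
  cases_type* And
  refine h.no (y := c1)
    (l := b3 :: (c3 :: (Wp M3 a2 ++ (b2 :: (c2 :: (b1 :: ((Wp M2 a1).reverse ++ (x :: (Wp M1 a3).reverse)))))))) ?_ (fun z => ?_)
  · simp
    repeat' apply And.intro
    all_goals
      first
      | assumption
      | exact SimpleGraph.Adj.symm (by assumption)
      | exact Xw.hd (by assumption)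
      | exact Xw.last (by assumption)
      | exact (Xw.hd (by assumption)).symm
      | exact (Xw.last (by assumption)).symm
  · simp; omega

theorem Cf.pg {b1 c1 a3 b3 c3 a2 b2 c2 a1 : V} {M1 M3 M2 : List (V × V)}
    (h : Cf G x [([b1, c1], M1, a3), ([b3, c3], M3, a2), ([b2, c2], M2, a1)])
    (e1 : G.Adj b1 c2) (e2 : G.Adj c1 a2) (e3 : G.Adj c1 b2) : False := by
  have hch := h.chain
  have hxw := h.xw
  simp at hch hxw
  cases_type* And
  refine h.no (y := x)
    (l := Wp M1 a3 ++ (b3 :: (c3 :: (Wp M3 a2 ++ (c1 :: b2 :: c2 :: b1 :: (Wp M2 a1).reverse))))) ?_ (fun z => ?_)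
  · simp
    repeat' apply And.intro
    all_goals
      first
      | assumption
      | exact SimpleGraph.Adj.symm (by assumption)
      | exact Xw.hd (by assumption)
      | exact Xw.last (by assumption)
      | exact (Xw.hd (by assumption)).symm
      | exact (Xw.last (by assumption)).symm
  · simp; omega

theorem Cf.nm {b1 c1 a2 b2 c2 a3 b3 c3 a1 : V} {M1 M2 M3 : List (V × V)}
    (h : Cf G x [([b1, c1], M1, a2), ([b2, c2], M2, a3), ([b3, c3], M3, a1)])
    (e1 : G.Adj b1 c2) : Ms G x (fl [([b1, c1], M1, a2), ([b2, c2], M2, a3), ([b3, c3], M3, a1)]) c1 := by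
  have hch := h.chain
  have hxw := h.xw
  simp at hch hxw
  cases_type* And
  refine h.ms c1 (y := x)
    (l := Wp M1 a2 ++ (b2 :: (c2 :: (b1 :: ((Wp M3 a1).reverse ++ (c3 :: b3 :: (Wp M2 a3).reverse)))))) ?_ (fun z => ?_)
  · simp
    repeat' apply And.intro
    all_goals
      first
      | assumption
      | exact SimpleGraph.Adj.symm (by assumption)
      | exact Xw.hd (by assumption)
      | exact Xw.last (by assumption)
      | exact (Xw.hd (by assumption)).symm
      | exact (Xw.last (by assumption)).symm
  · simp; omega

theorem Cf.na {b1 c1 a2 α t b2 c2 a3 b3 c3 a1 : V} {N1 N2 M2 M3 : List (V × V)}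
    (h : Cf G x [([b1, c1], N1 ++ (α, t) :: N2, a2), ([b2, c2], M2, a3), ([b3, c3], M3, a1)])
    (e1 : G.Adj b1 c2) (e2 : G.Adj c1 α) (e3 : G.Adj t a1) : False := by
  have hch := h.chain
  have hxw := h.xw
  simp at hch hxw
  cases_type* And
  refine h.no (y := c1)
    (l := (Wp N1 α).reverse ++ (x :: (Wp M2 a3 ++ (b3 :: (c3 :: (Wp M3 a1 ++ (t :: (Wp N2 a2 ++ [b2, c2, b1])))))))) ?_ (fun z => ?_)
  · simp
    repeat' apply And.intro
    all_goals
      first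
      | assumption
      | exact SimpleGraph.Adj.symm (by assumption)
      | exact Xw.hd (by assumption)
      | exact Xw.last (by assumption)
      | exact (Xw.hd (by assumption)).symm
      | exact (Xw.last (by assumption)).symm
  · simp; omega

theorem Cf.nb {b1 c1 a2 b2 c2 a3 b3 c3 a1 γ t : V} {M1 M2 N1 N2 : List (V × V)}
    (h : Cf G x [([b1, c1], M1, a2), ([b2, c2], M2, a3), ([b3, c3], N1 ++ (γ, t) :: N2, a1)])
    (e1 : G.Adj b1 c2) (e2 : G.Adj c1 (hd N2 a1)) (e3 : G.Adj t a1) : False := by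
  have hch := h.chain
  have hxw := h.xw
  simp at hch hxw
  cases_type* And
  refine h.no (y := c1)
    (l := b1 :: (c2 :: (b2 :: ((Wp M1 a2).reverse ++ (x :: (Wp M2 a3 ++ (b3 :: (c3 :: (Wp N1 γ ++ (t :: (Wp N2 a1).reverse)))))))))) ?_ (fun z => ?_)
  · simp
    repeat' apply And.intro
    all_goals
      first
      | assumption
      | exact SimpleGraph.Adj.symm (by assumption)
      | exact Xw.hd (by assumption)
      | exact Xw.last (by assumption)
      | exact (Xw.hd (by assumption)).symm
      | exact (Xw.last (by assumption)).symm
  · simp; omega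

theorem Cf.nc {b1 c1 a2 b2 c2 a3 γ t b3 c3 a1 : V} {M1 N1 N2 M3 : List (V × V)}
    (h : Cf G x [([b1, c1], M1, a2), ([b2, c2], N1 ++ (γ, t) :: N2, a3), ([b3, c3], M3, a1)])
    (e1 : G.Adj b1 c2) (e2 : G.Adj c1 (hd N2 a3)) (e3 : G.Adj t a1) : False := by
  have hch := h.chain
  have hxw := h.xw
  simp at hch hxw
  cases_type* And
  refine h.no (y := c1)
    (l := b1 :: (c2 :: (b2 :: ((Wp M1 a2).reverse ++ (x :: (Wp N1 γ ++ (t :: ((Wp M3 a1).reverse ++ (c3 :: b3 :: (Wp N2 a3).reverse))))))))) ?_ (fun z => ?_)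
  · simp
    repeat' apply And.intro
    all_goals
      first
      | assumption
      | exact SimpleGraph.Adj.symm (by assumption)
      | exact Xw.hd (by assumption)
      | exact Xw.last (by assumption)
      | exact (Xw.hd (by assumption)).symm
      | exact (Xw.last (by assumption)).symm
  · simp; omega

theorem Cf.nd {b1 c1 a2 b2 c2 a3 b3 c3 a1 : V} {M1 M2 M3 : List (V × V)}
    (h : Cf G x [([b1, c1], M1, a2), ([b2, c2], M2, a3), ([b3, c3], M3, a1)])
    (e1 : G.Adj b1 c2) (e2 : G.Adj c1 (hd M2 a3)) : False := by
  have hch := h.chain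
  have hxw := h.xw
  simp at hch hxw
  cases_type* And
  refine h.no (y := c1)
    (l := b1 :: (c2 :: (b2 :: ((Wp M1 a2).reverse ++ (x :: ((Wp M3 a1).reverse ++ (c3 :: b3 :: (Wp M2 a3).reverse))))))) ?_ (fun z => ?_)
  · simp
    repeat' apply And.intro
    all_goals
      first
      | assumption
      | exact SimpleGraph.Adj.symm (by assumption)
      | exact Xw.hd (by assumption)
      | exact Xw.last (by assumption)
      | exact (Xw.hd (by assumption)).symm
      | exact (Xw.last (by assumption)).symm
  · simp; omega

theorem Cf.ne {b1 c1 a2 b2 c2 a3 b3 c3 a1 : V} {M1 M2 M3 : List (V × V)}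
    (h : Cf G x [([b1, c1], M1, a2), ([b2, c2], M2, a3), ([b3, c3], M3, a1)])
    (e1 : G.Adj b1 c2) (e2 : G.Adj c1 a2) (e3 : G.Adj c1 b2) : False := by
  have hch := h.chain
  have hxw := h.xw
  simp at hch hxw
  cases_type* And
  refine h.no (y := x)
    (l := Wp M1 a2 ++ (c1 :: (b2 :: (c2 :: (b1 :: ((Wp M3 a1).reverse ++ (c3 :: b3 :: (Wp M2 a3).reverse))))))) ?_ (fun z => ?_)
  · simp
    repeat' apply And.intro
    all_goals
      first
      | assumption
      | exact SimpleGraph.Adj.symm (by assumption)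
      | exact Xw.hd (by assumption)
      | exact Xw.last (by assumption)
      | exact (Xw.hd (by assumption)).symm
      | exact (Xw.last (by assumption)).symm
  · simp; omega

theorem Cf.nf {b1 c1 a2 b2 c2 a3 b3 c3 a1 : V} {M1 M2 M3 : List (V × V)}
    (h : Cf G x [([b1, c1], M1, a2), ([b2, c2], M2, a3), ([b3, c3], M3, a1)])
    (e1 : G.Adj b1 c2) (e2 : G.Adj c1 a1) : False := by
  have hch := h.chain
  have hxw := h.xw
  simp at hch hxw
  cases_type* And
  refine h.no (y := x)
    (l := Wp M1 a2 ++ (b2 :: (c2 :: (b1 :: (c1 :: ((Wp M3 a1).reverse ++ (c3 :: b3 :: (Wp M2 a3).reverse))))))) ?_ (fun z => ?_)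
  · simp
    repeat' apply And.intro
    all_goals
      first
      | assumption
      | exact SimpleGraph.Adj.symm (by assumption)
      | exact Xw.hd (by assumption)
      | exact Xw.last (by assumption)
      | exact (Xw.hd (by assumption)).symm
      | exact (Xw.last (by assumption)).symm
  · simp; omega

end
end HT

namespace HT
set_option linter.unusedSectionVars false
set_option linter.unusedSimpArgs false
variable {V : Type u} {G : SimpleGraph V}

theorem last_split (P : V → Prop) (M : List (V × V)) (h : ∃ t ∈ M.map Prod.snd, P t) :
    ∃ N1 α s N2, M = N1 ++ (α, s) :: N2 ∧ P s ∧ ∀ t ∈ N2.map Prod.snd, ¬ P t := by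
  induction M with
  | nil => simp at h
  | cons p M ih =>
    obtain ⟨α, s⟩ := p
    by_cases hM : ∃ t ∈ M.map Prod.snd, P t
    · obtain ⟨N1, β, t, N2, e, h1, h2⟩ := ih hM
      exact ⟨(α, s) :: N1, β, t, N2, by rw [e]; rfl, h1, h2⟩
    · push Not at hM
      refine ⟨[], α, s, M, rfl, ?_, hM⟩
      obtain ⟨t, ht, hP⟩ := h
      simp only [List.map_cons, List.mem_cons] at ht
      rcases ht with rfl | ht
      · exact hP
      · exact absurd hP (hM t ht)

theorem split_uniq {N1 N2 N1' N2' : List (V × V)} {α α' t : V}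
    (e : N1 ++ (α, t) :: N2 = N1' ++ (α', t) :: N2')
    (hnd : ((N1 ++ (α, t) :: N2).map Prod.snd).Nodup) : α = α' ∧ N2 = N2' := by
  induction N1 generalizing N1' with
  | nil =>
    cases N1' with
    | nil => simpa using e
    | cons p N1' =>
      simp only [List.nil_append, List.cons_append, List.cons.injEq] at e
      simp only [List.nil_append, List.map_cons, List.nodup_cons, e.2] at hnd
      exact absurd (by simp) hnd.1
  | cons q N1 ih =>
    cases N1' with
    | nil =>
      simp only [List.nil_append, List.cons_append, List.cons.injEq] at e
      simp only [List.cons_append, List.map_cons, List.nodup_cons, e.1] at hnd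
      exact absurd (by simp) hnd.1
    | cons p N1' =>
      simp only [List.cons_append, List.cons.injEq] at e
      simp only [List.cons_append, List.map_cons, List.nodup_cons] at hnd
      exact ih e.2 hnd.2

section
variable [Fintype V] [DecidableEq V] [DecidableRel G.Adj] {C : List V} {x : V}
  {B B' : List (Bk V)}

theorem Cf.full (h : Cf G x B) {t : V} (hd : G.degree x ≤ G.degree t)
    (hN : ∀ w, G.Adj t w → w ∈ As B) : ∀ w ∈ As B, G.Adj t w := by
  have hs : G.neighborFinset t ⊆ G.neighborFinset x := by
    intro w hw
    simp only [SimpleGraph.mem_neighborFinset] at hw ⊢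
    exact (h.nx w).2 (hN w hw)
  have := Finset.eq_of_subset_of_card_le hs (by simpa using hd)
  intro w hw
  have : w ∈ G.neighborFinset t := by
    rw [this]; simpa using (h.nx w).2 hw
  simpa using this

theorem Cf.dge (h : Cf G x B) {v : V} (hv : v ∈ Sg B ∨ ∃ b ∈ B, v ∈ b.1) :
    Fintype.card V ≤ G.degree v + G.degree x + 4 := by
  refine h.cx.sig v x ?_ ?_
  · rintro rfl
    rcases hv with hv | ⟨b, hb, hv⟩
    · exact h.xN.2.1 hv
    · exact h.xN.2.2 b hb hv
  · intro e
    have := (h.nx v).1 e.symm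
    rcases hv with hv | hv
    · exact h.sA hv this
    · exact h.bA hv this

/-- all segments have length at most two: the neighbours of singles are in `As` -/
theorem Cf.sN2 (h : Cf G x B) (h2 : ∀ b ∈ B, ∃ p q, b.1 = [p, q]) {t w : V} (ht : t ∈ Sg B)
    (e : G.Adj t w) : w ∈ As B := by
  rcases h.sN ht e with k | ⟨b, hb, hw⟩
  · exact k
  · obtain ⟨p, q, hpq⟩ := h2 b hb
    have k1 := h.sh t ht b.1 (List.mem_map_of_mem hb) p [q] (Or.inl hpq)
    have k2 := h.sh t ht b.1 (List.mem_map_of_mem hb) q [p] (Or.inr (by simp [hpq]))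
    rw [hpq] at hw
    simp at hw
    rcases hw with rfl | rfl
    · exact absurd e k1
    · exact absurd e k2

theorem Cf.e22e {b1 c1 b2 c2 a1 a2 : V} {M1 M2 : List (V × V)}
    (h : Cf G x [([b1, c1], M1, a2), ([b2, c2], M2, a1)]) (e1 : G.Adj b1 c2) : False := by
  have hcard : 2 * G.degree x + 3 ≤ Fintype.card V := by
    have h1 := h.len
    have h2 := h.lt
    simp at h1
    omega
  have hk := h.k4
  have hm := h.k22m e1
  have hS : Sg [([b1, c1], M1, a2), ([b2, c2], M2, a1)] = M1.map Prod.snd ++ M2.map Prod.snd := by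
    simp [Sg_cons, Sg_nil]
  have hA : As [([b1, c1], M1, a2), ([b2, c2], M2, a1)] =
      M1.map Prod.fst ++ a2 :: (M2.map Prod.fst ++ [a1]) := by
    simp [As_cons, As_nil]
  have hcS : ∀ t ∈ Sg [([b1, c1], M1, a2), ([b2, c2], M2, a1)], ¬ G.Adj t c1 := fun t ht =>
    h.sh t ht [b1, c1] (by simp) c1 [b1] (Or.inr rfl)
  have hcc : ¬ G.Adj c1 c2 := by
    have := h.hh
    simp at this
    exact (this.2 _ _ _ _ rfl rfl).1
  have hsN : ∀ t ∈ Sg [([b1, c1], M1, a2), ([b2, c2], M2, a1)], ∀ w, G.Adj t w →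
      w ∈ As [([b1, c1], M1, a2), ([b2, c2], M2, a1)] := fun t ht w e =>
    h.sN2 (by simp) ht e
  have hndS : (Sg [([b1, c1], M1, a2), ([b2, c2], M2, a1)]).Nodup :=
    (List.nodup_append.1 (List.nodup_append.1 h.nodup).2.1).1
  obtain ⟨z, hz⟩ : ∃ z, ∀ w, G.Adj c1 w → w = a2 ∨ w = b2 → w = z := by
    by_cases k : G.Adj c1 a2
    · refine ⟨a2, fun w hw e => ?_⟩
      rcases e with rfl | rfl
      · rfl
      · exact (h.k22e e1 k hw).elim
    · refine ⟨b2, fun w hw e => ?_⟩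
      rcases e with rfl | rfl
      · exact absurd hw k
      · rfl
  let Lk : V → V → Prop := fun t w => (∃ N1 N2, M1 = N1 ++ (w, t) :: N2) ∨
    ∃ N1 γ N2, M2 = N1 ++ (γ, t) :: N2 ∧ w = hd N2 a1
  have hcl : ∀ w, G.Adj c1 w → w = b1 ∨ w = z ∨
      ∃ t ∈ Sg [([b1, c1], M1, a2), ([b2, c2], M2, a1)], ¬ G.Adj t a1 ∧ Lk t w := by
    intro w hw
    rcases h.nbr hm (h.bA (by simp)) hw with k | k | k
    · rw [hA] at k
      simp only [List.mem_append, List.mem_cons, List.not_mem_nil, or_false] at k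
      rcases k with k | k | k
      · obtain ⟨N1, t, N2, rfl⟩ := mem_fst k
        right; right
        refine ⟨t, by rw [hS]; simp, fun e => h.k22a e1 hw e, Or.inl ⟨N1, N2, rfl⟩⟩
      · exact Or.inr (Or.inl (hz w hw (Or.inl k)))
      · rcases mem_pre k with k | ⟨N1, γ, t, N2, rfl, rfl⟩
        · subst k; exact (h.k22c e1 hw).elim
        · right; right
          exact ⟨t, by rw [hS]; simp, fun e => h.k22b e1 hw e, Or.inr ⟨N1, γ, N2, rfl, rfl⟩⟩
    · exact absurd hw.symm (hcS w k)
    · simp at k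
      rcases k with (rfl | rfl) | (rfl | rfl)
      · exact Or.inl rfl
      · exact absurd rfl hw.ne
      · exact Or.inr (Or.inl (hz _ hw (Or.inr rfl)))
      · exact absurd hw hcc
  by_cases hb : ∃ t ∈ Sg [([b1, c1], M1, a2), ([b2, c2], M2, a1)], ¬ G.Adj t a1
  · obtain ⟨t0, ht0, hta⟩ := hb
    have hlow : ∀ t ∈ Sg [([b1, c1], M1, a2), ([b2, c2], M2, a1)], ¬ G.Adj t a1 →
        G.degree t + 1 ≤ G.degree x := by
      intro t ht hn
      have := deg_le_list (G := G) t ((As [([b1, c1], M1, a2), ([b2, c2], M2, a1)]).erase a1) (by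
        intro w hw
        rw [List.mem_erase_of_ne (by rintro rfl; exact hn hw)]
        exact hsN t ht w hw)
      rw [List.length_erase_of_mem (by rw [hA]; simp), ← h.deg] at this
      omega
    have huni : ∀ t ∈ Sg [([b1, c1], M1, a2), ([b2, c2], M2, a1)], ¬ G.Adj t a1 → t = t0 := by
      intro t ht hn
      by_contra hne
      have := h.cx.sig t t0 hne (h.ss t ht t0 ht0)
      have := hlow t ht hn
      have := hlow t0 ht0 hta
      omega
    have hd1 := h.cx.sig t0 c1 (by
      rintro rfl
      exact h.bS (by simp) ht0) (hcS t0 ht0)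
    have hd2 := hlow t0 ht0 hta
    have hLu : ∀ w w', Lk t0 w → Lk t0 w' → w = w' := by
      rw [hS, List.nodup_append] at hndS
      rintro w w' (⟨N1, N2, e⟩ | ⟨N1, γ, N2, e, rfl⟩) (⟨N1', N2', e'⟩ | ⟨N1', γ', N2', e', rfl⟩)
      · subst e
        exact (split_uniq e' hndS.1).1
      · exact absurd rfl (hndS.2.2 t0 (by simp [e]) t0 (by simp [e']))
      · exact absurd rfl (hndS.2.2 t0 (by simp [e']) t0 (by simp [e]))
      · subst e
        rw [(split_uniq e' hndS.2.1).2]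
    have hex : ∃ w0, ∀ w, Lk t0 w → w = w0 := by
      by_cases k : ∃ w, Lk t0 w
      · obtain ⟨w0, hw0⟩ := k
        exact ⟨w0, fun w hw => hLu w w0 hw hw0⟩
      · exact ⟨x, fun w hw => (k ⟨w, hw⟩).elim⟩
    obtain ⟨w0, hw0⟩ := hex
    have := deg_le_list (G := G) c1 [b1, z, w0] (by
      intro w hw
      simp only [List.mem_cons, List.not_mem_nil, or_false]
      rcases hcl w hw with k | k | ⟨t, ht, hn, hl⟩
      · exact Or.inl k
      · exact Or.inr (Or.inl k)
      · have := huni t ht hn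
        subst this
        exact Or.inr (Or.inr (hw0 w hl)))
    simp at this
    omega
  · push Not at hb
    have := deg_le_list (G := G) c1 [b1, z] (by
      intro w hw
      simp only [List.mem_cons, List.not_mem_nil, or_false]
      rcases hcl w hw with k | k | ⟨t, ht, hn, hl⟩
      · exact Or.inl k
      · exact Or.inr k
      · exact absurd (hb t ht) hn)
    have hd := h.dge (v := c1) (Or.inr (by simp))
    simp at this
    omega

/-- two segments of length two -/
theorem Cf.e22 {b1 c1 b2 c2 a1 a2 : V} {M1 M2 : List (V × V)}
    (h : Cf G x [([b1, c1], M1, a2), ([b2, c2], M2, a1)]) : False := by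
  have h' : Cf G x [([b2, c2], M2, a1), ([b1, c1], M1, a2)] :=
    Cf.rot (B1 := [([b1, c1], M1, a2)]) (B2 := [([b2, c2], M2, a1)]) h
  by_cases e1 : G.Adj b1 c2
  · exact h.e22e e1
  by_cases e2 : G.Adj b2 c1
  · exact h'.e22e e2
  have hnd := h.mx.1
  rw [fl_cons, fl_cons] at hnd
  simp at hnd
  have hbb : ¬ G.Adj b1 b2 ∧ ¬ G.Adj c1 c2 := by
    have := h.hh
    simp at this
    exact ⟨(this.1 _ _ _ _ rfl rfl).1, (this.2 _ _ _ _ rfl rfl).1⟩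
  have hcase : ∀ u, u ∉ As [([b1, c1], M1, a2), ([b2, c2], M2, a1)] →
      u ∉ Sg [([b1, c1], M1, a2), ([b2, c2], M2, a1)] → u ≠ x →
      (u = b1 ∨ u = c1) ∨ (u = b2 ∨ u = c2) ∨ u ∉ fl [([b1, c1], M1, a2), ([b2, c2], M2, a1)] := by
    intro u hu1 hu2 hux
    by_cases hu : u ∈ fl [([b1, c1], M1, a2), ([b2, c2], M2, a1)]
    · rw [h.mem] at hu
      rcases hu with k | k | k
      · exact absurd k hu1
      · exact absurd k hu2
      · simp at k
        rcases k with k | k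
        · exact Or.inl k
        · exact Or.inr (Or.inl k)
    · exact Or.inr (Or.inr hu)
  have hpfl : ∀ u, u ∈ fl [([b2, c2], M2, a1), ([b1, c1], M1, a2)] ↔
      u ∈ fl [([b1, c1], M1, a2), ([b2, c2], M2, a1)] := by
    intro u; simp [fl_cons, fl_nil]; tauto
  have hO : ∀ v, v ∉ fl [([b1, c1], M1, a2), ([b2, c2], M2, a1)] → v ≠ x →
      (G.Adj v b1 ∨ G.Adj v c1) → (G.Adj v b2 ∨ G.Adj v c2) → False := by
    intro v hv hvx k1 k2
    rcases k1 with k1 | k1 <;> rcases k2 with k2 | k2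
    · exact h.k22f hv hvx k1 k2
    · exact h.k22h hv hvx k1 k2
    · exact h'.k22h (by rwa [hpfl]) hvx k2 k1
    · exact h.k22g hv hvx k1 k2
  have := h.t3 (fun t ht w hw e => h.bA hw (h.sN2 (by simp) ht e))
    (fun v => (v = b1 ∨ v = c1) ∨ (v ∉ fl [([b1, c1], M1, a2), ([b2, c2], M2, a1)] ∧
      (G.Adj v b1 ∨ G.Adj v c1))) b1 b2 (by
      intro u v u1 v1 u2 v2 u3 v3 huv hP
      rcases hcase u u1 u2 u3 with k | k | k
      · rcases hcase v v1 v2 v3 with l | l | l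
        · exact Or.inl l
        · exfalso
          rcases k with rfl | rfl <;> rcases l with rfl | rfl
          · exact hbb.1 huv
          · exact e1 huv
          · exact e2 huv.symm
          · exact hbb.2 huv
        · refine Or.inr ⟨l, ?_⟩
          rcases k with rfl | rfl
          · exact Or.inl huv.symm
          · exact Or.inr huv.symm
      · exfalso
        have hin : u ∈ fl [([b1, c1], M1, a2), ([b2, c2], M2, a1)] := by
          rw [h.mem]; right; right; simpa using Or.inr k
        rcases hP with hP | hP
        · rcases hP with rfl | rfl <;> rcases k with rfl | rfl <;> simp at hnd
        · exact hP.1 hin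
      · rcases hcase v v1 v2 v3 with l | l | l
        · exact Or.inl l
        · exfalso
          rcases hP with hP | hP
          · refine k ?_
            rw [h.mem]; right; right; simpa using Or.inl hP
          · refine hO u k u3 hP.2 ?_
            rcases l with rfl | rfl
            · exact Or.inl huv
            · exact Or.inr huv
        · exact absurd huv (h.cx.dom h.mx k l)) (by simp) (by
      have hin : b2 ∈ fl [([b1, c1], M1, a2), ([b2, c2], M2, a1)] := by
        rw [h.mem]; right; right; simp
      rintro ((rfl | rfl) | k)
      · simp at hnd
      · simp at hnd
      · exact k.1 hin) (by simp) (by simp)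
  simp at this

end
end HT

namespace HT
set_option linter.unusedSectionVars false
set_option linter.unusedSimpArgs false
variable {V : Type u} {G : SimpleGraph V}
section
variable [Fintype V] [DecidableEq V] [DecidableRel G.Adj] {C : List V} {x : V}

/-- a pair of positions in an alternating list -/
theorem two_split {M : List (V × V)} {s t : V} (hs : s ∈ M.map Prod.snd) (ht : t ∈ M.map Prod.snd)
    (hst : s ≠ t) :
    (∃ N1 α N2 γ N3, M = N1 ++ (α, s) :: (N2 ++ (γ, t) :: N3)) ∨
    ∃ N1 α N2 γ N3, M = N1 ++ (α, t) :: (N2 ++ (γ, s) :: N3) := by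
  obtain ⟨N1, α, N2, rfl⟩ := mem_snd hs
  simp only [List.map_append, List.map_cons, List.mem_append, List.mem_cons] at ht
  rcases ht with ht | ht | ht
  · obtain ⟨N, γ, N', rfl⟩ := mem_snd ht
    exact Or.inr ⟨N, γ, N', α, N2, by simp⟩
  · exact absurd ht.symm hst
  · obtain ⟨N, γ, N', rfl⟩ := mem_snd ht
    exact Or.inl ⟨N1, α, N, γ, N', rfl⟩

theorem Cf.e4a {p1 p2 p3 p4 a : V} {M : List (V × V)} (h : Cf G x [([p1, p2, p3, p4], M, a)])
    (h3 : ∀ t ∈ Sg [([p1, p2, p3, p4], M, a)], ¬ G.Adj t p3) : False := by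
  have hcard : 2 * G.degree x + 4 ≤ Fintype.card V := by
    have h1 := h.len
    have h2 := h.lt
    simp at h1
    omega
  have hk := h.k4
  have hS : Sg [([p1, p2, p3, p4], M, a)] = M.map Prod.snd := by simp [Sg_cons, Sg_nil]
  have hA : As [([p1, p2, p3, p4], M, a)] = M.map Prod.fst ++ [a] := by simp [As_cons, As_nil]
  have h1 : ∀ t ∈ Sg [([p1, p2, p3, p4], M, a)], ¬ G.Adj t p1 := fun t ht =>
    h.sh t ht [p1, p2, p3, p4] (by simp) p1 _ (Or.inl rfl)
  have h4 : ∀ t ∈ Sg [([p1, p2, p3, p4], M, a)], ¬ G.Adj t p4 := fun t ht =>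
    h.sh t ht [p1, p2, p3, p4] (by simp) p4 _ (Or.inr rfl)
  have hnd := h.mx.1
  rw [fl_cons] at hnd
  simp at hnd
  by_cases hs : ∃ t ∈ Sg [([p1, p2, p3, p4], M, a)], G.Adj t p2
  · have hp1 : Ms G x (fl [([p1, p2, p3, p4], M, a)]) p1 ∧ ¬ G.Adj p1 p3 := by
      obtain ⟨t, ht, htp⟩ := hs
      have m1 := h.h2 t ht [p1, p2, p3, p4] (by simp) p1 p2 [p3, p4] (Or.inl rfl) htp
      exact ⟨m1.1, m1.2 p3 [p4] rfl⟩
    obtain ⟨hm, n13⟩ := hp1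
    have hnb : ∀ w, G.Adj p1 w → w ∈ As [([p1, p2, p3, p4], M, a)] ∨ w = p2 ∨ w = p4 := by
      intro w hw
      rcases h.nbr hm (h.bA (by simp)) hw with k | k | k
      · exact Or.inl k
      · exact absurd hw.symm (h1 w k)
      · simp at k
        rcases k with rfl | rfl | rfl | rfl
        · exact absurd rfl hw.ne
        · exact Or.inr (Or.inl rfl)
        · exact absurd hw n13
        · exact Or.inr (Or.inr rfl)
    by_cases h14 : G.Adj p1 p4
    · rw [hS] at hs
      have hfull : ∀ t ∈ Sg [([p1, p2, p3, p4], M, a)], ¬ G.Adj t p2 → G.Adj t (hd M a) := by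
        intro t ht h2
        refine h.full ?_ ?_ (hd M a) ?_
        · have := h.dge (Or.inl ht); omega
        · intro w hw
          rcases h.sN ht hw with k | k
          · exact k
          · simp at k
            rcases k with rfl | rfl | rfl | rfl
            · exact absurd hw (h1 t ht)
            · exact absurd hw h2
            · exact absurd hw (h3 t ht)
            · exact absurd hw (h4 t ht)
        · rw [hA]
          cases M <;> simp [hd]
      obtain ⟨N1, α, s, N2, rfl, hsp, hlast⟩ := last_split (fun t => G.Adj t p2) M hs
      have := deg_le_list (G := G) p1 [p2, p4, hd N2 a] (by
        intro w hw
        simp only [List.mem_cons, List.not_mem_nil, or_false]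
        rcases hnb w hw with k | k | k
        · rw [hA] at k
          simp only [List.map_append, List.map_cons, List.mem_append, List.mem_cons,
            List.not_mem_nil, or_false] at k
          have k' : w ∈ N1.map Prod.fst ∨ w = α ∨ (w ∈ N2.map Prod.fst ∨ w = a) := by
            rcases k with (k | k | k) | k
            · exact Or.inl k
            · exact Or.inr (Or.inl k)
            · exact Or.inr (Or.inr (Or.inl k))
            · exact Or.inr (Or.inr (Or.inr k))
          clear k
          rcases k' with k | k | k
          · exfalso
            obtain ⟨N, t, N', rfl⟩ := mem_fst k
            by_cases htp : G.Adj t p2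
            · have h' := h
              rw [List.append_assoc, List.cons_append] at h'
              exact h'.k4e h14 htp hw
            · have h5 := hfull t (by rw [hS]; simp) htp
              have h' := h
              rw [List.append_assoc, List.cons_append] at h'
              rw [hd_split, hd_split] at h5
              exact h'.k4g h14 hsp h5 hw
          · subst k
            exact (h.k4e h14 hsp hw).elim
          · rcases mem_pre k with k | ⟨N, γ, t, N', rfl, rfl⟩
            · exact Or.inr (Or.inr k)
            · exfalso
              have h5 := hfull t (by rw [hS]; simp) (hlast t (by simp))
              rw [hd_split] at h5
              exact h.k4f h14 hsp h5 hw
        · exact Or.inl k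
        · exact Or.inr (Or.inl k))
      have hd := h.dge (v := p1) (Or.inr (by simp))
      simp at this
      omega
    · have := h.t2 [p1] [p2] (by simp) (by simp [hnd]) (by simp) (by simp)
        (by
          intro v hv w e
          simp at hv
          subst hv
          rcases hnb w e with k | k | k
          · exact Or.inr k
          · left; simp [k]
          · subst k; exact absurd e h14)
        (by
          intro t ht w hw e
          simp at hw ⊢
          rcases hw with rfl | rfl | rfl | rfl
          · exact absurd e (h1 t ht)
          · rfl
          · exact absurd e (h3 t ht)
          · exact absurd e (h4 t ht)) p3 (by simp) (by simp; rintro rfl; simp at hnd)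
          (by simp; rintro rfl; simp at hnd)
      simp at this
  · push Not at hs
    have := h.t2 [] [] (by simp) (by simp) (by simp) (by simp) (by simp)
      (by
        intro t ht w hw e
        simp at hw
        rcases hw with rfl | rfl | rfl | rfl
        · exact absurd e (h1 t ht)
        · exact absurd e (hs t ht)
        · exact absurd e (h3 t ht)
        · exact absurd e (h4 t ht)) p1 (by simp) (by simp) (by simp)
    simp at this

/-- one segment of length four -/
theorem Cf.e4 {p1 p2 p3 p4 a : V} {M : List (V × V)} (h : Cf G x [([p1, p2, p3, p4], M, a)]) :
    False := by
  have hS : Sg [([p1, p2, p3, p4], M, a)] = M.map Prod.snd := by simp [Sg_cons, Sg_nil]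
  by_cases h3 : ∃ t ∈ Sg [([p1, p2, p3, p4], M, a)], G.Adj t p3
  · obtain ⟨M', a', -, hr⟩ := h.rev1
    simp only [List.reverse_cons, List.reverse_nil, List.nil_append, List.cons_append] at hr
    refine hr.e4a ?_
    obtain ⟨t, ht, htp⟩ := h3
    intro s hs' hsp
    have hs : s ∈ Sg [([p1, p2, p3, p4], M, a)] := by
      by_contra hs
      have hsA : s ∉ As [([p1, p2, p3, p4], M, a)] := by
        rw [← h.nx, hr.nx]; exact hr.sA hs'
      have hsB : ¬ ∃ b ∈ [([p1, p2, p3, p4], M, a)], s ∈ b.1 := by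
        intro k
        refine hr.bS ?_ hs'
        simp at k ⊢
        tauto
      have hsx : s ≠ x := by rintro rfl; exact hr.xN.2.1 hs'
      have h1 : s ∉ fl [([p1, p2, p3, p4], M, a)] := by
        rw [h.mem]
        rintro (k | k | k)
        · exact hsA k
        · exact hs k
        · exact hsB k
      have := (hr.dge (Or.inl hs'))
      have h1' := h.len
      have h2 := h.lt
      have h3 := h.hi
      simp at h1'
      rcases h.cov (by omega) s with k | k
      · exact hsx k
      · exact h1 k
    rw [hS] at ht hs
    by_cases hst : s = t
    · subst hst
      obtain ⟨N1, α, N2, rfl⟩ := mem_snd hs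
      exact h.k4a hsp htp
    · rcases two_split hs ht hst with ⟨N1, α, N2, γ, N3, rfl⟩ | ⟨N1, α, N2, γ, N3, rfl⟩
      · exact h.k4b hsp htp
      · exact h.k4c hsp htp
  · push Not at h3
    exact h.e4a h3

end
end HT

namespace HT
set_option linter.unusedSectionVars false
set_option linter.unusedSimpArgs false
variable {V : Type u} {G : SimpleGraph V}
section
variable [Fintype V] [DecidableEq V] [DecidableRel G.Adj] {C : List V} {x : V}
  {B : List (Bk V)}

/-- when the configuration is spanning, neighbours of segment vertices are on the cycle -/
theorem Cf.covN (h : Cf G x B) (hr : Fintype.card V ≤ (fl B).length + 1) {v w : V}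
    (hv : ∃ b ∈ B, v ∈ b.1) (e : G.Adj v w) : w ∈ As B ∨ w ∈ Sg B ∨ ∃ b ∈ B, w ∈ b.1 := by
  rcases h.cov hr w with k | k
  · subst k
    exact absurd ((h.nx v).1 e.symm) (h.bA hv)
  · exact h.mem.1 k

theorem Cf.n32 {p1 p2 p3 a2 q1 q2 a1 : V} {M1 M2 : List (V × V)}
    (h : Cf G x [([p1, p2, p3], M1, a2), ([q1, q2], M2, a1)]) : ¬ G.Adj p1 q2 := by
  intro e1
  have hcard : 2 * G.degree x + 4 ≤ Fintype.card V := by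
    have h1 := h.len
    have h2 := h.lt
    simp at h1
    omega
  have hk := h.k4
  have hS : Sg [([p1, p2, p3], M1, a2), ([q1, q2], M2, a1)] =
      M1.map Prod.snd ++ M2.map Prod.snd := by
    simp [Sg_cons, Sg_nil]
  have hA : As [([p1, p2, p3], M1, a2), ([q1, q2], M2, a1)] =
      M1.map Prod.fst ++ a2 :: (M2.map Prod.fst ++ [a1]) := by
    simp [As_cons, As_nil]
  have s1 : ∀ t ∈ Sg [([p1, p2, p3], M1, a2), ([q1, q2], M2, a1)], ¬ G.Adj t p1 := fun t ht =>
    h.sh t ht [p1, p2, p3] (by simp) p1 _ (Or.inl rfl)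
  have s3 : ∀ t ∈ Sg [([p1, p2, p3], M1, a2), ([q1, q2], M2, a1)], ¬ G.Adj t p3 := fun t ht =>
    h.sh t ht [p1, p2, p3] (by simp) p3 _ (Or.inr rfl)
  have s4 : ∀ t ∈ Sg [([p1, p2, p3], M1, a2), ([q1, q2], M2, a1)], ¬ G.Adj t q1 := fun t ht =>
    h.sh t ht [q1, q2] (by simp) q1 _ (Or.inl rfl)
  have s5 : ∀ t ∈ Sg [([p1, p2, p3], M1, a2), ([q1, q2], M2, a1)], ¬ G.Adj t q2 := fun t ht =>
    h.sh t ht [q1, q2] (by simp) q2 _ (Or.inr rfl)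
  have s2 : ∀ t ∈ Sg [([p1, p2, p3], M1, a2), ([q1, q2], M2, a1)], ¬ G.Adj t p2 := by
    intro t ht e
    rw [hS] at ht
    rcases List.mem_append.1 ht with k | k
    · obtain ⟨N1, α, N2, rfl⟩ := mem_snd k
      exact h.k32a e1 e
    · obtain ⟨N1, α, N2, rfl⟩ := mem_snd k
      exact h.k32b e1 e
  have hfull : ∀ t ∈ Sg [([p1, p2, p3], M1, a2), ([q1, q2], M2, a1)],
      ∀ w ∈ As [([p1, p2, p3], M1, a2), ([q1, q2], M2, a1)], G.Adj t w := by
    intro t ht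
    refine h.full ?_ ?_
    · have := h.dge (Or.inl ht); omega
    · intro w hw
      rcases h.sN ht hw with k | k
      · exact k
      · simp at k
        rcases k with (rfl | rfl | rfl) | (rfl | rfl)
        · exact absurd hw (s1 t ht)
        · exact absurd hw (s2 t ht)
        · exact absurd hw (s3 t ht)
        · exact absurd hw (s4 t ht)
        · exact absurd hw (s5 t ht)
  have hm := h.k32m e1
  have hpq : ¬ G.Adj p1 q1 := by
    have := h.hh
    simp at this
    exact (this.1 _ _ _ _ rfl rfl).1
  have hM1 : M1 = [] := by
    rcases List.eq_nil_or_concat M1 with k | ⟨N, ⟨γ, t⟩, rfl⟩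
    · exact k
    · exfalso
      rw [List.concat_eq_append] at h hfull hS hA
      refine h.k32c e1 (hfull t (by rw [hS]; simp) _ ?_)
      rw [hA]
      cases M2 <;> simp [hd]
  subst hM1
  have := deg_le_list (G := G) q1 [a2, q2, p2] (by
    intro w hw
    simp only [List.mem_cons, List.not_mem_nil, or_false]
    rcases h.nbr hm (h.bA (by simp)) hw with k | k | k
    · rw [hA] at k
      simp only [List.map_nil, List.nil_append, List.mem_append, List.mem_cons, List.not_mem_nil,
        or_false] at k
      rcases k with k | k | k
      · exact Or.inl k
      · exfalso
        obtain ⟨N1, t, N2, rfl⟩ := mem_fst k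
        refine h.k32e e1 hw (hfull t (by rw [hS]; simp) _ ?_)
        rw [hA]
        cases N1 <;> simp [hd]
      · subst k
        exact (h.k32f e1 hw).elim
    · exact absurd hw.symm (s4 w k)
    · simp at k
      rcases k with (rfl | rfl | rfl) | (rfl | rfl)
      · exact absurd hw.symm hpq
      · exact Or.inr (Or.inr rfl)
      · exact (h.k32d e1 hw).elim
      · exact absurd rfl hw.ne
      · exact Or.inr (Or.inl rfl))
  have hd := h.dge (v := q1) (Or.inr (by simp))
  simp at this
  omega

/-- segments of lengths three and two -/
theorem Cf.e32 {p1 p2 p3 a2 q1 q2 a1 : V} {M1 M2 : List (V × V)}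
    (h : Cf G x [([p1, p2, p3], M1, a2), ([q1, q2], M2, a1)]) : False := by
  have hr : Fintype.card V ≤ (fl [([p1, p2, p3], M1, a2), ([q1, q2], M2, a1)]).length + 1 := by
    have h1 := h.len
    have h2 := h.hi
    simp at h1
    omega
  have n1 := h.n32
  have n2 : ¬ G.Adj p3 q1 := by
    obtain ⟨M1', M2', a1', a2', -, -, h'⟩ := h.rev2
    exact Cf.n32 (by simpa using h')
  have hhh := h.hh
  simp at hhh
  have r1 := hhh.1 _ _ _ _ rfl rfl
  have r2 := hhh.2 _ _ _ _ rfl rfl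
  have hnd := h.mx.1
  rw [fl_cons, fl_cons] at hnd
  simp at hnd
  have s1 : ∀ t ∈ Sg [([p1, p2, p3], M1, a2), ([q1, q2], M2, a1)], ¬ G.Adj t p1 := fun t ht =>
    h.sh t ht [p1, p2, p3] (by simp) p1 _ (Or.inl rfl)
  have s3 : ∀ t ∈ Sg [([p1, p2, p3], M1, a2), ([q1, q2], M2, a1)], ¬ G.Adj t p3 := fun t ht =>
    h.sh t ht [p1, p2, p3] (by simp) p3 _ (Or.inr rfl)
  have s4 : ∀ t ∈ Sg [([p1, p2, p3], M1, a2), ([q1, q2], M2, a1)], ¬ G.Adj t q1 := fun t ht =>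
    h.sh t ht [q1, q2] (by simp) q1 _ (Or.inl rfl)
  have s5 : ∀ t ∈ Sg [([p1, p2, p3], M1, a2), ([q1, q2], M2, a1)], ¬ G.Adj t q2 := fun t ht =>
    h.sh t ht [q1, q2] (by simp) q2 _ (Or.inr rfl)
  by_cases hc : (∃ t ∈ Sg [([p1, p2, p3], M1, a2), ([q1, q2], M2, a1)], G.Adj t p2) ∨
      G.Adj q1 p2 ∨ G.Adj q2 p2
  · have n13 : ¬ G.Adj p1 p3 := by
      rcases hc with ⟨t, ht, e⟩ | e | e
      · exact (h.h2 t ht [p1, p2, p3] (by simp) p1 p2 [p3] (Or.inl rfl) e).2 p3 [] rfl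
      · exact r1.2.1 p1 p2 p3 [] rfl e
      · exact fun k => r2.2.1 p3 p2 p1 [] rfl e k.symm
    have := h.t2 [p1, p3] [p2] (by simp; rintro rfl; simp at hnd)
      (by
        intro v hv
        simp at hv ⊢
        rcases hv with rfl | rfl
        · rintro rfl; simp at hnd
        · rintro rfl; simp at hnd) (by simp) (by simp)
      (by
        intro v hv w e
        simp only [List.mem_cons, List.not_mem_nil, or_false] at hv ⊢
        have hvB : ∃ b ∈ [([p1, p2, p3], M1, a2), ([q1, q2], M2, a1)], v ∈ b.1 := by
          rcases hv with rfl | rfl <;> simp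
        rcases h.covN hr hvB e with k | k | k
        · exact Or.inr k
        · exfalso
          rcases hv with rfl | rfl
          · exact s1 w k e.symm
          · exact s3 w k e.symm
        · left
          simp at k
          rcases hv with rfl | rfl <;> rcases k with (rfl | rfl | rfl) | (rfl | rfl)
          · exact absurd rfl e.ne
          · rfl
          · exact absurd e n13
          · exact absurd e r1.1
          · exact absurd e n1
          · exact absurd e.symm n13
          · rfl
          · exact absurd rfl e.ne
          · exact absurd e n2
          · exact absurd e r2.1)
      (by
        intro t ht w hw e
        simp at hw ⊢
        rcases hw with (rfl | rfl | rfl) | (rfl | rfl)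
        · exact absurd e (s1 t ht)
        · rfl
        · exact absurd e (s3 t ht)
        · exact absurd e (s4 t ht)
        · exact absurd e (s5 t ht)) q1 (by simp)
      (by simp; constructor <;> (rintro rfl; simp at hnd)) (by simp; rintro rfl; simp at hnd)
    simp at this
  · have c1 : ∀ t ∈ Sg [([p1, p2, p3], M1, a2), ([q1, q2], M2, a1)], ¬ G.Adj t p2 :=
      fun t ht e => hc (Or.inl ⟨t, ht, e⟩)
    have c2 : ¬ G.Adj q1 p2 := fun e => hc (Or.inr (Or.inl e))
    have c3 : ¬ G.Adj q2 p2 := fun e => hc (Or.inr (Or.inr e))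
    have := h.t3 (by
        intro t ht w hw e
        simp at hw
        rcases hw with (rfl | rfl | rfl) | (rfl | rfl)
        · exact absurd e (s1 t ht)
        · exact absurd e (c1 t ht)
        · exact absurd e (s3 t ht)
        · exact absurd e (s4 t ht)
        · exact absurd e (s5 t ht)) (fun v => v = p1 ∨ v = p2 ∨ v = p3) p1 q1 (by
      intro u v u1 v1 u2 v2 u3 v3 e hP
      have huB : ∃ b ∈ [([p1, p2, p3], M1, a2), ([q1, q2], M2, a1)], u ∈ b.1 := by
        rcases hP with rfl | rfl | rfl <;> simp
      rcases h.covN hr huB e with k | k | k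
      · exact absurd k v1
      · exact absurd k v2
      · simp at k
        rcases k with k | k
        · exact k
        · exfalso
          rcases hP with rfl | rfl | rfl <;> rcases k with rfl | rfl
          · exact r1.1 e
          · exact n1 e
          · exact c2 e.symm
          · exact c3 e.symm
          · exact n2 e
          · exact r2.1 e) (Or.inl rfl) (by
      rintro (rfl | rfl | rfl) <;> simp at hnd) (by simp) (by simp)
    simp at this

end
end HT

namespace HT
set_option linter.unusedSectionVars false
set_option linter.unusedSimpArgs false
variable {V : Type u} {G : SimpleGraph V}
section
variable [Fintype V] [DecidableEq V] [DecidableRel G.Adj] {C : List V} {x : V}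
  {B : List (Bk V)}

theorem Cf.full2 (h : Cf G x B) (h2 : ∀ b ∈ B, ∃ p q, b.1 = [p, q])
    (hc : 2 * G.degree x + 4 ≤ Fintype.card V) {t w : V} (ht : t ∈ Sg B) (hw : w ∈ As B) :
    G.Adj t w := by
  refine h.full ?_ (fun w e => h.sN2 h2 ht e) w hw
  have := h.dge (Or.inl ht)
  omega

theorem hd_mem (M : List (V × V)) (a : V) : hd M a ∈ M.map Prod.fst ∨ hd M a = a := by
  cases M <;> simp [hd]

theorem Cf.card3 {b1 c1 a3 b3 c3 a2 b2 c2 a1 : V} {M1 M3 M2 : List (V × V)}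
    (h : Cf G x [([b1, c1], M1, a3), ([b3, c3], M3, a2), ([b2, c2], M2, a1)]) :
    2 * G.degree x + 4 ≤ Fintype.card V := by
  have h1 := h.len
  have h2 := h.lt
  simp at h1
  omega

theorem Cf.prev {b1 c1 a3 b3 c3 a2 b2 c2 a1 : V} {M1 M3 M2 : List (V × V)}
    (h : Cf G x [([b1, c1], M1, a3), ([b3, c3], M3, a2), ([b2, c2], M2, a1)]) :
    ¬ G.Adj b1 c2 := by
  intro e1
  have hcard := h.card3
  have hk := h.k4
  have hS : Sg [([b1, c1], M1, a3), ([b3, c3], M3, a2), ([b2, c2], M2, a1)] =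
      M1.map Prod.snd ++ (M3.map Prod.snd ++ M2.map Prod.snd) := by
    simp [Sg_cons, Sg_nil]
  have hA : As [([b1, c1], M1, a3), ([b3, c3], M3, a2), ([b2, c2], M2, a1)] =
      M1.map Prod.fst ++ a3 :: (M3.map Prod.fst ++ a2 :: (M2.map Prod.fst ++ [a1])) := by
    simp [As_cons, As_nil]
  have hf : ∀ t ∈ Sg [([b1, c1], M1, a3), ([b3, c3], M3, a2), ([b2, c2], M2, a1)], G.Adj t a1 :=
    fun t ht => h.full2 (by simp) hcard ht (by rw [hA]; simp)
  have hcS : ∀ t ∈ Sg [([b1, c1], M1, a3), ([b3, c3], M3, a2), ([b2, c2], M2, a1)],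
      ¬ G.Adj t c1 := fun t ht =>
    h.sh t ht [b1, c1] (by simp) c1 [b1] (Or.inr rfl)
  have hcc : ¬ G.Adj c1 c2 ∧ ¬ G.Adj c1 c3 := by
    have := h.hh
    simp at this
    exact ⟨(this.1.2.2 _ _ _ _ rfl rfl).1, (this.1.1.2 _ _ _ _ rfl rfl).1⟩
  obtain ⟨z, hz⟩ : ∃ z, ∀ w, G.Adj c1 w → w = a2 ∨ w = b2 → w = z := by
    by_cases k : G.Adj c1 a2
    · refine ⟨a2, fun w hw e => ?_⟩
      rcases e with rfl | rfl
      · rfl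
      · exact (h.pg e1 k hw).elim
    · refine ⟨b2, fun w hw e => ?_⟩
      rcases e with rfl | rfl
      · exact absurd hw k
      · rfl
  have := deg_le_list (G := G) c1 [b1, a3, z] (by
    intro w hw
    simp only [List.mem_cons, List.not_mem_nil, or_false]
    rcases h.nbr (h.pm e1) (h.bA (by simp)) hw with k | k | k
    · rw [hA] at k
      simp only [List.mem_append, List.mem_cons, List.not_mem_nil, or_false] at k
      rcases k with k | k | k | k | k
      · obtain ⟨N1, t, N2, rfl⟩ := mem_fst k
        exact (h.pa e1 hw (hf t (by rw [hS]; simp))).elim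
      · exact Or.inr (Or.inl k)
      · obtain ⟨N1, t, N2, rfl⟩ := mem_fst k
        exact (h.pb e1 hw (hf t (by rw [hS]; simp))).elim
      · exact Or.inr (Or.inr (hz w hw (Or.inl k)))
      · rcases mem_pre k with k | ⟨N1, γ, t, N2, rfl, rfl⟩
        · subst k; exact (h.pd e1 hw).elim
        · exact (h.pc e1 hw (hf t (by rw [hS]; simp))).elim
    · exact absurd hw.symm (hcS w k)
    · simp at k
      rcases k with (rfl | rfl) | (rfl | rfl) | (rfl | rfl)
      · exact Or.inl rfl
      · exact absurd rfl hw.ne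
      · exact (h.pf e1 hw).elim
      · exact absurd hw hcc.2
      · exact Or.inr (Or.inr (hz _ hw (Or.inr rfl)))
      · exact absurd hw hcc.1)
  have hd := h.dge (v := c1) (Or.inr (by simp))
  simp at this
  omega

theorem Cf.next1 {b1 c1 a2 b2 c2 a3 b3 c3 a1 : V} {M1 M2 M3 : List (V × V)}
    (h : Cf G x [([b1, c1], M1, a2), ([b2, c2], M2, a3), ([b3, c3], M3, a1)])
    (e1 : G.Adj b1 c2) : G.degree x ≤ 4 ∧ M3 ≠ [] := by
  have hcard := h.card3
  have hk := h.k4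
  have hS : Sg [([b1, c1], M1, a2), ([b2, c2], M2, a3), ([b3, c3], M3, a1)] =
      M1.map Prod.snd ++ (M2.map Prod.snd ++ M3.map Prod.snd) := by
    simp [Sg_cons, Sg_nil]
  have hA : As [([b1, c1], M1, a2), ([b2, c2], M2, a3), ([b3, c3], M3, a1)] =
      M1.map Prod.fst ++ a2 :: (M2.map Prod.fst ++ a3 :: (M3.map Prod.fst ++ [a1])) := by
    simp [As_cons, As_nil]
  have hf : ∀ t ∈ Sg [([b1, c1], M1, a2), ([b2, c2], M2, a3), ([b3, c3], M3, a1)], G.Adj t a1 :=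
    fun t ht => h.full2 (by simp) hcard ht (by rw [hA]; simp)
  have hcS : ∀ t ∈ Sg [([b1, c1], M1, a2), ([b2, c2], M2, a3), ([b3, c3], M3, a1)],
      ¬ G.Adj t c1 := fun t ht =>
    h.sh t ht [b1, c1] (by simp) c1 [b1] (Or.inr rfl)
  have hcc : ¬ G.Adj c1 c2 ∧ ¬ G.Adj c1 c3 := by
    have := h.hh
    simp at this
    exact ⟨(this.1.1.2 _ _ _ _ rfl rfl).1, (this.1.2.2 _ _ _ _ rfl rfl).1⟩
  have hch := h.chain
  have hM1 : M1 = [] := by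
    cases M1 with
    | nil => rfl
    | cons p N =>
      obtain ⟨α, t⟩ := p
      exfalso
      refine Cf.na (N1 := []) h e1 ?_ (hf t (by rw [hS]; simp))
      rw [fl_cons] at hch
      simp [Wp_cons] at hch
      exact hch.2.1
  subst hM1
  have hca : G.Adj c1 a2 := by
    rw [fl_cons] at hch
    simp [Wp_nil] at hch
    exact hch.2.1
  have hN : ∀ w, G.Adj c1 w → w = a2 ∨ w = b1 ∨ w = b3 ∨ w = hd M3 a1 := by
    intro w hw
    rcases h.nbr (h.nm e1) (h.bA (by simp)) hw with k | k | k
    · rw [hA] at k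
      simp only [List.map_nil, List.nil_append, List.mem_append, List.mem_cons, List.not_mem_nil,
        or_false] at k
      have k' : w = a2 ∨ (w ∈ M2.map Prod.fst ∨ w = a3) ∨ (w ∈ M3.map Prod.fst ∨ w = a1) := by
        rcases k with k | k | k | k
        · exact Or.inl k
        · exact Or.inr (Or.inl (Or.inl k))
        · exact Or.inr (Or.inl (Or.inr k))
        · exact Or.inr (Or.inr k)
      rcases k' with k | k | k
      · exact Or.inl k
      · rcases mem_pre k with k | ⟨N1, γ, t, N2, rfl, rfl⟩
        · subst k; exact (h.nd e1 hw).elim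
        · exact (h.nc e1 hw (hf t (by rw [hS]; simp))).elim
      · rcases mem_pre k with k | ⟨N1, γ, t, N2, rfl, rfl⟩
        · exact Or.inr (Or.inr (Or.inr k))
        · exact (h.nb e1 hw (hf t (by rw [hS]; simp))).elim
    · exact absurd hw.symm (hcS w k)
    · simp at k
      rcases k with (rfl | rfl) | (rfl | rfl) | (rfl | rfl)
      · exact Or.inr (Or.inl rfl)
      · exact absurd rfl hw.ne
      · exact (h.ne e1 hca hw).elim
      · exact absurd hw hcc.1
      · exact Or.inr (Or.inr (Or.inl rfl))
      · exact absurd hw hcc.2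
  have hdg := h.dge (v := c1) (Or.inr (by simp))
  constructor
  · have := deg_le_list (G := G) c1 [a2, b1, b3, hd M3 a1] (by
      intro w hw
      simpa using hN w hw)
    simp at this
    omega
  · rintro rfl
    have := deg_le_list (G := G) c1 [a2, b1, b3] (by
      intro w hw
      simp only [List.mem_cons, List.not_mem_nil, or_false]
      rcases hN w hw with k | k | k | k
      · exact Or.inl k
      · exact Or.inr (Or.inl k)
      · exact Or.inr (Or.inr k)
      · rw [k] at hw
        exact (h.nf e1 hw).elim)
    simp at this
    omega

theorem Cf.next {b1 c1 a2 b2 c2 a3 b3 c3 a1 : V} {M1 M2 M3 : List (V × V)}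
    (h : Cf G x [([b1, c1], M1, a2), ([b2, c2], M2, a3), ([b3, c3], M3, a1)]) :
    ¬ G.Adj b1 c2 := by
  intro e1
  obtain ⟨k1, k2⟩ := h.next1 e1
  obtain ⟨M1', M2', M3', a', b', c', l1, l2, l3, h'⟩ := h.rev3
  simp only [List.reverse_cons, List.reverse_nil, List.nil_append, List.cons_append] at h'
  have h'' := Cf.rot (B1 := [([c1, b1], M3', c'), ([c3, b3], M2', b')])
    (B2 := [([c2, b2], M1', a')]) h'
  simp only [List.cons_append, List.nil_append] at h''
  obtain ⟨-, k3⟩ := h''.next1 e1.symm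
  have hdeg := h.deg
  rw [← List.length_pos_iff] at k2 k3
  simp [As_cons, As_nil] at hdeg
  omega

theorem Cf.e222 {b1 c1 a2 b2 c2 a3 b3 c3 a1 : V} {M1 M2 M3 : List (V × V)}
    (h : Cf G x [([b1, c1], M1, a2), ([b2, c2], M2, a3), ([b3, c3], M3, a1)]) : False := by
  have h' := Cf.rot (B1 := [([b1, c1], M1, a2)])
    (B2 := [([b2, c2], M2, a3), ([b3, c3], M3, a1)]) h
  have h'' := Cf.rot (B1 := [([b1, c1], M1, a2), ([b2, c2], M2, a3)])
    (B2 := [([b3, c3], M3, a1)]) h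
  simp only [List.cons_append, List.nil_append] at h' h''
  have n12 := h.next
  have n23 := h'.next
  have n31 := h''.next
  have n13 := h.prev
  have n21 := h'.prev
  have n32 := h''.prev
  have hr : Fintype.card V ≤
      (fl [([b1, c1], M1, a2), ([b2, c2], M2, a3), ([b3, c3], M3, a1)]).length + 1 := by
    have h1 := h.len
    have h2 := h.hi
    simp at h1
    omega
  have hhh := h.hh
  simp at hhh
  obtain ⟨⟨r12, r13⟩, r23⟩ := hhh
  have b12 := (r12.1 _ _ _ _ rfl rfl).1
  have b13 := (r13.1 _ _ _ _ rfl rfl).1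
  have b23 := (r23.1 _ _ _ _ rfl rfl).1
  have c12 := (r12.2 _ _ _ _ rfl rfl).1
  have c13 := (r13.2 _ _ _ _ rfl rfl).1
  have c23 := (r23.2 _ _ _ _ rfl rfl).1
  have hnd := (List.nodup_append.1 (List.nodup_append.1 h.nodup).2.1).2.1
  simp at hnd
  have hxN := h.xN
  have hS := Sg_len [([b1, c1], M1, a2), ([b2, c2], M2, a3), ([b3, c3], M3, a1)]
  have hn0 := h.nodup
  have hbA : ∀ v, (∃ b ∈ [([b1, c1], M1, a2), ([b2, c2], M2, a3), ([b3, c3], M3, a1)], v ∈ b.1) →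
    v ∉ As [([b1, c1], M1, a2), ([b2, c2], M2, a3), ([b3, c3], M3, a1)] := fun v k => h.bA k
  have hbS : ∀ v, (∃ b ∈ [([b1, c1], M1, a2), ([b2, c2], M2, a3), ([b3, c3], M3, a1)], v ∈ b.1) →
    v ∉ Sg [([b1, c1], M1, a2), ([b2, c2], M2, a3), ([b3, c3], M3, a1)] := fun v k => h.bS k
  have hbx : ∀ v, (∃ b ∈ [([b1, c1], M1, a2), ([b2, c2], M2, a3), ([b3, c3], M3, a1)], v ∈ b.1) →
    v ≠ x := by
    rintro v ⟨b, hb, k⟩ rfl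
    exact hxN.2.2 b hb k
  -- relabelling of the pieces
  let f : V → V := fun v => if v = c1 then b1 else if v = c2 then b2 else if v = c3 then b3 else v
  have fid : ∀ v, v ≠ c1 → v ≠ c2 → v ≠ c3 → f v = v := by
    intro v k1 k2 k3
    simp [f, k1, k2, k3]
  have fc1 : f c1 = b1 := by simp [f]
  have fc2 : f c2 = b2 := by
    have : c2 ≠ c1 := by rintro rfl; simp at hnd
    simp [f, this]
  have fc3 : f c3 = b3 := by
    have k1 : c3 ≠ c1 := by rintro rfl; simp at hnd
    have k2 : c3 ≠ c2 := by rintro rfl; simp at hnd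
    simp [f, k1, k2]
  have fb1 : f b1 = b1 := by
    refine fid _ ?_ ?_ ?_ <;> (rintro rfl; simp at hnd)
  have fb2 : f b2 = b2 := by
    refine fid _ ?_ ?_ ?_ <;> (rintro rfl; simp at hnd)
  have fb3 : f b3 = b3 := by
    refine fid _ ?_ ?_ ?_ <;> (rintro rfl; simp at hnd)
  have hblob : ∀ v w, (∃ b ∈ [([b1, c1], M1, a2), ([b2, c2], M2, a3), ([b3, c3], M3, a1)], v ∈ b.1) →
      w ∉ As [([b1, c1], M1, a2), ([b2, c2], M2, a3), ([b3, c3], M3, a1)] →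
      G.Adj v w → f v = f w := by
    intro v w hv hw e
    rcases h.covN hr hv e with k | k | k
    · exact absurd k hw
    · exact absurd (h.sN2 (by simp) k e.symm) (h.bA hv)
    · simp at hv k
      rcases hv with (rfl | rfl) | (rfl | rfl) | (rfl | rfl) <;>
        rcases k with (rfl | rfl) | (rfl | rfl) | (rfl | rfl) <;>
        simp only [fb1, fb2, fb3, fc1, fc2, fc3] <;>
        first
        | exact absurd e b12
        | exact absurd e b13
        | exact absurd e b23
        | exact absurd e c12
        | exact absurd e c13
        | exact absurd e c23
        | exact absurd e n12
        | exact absurd e n13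
        | exact absurd e n23
        | exact absurd e n21
        | exact absurd e n31
        | exact absurd e n32
        | exact absurd e.symm b12
        | exact absurd e.symm b13
        | exact absurd e.symm b23
        | exact absurd e.symm c12
        | exact absurd e.symm c13
        | exact absurd e.symm c23
        | exact absurd e.symm n12
        | exact absurd e.symm n13
        | exact absurd e.symm n23
        | exact absurd e.symm n21
        | exact absurd e.symm n31
        | exact absurd e.symm n32
  have hrest : ∀ v w, v ∉ As [([b1, c1], M1, a2), ([b2, c2], M2, a3), ([b3, c3], M3, a1)] →
      w ∉ As [([b1, c1], M1, a2), ([b2, c2], M2, a3), ([b3, c3], M3, a1)] → G.Adj v w →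
      ∃ b ∈ [([b1, c1], M1, a2), ([b2, c2], M2, a3), ([b3, c3], M3, a1)], v ∈ b.1 := by
    intro v w hv hw e
    rcases h.cov hr v with k | k
    · subst k; exact absurd ((h.nx w).1 e) hw
    · rcases h.mem.1 k with k | k | k
      · exact absurd k hv
      · exact absurd (h.sN2 (by simp) k e) hw
      · exact k
  have fT : ∀ v ∈ x :: b1 :: b2 :: b3 ::
      Sg [([b1, c1], M1, a2), ([b2, c2], M2, a3), ([b3, c3], M3, a1)], f v = v := by
    intro v hv
    simp only [List.mem_cons] at hv
    rcases hv with rfl | rfl | rfl | rfl | hv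
    · exact fid _ (fun k => hbx c1 (by simp) k.symm) (fun k => hbx c2 (by simp) k.symm)
        (fun k => hbx c3 (by simp) k.symm)
    · exact fb1
    · exact fb2
    · exact fb3
    · refine fid _ ?_ ?_ ?_
      · rintro rfl; exact hbS _ (by simp) hv
      · rintro rfl; exact hbS _ (by simp) hv
      · rintro rfl; exact hbS _ (by simp) hv
  have hTn : (x :: b1 :: b2 :: b3 ::
      Sg [([b1, c1], M1, a2), ([b2, c2], M2, a3), ([b3, c3], M3, a1)]).Nodup := by
    have d12 : b1 ≠ b2 := by rintro rfl; simp at hnd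
    have d13 : b1 ≠ b3 := by rintro rfl; simp at hnd
    have d23 : b2 ≠ b3 := by rintro rfl; simp at hnd
    have e1 := hbx b1 (by simp)
    have e2 := hbx b2 (by simp)
    have e3 := hbx b3 (by simp)
    have g1 := hbS b1 (by simp)
    have g2 := hbS b2 (by simp)
    have g3 := hbS b3 (by simp)
    have hs := (List.nodup_append.1 (List.nodup_append.1 hn0).2.1).1
    have hxs := hxN.2.1
    simp only [List.nodup_cons, List.mem_cons, not_or]
    exact ⟨⟨e1.symm, e2.symm, e3.symm, hxs⟩, ⟨d12, d13, g1⟩, ⟨d23, g2⟩, g3, hs⟩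
  have := tough_label h.cx.tough
    (As [([b1, c1], M1, a2), ([b2, c2], M2, a3), ([b3, c3], M3, a1)]).toFinset
    (x :: b1 :: b2 :: b3 ::
      Sg [([b1, c1], M1, a2), ([b2, c2], M2, a3), ([b3, c3], M3, a1)]).toFinset f (by
      intro u v hu hv e
      rw [List.mem_toFinset] at hu hv
      exact hblob u v (hrest u v hu hv e) hv e) (by
      intro v hv
      rw [List.mem_toFinset] at hv ⊢
      simp only [List.mem_cons] at hv
      rcases hv with rfl | rfl | rfl | rfl | hv
      · exact hxN.1
      · exact hbA _ (by simp)
      · exact hbA _ (by simp)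
      · exact hbA _ (by simp)
      · exact h.sA hv) (by
      intro u hu v hv e
      rw [List.mem_toFinset] at hu hv
      rwa [fT u hu, fT v hv] at e) (by
      rw [List.toFinset_card_of_nodup hTn]; simp)
  rw [List.toFinset_card_of_nodup hTn, List.toFinset_card_of_nodup (List.nodup_append.1 hn0).1]
    at this
  simp only [List.length_cons, List.length_nil] at this hS
  omega

theorem Ctx.false (cx : Ctx G) : False := by
  obtain ⟨x, B, h, hne, h2⟩ := cx.cf
  have h1 := h.len
  have h3 := h.lt
  have h4 := h.hi
  rcases B with _ | ⟨⟨s1, M1, y1⟩, _ | ⟨⟨s2, M2, y2⟩, _ | ⟨⟨s3, M3, y3⟩, B⟩⟩⟩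
  · exact hne rfl
  · have l1 := h2 s1 (by simp)
    simp at h1
    rcases s1 with _ | ⟨p1, _ | ⟨p2, _ | ⟨p3, _ | ⟨p4, _ | ⟨p5, s⟩⟩⟩⟩⟩
    · simp at l1
    · simp at l1
    · exact h.e2
    · exact h.e3
    · exact h.e4
    · simp at h1; omega
  · have l1 := h2 s1 (by simp)
    have l2 := h2 s2 (by simp)
    simp at h1
    have h' := Cf.rot (B1 := [(s1, M1, y1)]) (B2 := [(s2, M2, y2)]) h
    simp only [List.cons_append, List.nil_append] at h'
    rcases s1 with _ | ⟨p1, _ | ⟨p2, _ | ⟨p3, _ | ⟨p4, s⟩⟩⟩⟩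
    · simp at l1
    · simp at l1
    · rcases s2 with _ | ⟨q1, _ | ⟨q2, _ | ⟨q3, _ | ⟨q4, s⟩⟩⟩⟩
      · simp at l2
      · simp at l2
      · exact h.e22
      · exact h'.e32
      · simp at h1; omega
    · rcases s2 with _ | ⟨q1, _ | ⟨q2, _ | ⟨q3, s⟩⟩⟩
      · simp at l2
      · simp at l2
      · exact h.e32
      · simp at h1; omega
    · simp at h1; omega
  · have l1 := h2 s1 (by simp)
    have l2 := h2 s2 (by simp)
    have l3 := h2 s3 (by simp)
    have hB : 2 * B.length ≤ (B.map Prod.fst).flatten.length := by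
      have hB' : ∀ s ∈ B.map Prod.fst, 2 ≤ s.length := fun s hs => h2 s (by
        simp only [List.map_cons, List.mem_cons]
        exact Or.inr (Or.inr (Or.inr hs)))
      clear h1 h2 h3 h4 h hne
      induction B with
      | nil => simp
      | cons b B ih =>
        have i1 := ih (fun s hs => hB' s (by
          simp only [List.map_cons, List.mem_cons]; exact Or.inr hs))
        have i2 := hB' b.1 (by simp)
        simp only [List.map_cons, List.flatten_cons, List.length_append, List.length_cons]
        omega
    simp only [List.map_cons, List.flatten_cons, List.length_append, List.length_cons] at h1
    have hB0 : B = [] := by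
      rw [← List.length_eq_zero_iff]; omega
    subst hB0
    simp only [List.length_nil, List.map_nil, List.flatten_nil] at h1
    have e1 : s1.length = 2 := by omega
    have e2 : s2.length = 2 := by omega
    have e3 : s3.length = 2 := by omega
    obtain ⟨_, _, rfl⟩ := List.length_eq_two.1 e1
    obtain ⟨_, _, rfl⟩ := List.length_eq_two.1 e2
    obtain ⟨_, _, rfl⟩ := List.length_eq_two.1 e3
    exact h.e222

end
end HT

/-- Jung's theorem: a 1-tough graph on `n ≥ 11` vertices in which every pair of
distinct non-adjacent vertices has degree sum at least `n - 4` is Hamiltonian. -/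
theorem hamiltonian_of_tough_of_sigma_two {V : Type u} [Finite V] (G : SimpleGraph V)
    (hn : 11 ≤ Nat.card V) (htough : G.Tough)
    (hsigma : ∀ u v : V, u ≠ v → ¬ G.Adj u v →
      Nat.card V - 4 ≤ Nat.card (G.neighborSet u) + Nat.card (G.neighborSet v)) :
    G.IsHamiltonianGraph := by
  classical
  have := Fintype.ofFinite V
  by_contra hh
  rw [Nat.card_eq_fintype_card] at hn
  refine HT.Ctx.false (G := G) ⟨hn, htough, ?_, ?_⟩
  · intro u v h1 h2
    have := hsigma u v h1 h2
    rw [Nat.card_eq_fintype_card, Nat.card_eq_fintype_card, Nat.card_eq_fintype_card,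
      SimpleGraph.card_neighborSet_eq_degree, SimpleGraph.card_neighborSet_eq_degree] at this
    omega
  · intro l hl hc
    by_contra hlen
    exact hh (HT.ham_of_list (by omega) l hl hc (by omega))
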